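/- There exists a constant C = C(n) > 0 with the following property. Let u be a smooth solution of the biharmonic heat equation on ℝⁿ × [0,∞) such that u(·,0) is bounded, and suppose that for every T > 0 there exist a constant a > 0, a constant R* ≥ 1, and a nondecreasing function L : [1,∞) → (0,∞) with ∫₁^∞ r³ / L(r)³ dr = ∞, such that ∫₀^T t^a ∫_{B(0,R)} u(x,t)² dx dt ≤ exp(L(R)) for all R ≥ R*. Then sup_{x ∈ ℝⁿ} |u(x,t)| ≤ C · sup_{x ∈ ℝⁿ} |u(x,0)| for every t > 0. -/

import Mathlib

open MeasureTheory Metric Set Filter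

/-- The Euclidean Laplacian `Δf = ∑ᵢ ∂²f/∂xᵢ²`. -/
noncomputable def lap {n : ℕ} (f : EuclideanSpace ℝ (Fin n) → ℝ) :
    EuclideanSpace ℝ (Fin n) → ℝ :=
  fun x => ∑ i : Fin n,
    fderiv ℝ (fun y => fderiv ℝ f y (EuclideanSpace.single i 1)) x (EuclideanSpace.single i 1)

/-- `u = u(x,t)` is a smooth solution of the biharmonic heat equation
`∂ₜu = -Δ²u` on the set `S ⊆ ℝⁿ × ℝ`. -/
def IsBiharmonicHeatSol {n : ℕ} (u : EuclideanSpace ℝ (Fin n) → ℝ → ℝ)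
    (S : Set (EuclideanSpace ℝ (Fin n) × ℝ)) : Prop :=
  ContDiffOn ℝ (⊤ : ℕ∞) (fun p => u p.1 p.2) S ∧
  ∀ p ∈ S, HasDerivWithinAt (fun s => u p.1 s)
    (-(lap (lap (fun y => u y p.2)) p.1)) {s | (p.1, s) ∈ S} p.2

open scoped ContDiff

/-- The directional derivative `∂ₑ f`. -/
noncomputable def dirD {F : Type*} [NormedAddCommGroup F] [NormedSpace ℝ F] (e : F) (f : F → ℝ) :
    F → ℝ :=
  fun p => fderiv ℝ f p e

section DirectionalDerivative

variable {F : Type*} [NormedAddCommGroup F] [NormedSpace ℝ F] {Ω : Set F} {f g : F → ℝ}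

theorem ContDiffOn.dirD (hΩ : IsOpen Ω) (hf : ContDiffOn ℝ ∞ f Ω) (e : F) :
    ContDiffOn ℝ ∞ (dirD e f) Ω :=
  (hf.fderiv_of_isOpen hΩ (by simp)).clm_apply contDiffOn_const

theorem ContDiff.dirD {k m : ℕ∞ω} (hf : ContDiff ℝ k f) (h : m + 1 ≤ k) (e : F) :
    ContDiff ℝ m (dirD e f) :=
  (hf.fderiv_right h).clm_apply contDiff_const

theorem Set.EqOn.dirD (hΩ : IsOpen Ω) (h : EqOn f g Ω) (e : F) :
    EqOn (dirD e f) (dirD e g) Ω := fun p hp => by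
  simp only [_root_.dirD]
  rw [Filter.EventuallyEq.fderiv_eq (h.eventuallyEq_of_mem (hΩ.mem_nhds hp))]

theorem dirD_comm (hΩ : IsOpen Ω) (hf : ContDiffOn ℝ ∞ f Ω) (e e' : F) :
    EqOn (dirD e (dirD e' f)) (dirD e' (dirD e f)) Ω := fun p hp => by
  have hc : ContDiffAt ℝ ∞ f p := hf.contDiffAt (hΩ.mem_nhds hp)
  have hs : IsSymmSndFDerivAt ℝ f p := hc.isSymmSndFDerivAt (by
    rw [minSmoothness_of_isRCLikeNormedField]; exact WithTop.coe_le_coe.2 (le_top : (2 : ℕ∞) ≤ ⊤))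
  have hd : DifferentiableAt ℝ (fderiv ℝ f) p :=
    (hc.fderiv_right (m := ∞) (by simp)).differentiableAt (by simp)
  have key : ∀ a b : F, dirD a (dirD b f) p = fderiv ℝ (fderiv ℝ f) p a b := fun a b => by
    have : dirD b f = fun x => fderiv ℝ f x b := rfl
    rw [this, dirD, fderiv_clm_apply hd (differentiableAt_const b)]
    simp
  rw [key, key, hs.eq]

theorem dirD_neg (e : F) : dirD e (fun x => -f x) = fun x => -dirD e f x := by
  ext x; simp [dirD, fderiv_fun_neg]

theorem dirD_sum {ι : Type*} (s : Finset ι) (G : ι → F → ℝ) (e : F) {p : F}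
    (h : ∀ i ∈ s, DifferentiableAt ℝ (G i) p) :
    dirD e (fun x => ∑ i ∈ s, G i x) p = ∑ i ∈ s, dirD e (G i) p := by
  simp only [dirD]
  rw [fderiv_fun_sum h]
  simp

theorem dirD_mul (e : F) {p : F} (hf : DifferentiableAt ℝ f p) (hg : DifferentiableAt ℝ g p) :
    dirD e (fun x => f x * g x) p = dirD e f p * g p + f p * dirD e g p := by
  simp only [dirD]
  rw [fderiv_fun_mul hf hg]
  simp only [add_apply, smul_apply, smul_eq_mul]
  ring

theorem dirD_add (e : F) {p : F} (hf : DifferentiableAt ℝ f p) (hg : DifferentiableAt ℝ g p) :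
    dirD e (fun x => f x + g x) p = dirD e f p + dirD e g p := by
  simp only [dirD]
  rw [fderiv_fun_add hf hg]
  simp

end DirectionalDerivative

section Laplacian

variable {n : ℕ}

/-- The `i`-th coordinate direction of `ℝⁿ`. -/
noncomputable abbrev coordDir (i : Fin n) : EuclideanSpace ℝ (Fin n) := EuclideanSpace.single i 1

theorem lap_eq_sum (f : EuclideanSpace ℝ (Fin n) → ℝ) (x : EuclideanSpace ℝ (Fin n)) :
    lap f x = ∑ i, dirD (coordDir i) (dirD (coordDir i) f) x := rfl

theorem ContDiff.lap {f : EuclideanSpace ℝ (Fin n) → ℝ} {k m : ℕ∞ω} (hf : ContDiff ℝ k f)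
    (h : m + 1 + 1 ≤ k) : ContDiff ℝ m (lap f) := by
  have : _root_.lap f = fun x => ∑ i, _root_.dirD (coordDir i) (_root_.dirD (coordDir i) f) x := rfl
  rw [this]
  exact ContDiff.sum fun i _ => (hf.dirD h _).dirD le_rfl _

/-- The Laplacian in the space variable of a function of `(x, t)`. -/
noncomputable def stLap (V : EuclideanSpace ℝ (Fin n) × ℝ → ℝ) :
    EuclideanSpace ℝ (Fin n) × ℝ → ℝ :=
  fun p => ∑ i, dirD (coordDir i, 0) (dirD (coordDir i, 0) V) p

/-- The open upper half of space-time. -/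
def upperHalf (n : ℕ) : Set (EuclideanSpace ℝ (Fin n) × ℝ) := {p | 0 < p.2}

theorem isOpen_upperHalf : IsOpen (upperHalf n) := isOpen_lt continuous_const continuous_snd

theorem ContDiffOn.stLap {V : EuclideanSpace ℝ (Fin n) × ℝ → ℝ}
    (hV : ContDiffOn ℝ ∞ V (upperHalf n)) : ContDiffOn ℝ ∞ (stLap V) (upperHalf n) := by
  have : _root_.stLap V =
    fun x => ∑ i, _root_.dirD (coordDir i, 0) (_root_.dirD (coordDir i, 0) V) x := rfl
  rw [this]
  exact ContDiffOn.sum fun i _ => (hV.dirD isOpen_upperHalf _).dirD isOpen_upperHalf _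

theorem Set.EqOn.stLap {V U : EuclideanSpace ℝ (Fin n) × ℝ → ℝ} (h : EqOn V U (upperHalf n)) :
    EqOn (stLap V) (stLap U) (upperHalf n) := fun p hp => by
  simp only [_root_.stLap]
  exact Finset.sum_congr rfl fun i _ => (h.dirD isOpen_upperHalf _).dirD isOpen_upperHalf _ hp

theorem stLap_dirD {V : EuclideanSpace ℝ (Fin n) × ℝ → ℝ} (hV : ContDiffOn ℝ ∞ V (upperHalf n))
    (e : EuclideanSpace ℝ (Fin n) × ℝ) :
    EqOn (stLap (dirD e V)) (dirD e (stLap V)) (upperHalf n) := fun p hp => by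
  have h0 := isOpen_upperHalf (n := n)
  have hl : stLap V = fun x => ∑ i, dirD (coordDir i, 0) (dirD (coordDir i, 0) V) x := rfl
  rw [hl, dirD_sum]
  · rw [stLap]
    refine Finset.sum_congr rfl fun i _ => ?_
    rw [dirD_comm h0 (hV.dirD h0 _) e _ hp]
    exact (dirD_comm h0 hV _ _).dirD h0 _ hp
  · intro i _
    exact (((hV.dirD h0 _).dirD h0 _).contDiffAt (h0.mem_nhds hp)).differentiableAt (by simp)

theorem dirD_slice {V : EuclideanSpace ℝ (Fin n) × ℝ → ℝ} {x e : EuclideanSpace ℝ (Fin n)} {t : ℝ}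
    (hV : DifferentiableAt ℝ V (x, t)) :
    dirD e (fun y => V (y, t)) x = dirD (e, 0) V (x, t) := by
  simp only [dirD]
  have h : HasFDerivAt (fun y : EuclideanSpace ℝ (Fin n) => (y, t))
      ((ContinuousLinearMap.id ℝ _).prod 0) x :=
    (hasFDerivAt_id x).prodMk (hasFDerivAt_const t x)
  have h2 : HasFDerivAt (fun y => V (y, t)) _ x := HasFDerivAt.comp x hV.hasFDerivAt h
  rw [h2.fderiv]
  simp

theorem lap_slice {V : EuclideanSpace ℝ (Fin n) × ℝ → ℝ} (hV : ContDiffOn ℝ ∞ V (upperHalf n))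
    {t : ℝ} (ht : 0 < t) (x : EuclideanSpace ℝ (Fin n)) :
    lap (fun y => V (y, t)) x = stLap V (x, t) := by
  have h0 := isOpen_upperHalf (n := n)
  have hd : ∀ {U : EuclideanSpace ℝ (Fin n) × ℝ → ℝ}, ContDiffOn ℝ ∞ U (upperHalf n) →
      ∀ y : EuclideanSpace ℝ (Fin n), DifferentiableAt ℝ U (y, t) := fun hU y =>
    (hU.contDiffAt (h0.mem_nhds (show (y, t) ∈ upperHalf n from ht))).differentiableAt (by simp)
  rw [lap_eq_sum]
  simp only [stLap]
  refine Finset.sum_congr rfl fun i _ => ?_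
  have : dirD (coordDir i) (fun y => V (y, t)) = fun y => dirD (coordDir i, 0) V (y, t) :=
    funext fun y => dirD_slice (hd hV y)
  rw [this, dirD_slice (hd (hV.dirD h0 _) x)]

theorem contDiff_slice {V : EuclideanSpace ℝ (Fin n) × ℝ → ℝ}
    (hV : ContDiffOn ℝ ∞ V (upperHalf n)) {t : ℝ} (ht : 0 < t) :
    ContDiff ℝ ∞ fun y => V (y, t) :=
  hV.comp_contDiff (contDiff_id.prodMk contDiff_const) fun _ => ht

/-- Smooth solutions of `∂ₜV = -Δ²V` for positive times. -/
structure IsBiharmonicSol (V : EuclideanSpace ℝ (Fin n) × ℝ → ℝ) : Prop where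
  smooth : ContDiffOn ℝ ∞ V (upperHalf n)
  eqn : EqOn (dirD (0, 1) V) (fun p => -stLap (stLap V) p) (upperHalf n)

theorem IsBiharmonicSol.dirD {V : EuclideanSpace ℝ (Fin n) × ℝ → ℝ} (hV : IsBiharmonicSol V)
    (e : EuclideanSpace ℝ (Fin n) × ℝ) : IsBiharmonicSol (dirD e V) where
  smooth := hV.smooth.dirD isOpen_upperHalf e
  eqn := fun p hp => by
    have h0 := isOpen_upperHalf (n := n)
    rw [dirD_comm h0 hV.smooth _ _ hp, hV.eqn.dirD h0 e hp, dirD_neg]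
    simp only [(stLap_dirD hV.smooth e).stLap hp, stLap_dirD hV.smooth.stLap e hp]

theorem IsBiharmonicSol.hasDerivAt {V : EuclideanSpace ℝ (Fin n) × ℝ → ℝ}
    (hV : IsBiharmonicSol V) (x : EuclideanSpace ℝ (Fin n)) {t : ℝ} (ht : 0 < t) :
    HasDerivAt (fun s => V (x, s)) (-lap (lap fun y => V (y, t)) x) t := by
  have hp : (x, t) ∈ upperHalf n := ht
  have hd : DifferentiableAt ℝ V (x, t) :=
    (hV.smooth.contDiffAt (isOpen_upperHalf.mem_nhds hp)).differentiableAt (by simp)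
  have h : HasDerivAt (fun s : ℝ => (x, s)) ((0, 1) : EuclideanSpace ℝ (Fin n) × ℝ) t :=
    (hasDerivAt_const t x).prodMk (hasDerivAt_id t)
  have h2 := hd.hasFDerivAt.comp_hasDerivAt t h
  have h3 := hV.eqn hp
  have h4 : lap (fun y => V (y, t)) = fun y => stLap V (y, t) :=
    funext fun y => lap_slice hV.smooth ht y
  rw [h4, lap_slice hV.smooth.stLap ht]
  refine h2.congr_deriv ?_
  exact h3

end Laplacian

section Green

variable {n : ℕ}

theorem HasCompactSupport.dirD {f : EuclideanSpace ℝ (Fin n) → ℝ} (hf : HasCompactSupport f)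
    (e : EuclideanSpace ℝ (Fin n)) : HasCompactSupport (dirD e f) :=
  hf.fderiv_apply (𝕜 := ℝ) e

theorem HasCompactSupport.lap {f : EuclideanSpace ℝ (Fin n) → ℝ} (hf : HasCompactSupport f) :
    HasCompactSupport (lap f) := by
  refine HasCompactSupport.intro hf (K := tsupport f) fun x hx => ?_
  rw [lap_eq_sum]
  refine Finset.sum_eq_zero fun i _ => ?_
  by_contra hne
  refine hx ((tsupport_fderiv_apply_subset ℝ (coordDir i)).trans ?_ (subset_tsupport _ hne))
  exact tsupport_fderiv_apply_subset ℝ (coordDir i)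

theorem integral_mul_dirD {f g : EuclideanSpace ℝ (Fin n) → ℝ} (hf : ContDiff ℝ 1 f)
    (hg : ContDiff ℝ 1 g) (hc : HasCompactSupport f) (e : EuclideanSpace ℝ (Fin n)) :
    ∫ x, f x * dirD e g x = -∫ x, dirD e f x * g x := by
  have hf' : Continuous (dirD e f) := (hf.dirD (m := 0) (by simp) e).continuous
  have hg' : Continuous (dirD e g) := (hg.dirD (m := 0) (by simp) e).continuous
  refine integral_mul_fderiv_eq_neg_fderiv_mul_of_integrable ?_ ?_ ?_
    (fun x _ => hf.differentiable (by simp) x) (fun x _ => hg.differentiable (by simp) x)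
  · exact (hf'.mul hg.continuous).integrable_of_hasCompactSupport (hc.dirD e).mul_right
  · exact (hf.continuous.mul hg').integrable_of_hasCompactSupport hc.mul_right
  · exact (hf.continuous.mul hg.continuous).integrable_of_hasCompactSupport hc.mul_right

/-- Green's identity for a compactly supported `f`. -/
theorem integral_mul_lap {f g : EuclideanSpace ℝ (Fin n) → ℝ} (hf : ContDiff ℝ 2 f)
    (hg : ContDiff ℝ 2 g) (hc : HasCompactSupport f) :
    ∫ x, f x * lap g x = ∫ x, lap f x * g x := by
  have h12 : (1 : ℕ∞ω) + 1 ≤ 2 := by norm_num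
  have h01 : (0 : ℕ∞ω) + 1 ≤ 1 := by norm_num
  simp only [lap_eq_sum, Finset.mul_sum, Finset.sum_mul]
  rw [integral_finsetSum, integral_finsetSum]
  · refine Finset.sum_congr rfl fun i _ => ?_
    rw [integral_mul_dirD (hf.of_le (by norm_num)) (hg.dirD h12 _) hc]
    have := integral_mul_dirD (hf.dirD h12 (coordDir i)) (hg.of_le (by norm_num))
      (hc.dirD (coordDir i)) (coordDir i)
    rw [this, neg_neg]
  · intro i _
    exact (((hf.dirD h12 _).dirD h01 _).continuous.mul hg.continuous
      ).integrable_of_hasCompactSupport ((hc.dirD _).dirD _).mul_right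
  · intro i _
    exact (hf.continuous.mul ((hg.dirD h12 _).dirD h01 _).continuous
      ).integrable_of_hasCompactSupport hc.mul_right

/-- The squared length of the gradient. -/
noncomputable def gradSq (f : EuclideanSpace ℝ (Fin n) → ℝ) (x : EuclideanSpace ℝ (Fin n)) : ℝ :=
  ∑ i, dirD (coordDir i) f x ^ 2

theorem lap_mul {f g : EuclideanSpace ℝ (Fin n) → ℝ} (hf : ContDiff ℝ 2 f) (hg : ContDiff ℝ 2 g)
    (x : EuclideanSpace ℝ (Fin n)) :
    lap (fun y => f y * g y) x = lap f x * g x +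
      2 * ∑ i, dirD (coordDir i) f x * dirD (coordDir i) g x + f x * lap g x := by
  have h12 : (1 : ℕ∞ω) + 1 ≤ 2 := by norm_num
  simp only [lap_eq_sum, Finset.mul_sum, Finset.sum_mul, ← Finset.sum_add_distrib]
  refine Finset.sum_congr rfl fun i _ => ?_
  have hdf := hf.differentiable (by norm_num)
  have hdg := hg.differentiable (by norm_num)
  have hdf' := (hf.dirD h12 (coordDir i)).differentiable (by norm_num)
  have hdg' := (hg.dirD h12 (coordDir i)).differentiable (by norm_num)
  have h1 : dirD (coordDir i) (fun y => f y * g y) =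
      fun y => dirD (coordDir i) f y * g y + f y * dirD (coordDir i) g y :=
    funext fun y => dirD_mul _ (hdf y) (hdg y)
  have ha : DifferentiableAt ℝ (fun y => dirD (coordDir i) f y * g y) x := (hdf' x).mul (hdg x)
  have hb : DifferentiableAt ℝ (fun y => f y * dirD (coordDir i) g y) x := (hdf x).mul (hdg' x)
  rw [h1, dirD_add _ ha hb,
    dirD_mul _ (hdf' x) (hdg x), dirD_mul _ (hdf x) (hdg' x)]
  ring

theorem le_add_of_sq_le_four_mul {x p q : ℝ} (hp : 0 ≤ p) (hq : 0 ≤ q) (h : x ^ 2 ≤ 4 * (p * q)) :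
    x ≤ p + q :=
  le_of_sq_le_sq (by nlinarith [sq_nonneg (p - q)]) (by positivity)

theorem energy_density_le {w θ α a b v g G N : ℝ} (hw : 0 ≤ w) (hθ : 0 ≤ θ) (hα : 0 ≤ α)
    (hN : 0 ≤ N) (hG : G ^ 2 ≤ w * θ * N) (hθα : θ ^ 2 ≤ w * α) (ha : a ^ 2 ≤ w * α)
    (hb : |b| ≤ α) :
    -2 * ((a * v + 2 * G + w * g) * g) + 9 / 2 * (b * v ^ 2) - 9 * (θ * v * g) - 8 * (θ * N) ≤
      50 * α * v ^ 2 := by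
  have h1 : -2 * (a * v * g) ≤ 1 / 2 * (w * g ^ 2) + 2 * (α * v ^ 2) := by
    refine le_add_of_sq_le_four_mul (by positivity) (by positivity) ?_
    nlinarith [mul_le_mul_of_nonneg_right ha (by positivity : 0 ≤ (v * g) ^ 2)]
  have h2 : -4 * (G * g) ≤ 1 / 2 * (w * g ^ 2) + 8 * (θ * N) := by
    refine le_add_of_sq_le_four_mul (by positivity) (by positivity) ?_
    nlinarith [mul_le_mul_of_nonneg_right hG (by positivity : 0 ≤ g ^ 2)]
  have h3 : -9 * (θ * v * g) ≤ 1 / 2 * (w * g ^ 2) + 81 / 2 * (α * v ^ 2) := by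
    refine le_add_of_sq_le_four_mul (by positivity) (by positivity) ?_
    nlinarith [mul_le_mul_of_nonneg_right hθα (by positivity : 0 ≤ (v * g) ^ 2)]
  have h4 : b * v ^ 2 ≤ α * v ^ 2 :=
    mul_le_mul_of_nonneg_right ((le_abs_self b).trans hb) (by positivity)
  have h5 : 0 ≤ w * g ^ 2 := by positivity
  have h6 : 0 ≤ α * v ^ 2 := by positivity
  nlinarith

/-- The weighted energy inequality at a fixed time. -/
theorem integral_energy_le {v w θ ρ : EuclideanSpace ℝ (Fin n) → ℝ} (hv : ContDiff ℝ 4 v)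
    (hw : ContDiff ℝ 2 w) (hθ : ContDiff ℝ 2 θ) (hwc : HasCompactSupport w)
    (hθc : HasCompactSupport θ) (hρ : Integrable fun x => ρ x * v x ^ 2)
    (h : ∀ x, 0 ≤ w x ∧ 0 ≤ θ x ∧ gradSq w x ≤ w x * θ x ∧ ∃ α, 0 ≤ α ∧ θ x ^ 2 ≤ w x * α ∧
      lap w x ^ 2 ≤ w x * α ∧ |lap θ x| ≤ α ∧ 50 * α ≤ ρ x) :
    ∫ x, (-2 * (w x * v x * lap (lap v) x) + θ x * gradSq v x) ≤ ∫ x, ρ x * v x ^ 2 := by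
  have hv2 : ContDiff ℝ 2 v := hv.of_le (by norm_num)
  have hg : ContDiff ℝ 2 (lap v) := hv.lap (by norm_num)
  have hwv : ContDiff ℝ 2 fun x => w x * v x := hw.mul hv2
  have hvv : ContDiff ℝ 2 fun x => v x * v x := hv2.mul hv2
  have hgrad : Continuous (gradSq v) := by
    have : gradSq v = fun x => ∑ i, dirD (coordDir i) v x ^ 2 := rfl
    rw [this]
    exact continuous_finsetSum _ fun i _ =>
      ((hv2.dirD (m := 1) (by norm_num) _).continuous.pow 2)
  have c4 : Continuous (lap (lap v)) := (hg.lap (m := 0) (by norm_num)).continuous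
  have cθ : Continuous (lap θ) := (hθ.lap (m := 0) (by norm_num)).continuous
  have cwv : Continuous (lap fun x => w x * v x) := (hwv.lap (m := 0) (by norm_num)).continuous
  have hθlc : HasCompactSupport (lap θ) := hθc.lap
  have hwlc : HasCompactSupport (lap fun x => w x * v x) := HasCompactSupport.lap hwc.mul_right
  have g1 : ∫ x, w x * v x * lap (lap v) x = ∫ x, lap (fun y => w y * v y) x * lap v x :=
    integral_mul_lap hwv hg hwc.mul_right
  have g2 : ∫ x, θ x * lap (fun y => v y * v y) x = ∫ x, lap θ x * (v x * v x) :=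
    integral_mul_lap hθ hvv hθc
  have lvv : ∀ x, lap (fun y => v y * v y) x = 2 * (v x * lap v x) + 2 * gradSq v x := fun x => by
    rw [lap_mul hv2 hv2, gradSq]
    simp only [← pow_two]
    ring
  have i1 : Integrable fun x => w x * v x * lap (lap v) x :=
    (hwv.continuous.mul c4).integrable_of_hasCompactSupport
      (HasCompactSupport.mul_right hwc.mul_right)
  have i2 : Integrable fun x => θ x * gradSq v x :=
    (hθ.continuous.mul hgrad).integrable_of_hasCompactSupport hθc.mul_right
  have i3 : Integrable fun x => lap (fun y => w y * v y) x * lap v x :=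
    (cwv.mul hg.continuous).integrable_of_hasCompactSupport hwlc.mul_right
  have i4 : Integrable fun x => lap θ x * (v x * v x) :=
    (cθ.mul hvv.continuous).integrable_of_hasCompactSupport hθlc.mul_right
  have i5 : Integrable fun x => θ x * (v x * lap v x) :=
    (hθ.continuous.mul (hv2.continuous.mul hg.continuous)).integrable_of_hasCompactSupport
      hθc.mul_right
  have e2 : 2 * ∫ x, θ x * (v x * lap v x) = (∫ x, lap θ x * (v x * v x)) -
      2 * ∫ x, θ x * gradSq v x := by
    rw [← g2, ← integral_const_mul, ← integral_const_mul, ← integral_sub]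
    · refine integral_congr_ae (ae_of_all _ fun x => ?_)
      simp only [lvv]
      ring
    · have : (fun x => θ x * lap (fun y => v y * v y) x) =
          fun x => 2 * (θ x * (v x * lap v x)) + 2 * (θ x * gradSq v x) := by
        funext x; rw [lvv]; ring
      rw [this]
      exact (i5.const_mul 2).add (i2.const_mul 2)
    · exact i2.const_mul 2
  have i6 : Integrable fun x => -2 * (lap (fun y => w y * v y) x * lap v x) := i3.const_mul _
  have i7 : Integrable fun x => 9 / 2 * (lap θ x * (v x * v x)) := i4.const_mul _
  have i8 : Integrable fun x => 9 * (θ x * (v x * lap v x)) := i5.const_mul _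
  have i9 : Integrable fun x => 8 * (θ x * gradSq v x) := i2.const_mul _
  have key : ∫ x, (-2 * (w x * v x * lap (lap v) x) + θ x * gradSq v x) =
      ∫ x, (-2 * (lap (fun y => w y * v y) x * lap v x) + 9 / 2 * (lap θ x * (v x * v x))
        - 9 * (θ x * (v x * lap v x)) - 8 * (θ x * gradSq v x)) := by
    have i67 : Integrable fun x => -2 * (lap (fun y => w y * v y) x * lap v x) +
        9 / 2 * (lap θ x * (v x * v x)) := i6.add i7
    have i678 : Integrable fun x => -2 * (lap (fun y => w y * v y) x * lap v x) +
        9 / 2 * (lap θ x * (v x * v x)) - 9 * (θ x * (v x * lap v x)) := i67.sub i8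
    rw [integral_add (i1.const_mul _) i2, integral_sub i678 i9,
      integral_sub i67 i8, integral_add i6 i7]
    simp only [integral_const_mul]
    rw [g1]
    linarith
  rw [key]
  refine integral_mono (((i6.add i7).sub i8).sub i9) hρ fun x => ?_
  obtain ⟨hw0, hθ0, hgw, α, hα, hθα, ha, hb, hρα⟩ := h x
  have hCS : (∑ i, dirD (coordDir i) w x * dirD (coordDir i) v x) ^ 2 ≤
      w x * θ x * gradSq v x :=
    (Finset.sum_mul_sq_le_sq_mul_sq _ _ _).trans
      (mul_le_mul_of_nonneg_right hgw (Finset.sum_nonneg fun i _ => sq_nonneg _))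
  have := energy_density_le (v := v x) (g := lap v x) hw0 hθ0 hα
    (Finset.sum_nonneg fun i _ => sq_nonneg _) hCS hθα ha hb
  have h2 : 50 * α * v x ^ 2 ≤ ρ x * v x ^ 2 := mul_le_mul_of_nonneg_right hρα (sq_nonneg _)
  refine le_trans (le_of_eq ?_) (this.trans h2)
  simp only [lap_mul hw hv2, gradSq]
  ring

end Green

section Radial

variable {n : ℕ}

/-- The smooth radial function `√(1 + ‖x‖²)`. -/
noncomputable def japanese (x : EuclideanSpace ℝ (Fin n)) : ℝ := √(1 + ‖x‖ ^ 2)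

theorem one_le_japanese (x : EuclideanSpace ℝ (Fin n)) : 1 ≤ japanese x :=
  Real.one_le_sqrt.2 (by nlinarith [sq_nonneg ‖x‖])

theorem japanese_pos (x : EuclideanSpace ℝ (Fin n)) : 0 < japanese x :=
  one_pos.trans_le (one_le_japanese x)

theorem japanese_sq (x : EuclideanSpace ℝ (Fin n)) : japanese x ^ 2 = 1 + ‖x‖ ^ 2 :=
  Real.sq_sqrt (by positivity)

theorem norm_le_japanese (x : EuclideanSpace ℝ (Fin n)) : ‖x‖ ≤ japanese x :=
  Real.le_sqrt_of_sq_le (by linarith)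

theorem contDiff_japanese {k : ℕ∞ω} : ContDiff ℝ k (japanese (n := n)) :=
  (contDiff_const.add (contDiff_norm_sq ℝ)).sqrt fun x => by positivity

theorem continuous_japanese : Continuous (japanese (n := n)) :=
  (contDiff_japanese (k := 0)).continuous

theorem hasFDerivAt_japanese (x : EuclideanSpace ℝ (Fin n)) :
    HasFDerivAt japanese ((1 / japanese x) • innerSL ℝ x) x := by
  have h : HasFDerivAt (fun y : EuclideanSpace ℝ (Fin n) => 1 + ‖y‖ ^ 2) (2 • innerSL ℝ x) x :=
    ((hasStrictFDerivAt_norm_sq x).hasFDerivAt).const_add 1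
  have h2 := h.sqrt (by positivity)
  refine h2.congr_fderiv ?_
  ext y
  simp only [japanese, smul_apply, smul_eq_mul, nsmul_eq_mul]
  push_cast
  field_simp

theorem dirD_japanese (x : EuclideanSpace ℝ (Fin n)) (i : Fin n) :
    dirD (coordDir i) japanese x = x i / japanese x := by
  rw [dirD, (hasFDerivAt_japanese x).fderiv]
  simp [EuclideanSpace.inner_single_right]
  ring

theorem dirD_comp {F : Type*} [NormedAddCommGroup F] [NormedSpace ℝ F] {W : ℝ → ℝ} {W' : ℝ}
    {f : F → ℝ} {x : F} (hW : HasDerivAt W W' (f x)) (hf : DifferentiableAt ℝ f x) (e : F) :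
    dirD e (fun y => W (f y)) x = W' * dirD e f x := by
  have h : HasFDerivAt (fun y => W (f y)) _ x := hW.comp_hasFDerivAt x hf.hasFDerivAt
  rw [dirD, h.fderiv]
  simp [dirD]

theorem dirD_coord (x : EuclideanSpace ℝ (Fin n)) (i : Fin n) :
    dirD (coordDir i) (fun y => y i) x = 1 := by
  have h : HasFDerivAt (fun y : EuclideanSpace ℝ (Fin n) => y i)
      (EuclideanSpace.proj i : EuclideanSpace ℝ (Fin n) →L[ℝ] ℝ) x :=
    (EuclideanSpace.proj i : EuclideanSpace ℝ (Fin n) →L[ℝ] ℝ).hasFDerivAt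
  rw [dirD, h.fderiv]
  simp

theorem dirD_radial {W W1 : ℝ → ℝ} (h1 : ∀ s, HasDerivAt W (W1 s) s)
    (x : EuclideanSpace ℝ (Fin n)) (i : Fin n) :
    dirD (coordDir i) (fun y => W (japanese y)) x = W1 (japanese x) * (x i / japanese x) := by
  rw [dirD_comp (h1 _) (hasFDerivAt_japanese x).differentiableAt, dirD_japanese]

theorem gradSq_radial_le {W W1 : ℝ → ℝ} (h1 : ∀ s, HasDerivAt W (W1 s) s)
    (x : EuclideanSpace ℝ (Fin n)) :
    gradSq (fun y => W (japanese y)) x ≤ W1 (japanese x) ^ 2 := by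
  simp only [gradSq, dirD_radial h1, mul_pow, div_pow]
  rw [← Finset.mul_sum, ← Finset.sum_div]
  have h : ∑ i, x i ^ 2 = ‖x‖ ^ 2 := by
    rw [EuclideanSpace.norm_sq_eq]; simp
  rw [h]
  refine mul_le_of_le_one_right (sq_nonneg _) ?_
  rw [div_le_one (by positivity [japanese_pos x]), japanese_sq]
  linarith

theorem lap_radial {W W1 W2 : ℝ → ℝ} (h1 : ∀ s, HasDerivAt W (W1 s) s)
    (h2 : ∀ s, HasDerivAt W1 (W2 s) s) (x : EuclideanSpace ℝ (Fin n)) :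
    lap (fun y => W (japanese y)) x = W2 (japanese x) * (‖x‖ ^ 2 / japanese x ^ 2) +
      W1 (japanese x) * (n / japanese x - ‖x‖ ^ 2 / japanese x ^ 3) := by
  have hq := japanese_pos x
  have h : ∑ i, x i ^ 2 = ‖x‖ ^ 2 := by
    rw [EuclideanSpace.norm_sq_eq]; simp
  have hd := (hasFDerivAt_japanese x).differentiableAt
  have key : ∀ i : Fin n, dirD (coordDir i) (dirD (coordDir i) fun y => W (japanese y)) x =
      W2 (japanese x) / japanese x ^ 2 * x i ^ 2 + (W1 (japanese x) / japanese x -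
        W1 (japanese x) / japanese x ^ 3 * x i ^ 2) := fun i => by
    have e1 : (dirD (coordDir i) fun y => W (japanese y)) =
        fun y => (W1 (japanese y) * (japanese y)⁻¹) * y i := by
      funext y; rw [dirD_radial h1]; ring
    have d1 : DifferentiableAt ℝ (fun y : EuclideanSpace ℝ (Fin n) => W1 (japanese y)) x :=
      (h2 _).differentiableAt.comp x hd
    have d2 : DifferentiableAt ℝ (fun y : EuclideanSpace ℝ (Fin n) => (japanese y)⁻¹) x :=
      hd.inv hq.ne'
    have d3 : DifferentiableAt ℝ (fun y : EuclideanSpace ℝ (Fin n) => y i) x :=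
      (EuclideanSpace.proj i : EuclideanSpace ℝ (Fin n) →L[ℝ] ℝ).differentiableAt
    have d4 : DifferentiableAt ℝ
      (fun y : EuclideanSpace ℝ (Fin n) => W1 (japanese y) * (japanese y)⁻¹) x := d1.mul d2
    rw [e1, dirD_mul _ d4 d3, dirD_mul _ d1 d2, dirD_comp (h2 _) hd,
      dirD_comp (hasDerivAt_inv hq.ne') hd, dirD_japanese, dirD_coord]
    field_simp
    ring
  rw [lap_eq_sum, Finset.sum_congr rfl fun i _ => key i, Finset.sum_add_distrib,
    Finset.sum_sub_distrib, ← Finset.mul_sum, ← Finset.mul_sum, h]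
  simp only [Finset.sum_const, Finset.card_univ, Fintype.card_fin, nsmul_eq_mul]
  ring

theorem abs_lap_radial_le {W W1 W2 : ℝ → ℝ} (h1 : ∀ s, HasDerivAt W (W1 s) s)
    (h2 : ∀ s, HasDerivAt W1 (W2 s) s) (x : EuclideanSpace ℝ (Fin n)) :
    |lap (fun y => W (japanese y)) x| ≤
      |W2 (japanese x)| + (n + 1) * |W1 (japanese x)| := by
  rw [lap_radial h1 h2]
  have hq1 := one_le_japanese x
  have hq := japanese_pos x
  have hsq := japanese_sq x
  have a1 : ‖x‖ ^ 2 / japanese x ^ 2 ≤ 1 := by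
    rw [div_le_one (by positivity)]; linarith
  have a0 : 0 ≤ ‖x‖ ^ 2 / japanese x ^ 2 := by positivity
  have a2 : |n / japanese x - ‖x‖ ^ 2 / japanese x ^ 3| ≤ (n : ℝ) + 1 := by
    have b1 : n / japanese x ≤ (n : ℝ) := div_le_self (by positivity) hq1
    have b2 : 0 ≤ n / japanese x := by positivity
    have b3 : ‖x‖ ^ 2 / japanese x ^ 3 ≤ 1 := by
      rw [div_le_one (by positivity)]
      nlinarith [sq_nonneg (japanese x)]
    have b4 : 0 ≤ ‖x‖ ^ 2 / japanese x ^ 3 := by positivity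
    rw [abs_le]; constructor <;> linarith
  refine (abs_add_le _ _).trans (add_le_add ?_ ?_)
  · rw [abs_mul, abs_of_nonneg a0]
    exact mul_le_of_le_one_right (abs_nonneg _) a1
  · rw [abs_mul, mul_comm]
    exact mul_le_mul_of_nonneg_right a2 (abs_nonneg _)

theorem contDiff_two_of_hasDerivAt {W W1 W2 : ℝ → ℝ} (h1 : ∀ s, HasDerivAt W (W1 s) s)
    (h2 : ∀ s, HasDerivAt W1 (W2 s) s) (h3 : Continuous W2) : ContDiff ℝ 2 W := by
  have e1 : deriv W = W1 := funext fun s => (h1 s).deriv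
  have e2 : deriv W1 = W2 := funext fun s => (h2 s).deriv
  have c1 : ContDiff ℝ 1 W1 := contDiff_one_iff_deriv.2
    ⟨fun s => (h2 s).differentiableAt, e2 ▸ h3⟩
  have : (2 : ℕ∞ω) = 1 + 1 := by norm_num
  rw [this, contDiff_succ_iff_deriv]
  exact ⟨fun s => (h1 s).differentiableAt, by simp, e1 ▸ c1⟩

/-- The sublevel sets of `√(1 + ‖x‖²)`. -/
def jball (n : ℕ) (Q : ℝ) : Set (EuclideanSpace ℝ (Fin n)) := {x | japanese x < Q}

theorem isOpen_jball (Q : ℝ) : IsOpen (jball n Q) := isOpen_lt continuous_japanese continuous_const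

theorem measurableSet_jball (Q : ℝ) : MeasurableSet (jball n Q) := (isOpen_jball Q).measurableSet

theorem jball_subset (Q : ℝ) : jball n Q ⊆ ball 0 Q := fun x hx => by
  rw [mem_ball_zero_iff]; exact (norm_le_japanese x).trans_lt hx

theorem volume_jball_lt_top (Q : ℝ) : volume (jball n Q) < ⊤ :=
  (measure_mono (jball_subset Q)).trans_lt measure_ball_lt_top

theorem hasCompactSupport_radial {W : ℝ → ℝ} {Q : ℝ} (h : ∀ s, Q ≤ s → W s = 0) :
    HasCompactSupport fun x : EuclideanSpace ℝ (Fin n) => W (japanese x) :=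
  HasCompactSupport.intro (isCompact_closedBall 0 Q) fun x hx => h _ <| by
    rw [mem_closedBall_zero_iff, not_le] at hx
    exact hx.le.trans (norm_le_japanese x)

theorem exists_bound_closedBall {G : EuclideanSpace ℝ (Fin n) × ℝ → ℝ} {a b : ℝ} (Q : ℝ)
    (hG : ContinuousOn G (univ ×ˢ Icc a b)) :
    ∃ C, ∀ x ∈ jball n Q, ∀ t ∈ Icc a b, ‖G (x, t)‖ ≤ C := by
  obtain ⟨C, hC⟩ := ((isCompact_closedBall (0 : EuclideanSpace ℝ (Fin n)) Q).prod
    (isCompact_Icc (a := a) (b := b))).exists_bound_of_continuousOn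
    (hG.mono (prod_mono (subset_univ _) subset_rfl))
  exact ⟨C, fun x hx t ht => hC (x, t) ⟨ball_subset_closedBall (jball_subset Q hx), ht⟩⟩

theorem continuous_slice_of_continuousOn {G : EuclideanSpace ℝ (Fin n) × ℝ → ℝ} {a b t : ℝ}
    (hG : ContinuousOn G (univ ×ˢ Icc a b)) (ht : t ∈ Icc a b) : Continuous fun x => G (x, t) :=
  hG.comp_continuous (by fun_prop) fun _ => ⟨mem_univ _, ht⟩

theorem integrableOn_jball_of_continuous {f : EuclideanSpace ℝ (Fin n) → ℝ} (hf : Continuous f)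
    (Q : ℝ) : IntegrableOn f (jball n Q) :=
  (hf.continuousOn.integrableOn_compact (isCompact_closedBall 0 Q)).mono_set
    ((jball_subset Q).trans ball_subset_closedBall)

theorem continuousOn_integral_jball {G : EuclideanSpace ℝ (Fin n) × ℝ → ℝ} {a b : ℝ} (Q : ℝ)
    (hG : ContinuousOn G (univ ×ˢ Icc a b)) :
    ContinuousOn (fun t => ∫ x in jball n Q, G (x, t)) (Icc a b) := by
  obtain ⟨C, hC⟩ := exists_bound_closedBall Q hG
  refine continuousOn_of_dominated (bound := fun _ => C) ?_ ?_ ?_ ?_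
  · exact fun t ht => (continuous_slice_of_continuousOn hG ht).aestronglyMeasurable
  · exact fun t ht => (ae_restrict_iff' (measurableSet_jball Q)).2
      (ae_of_all _ fun x hx => hC x hx t ht)
  · exact integrableOn_const (volume_jball_lt_top Q).ne
  · exact ae_of_all _ fun x => hG.comp (by fun_prop) fun t ht => ⟨mem_univ _, ht⟩

theorem integral_jball_swap {G : EuclideanSpace ℝ (Fin n) × ℝ → ℝ} {a b : ℝ} (hab : a ≤ b) (Q : ℝ)
    (hG : ContinuousOn G (univ ×ˢ Icc a b)) :
    ∫ x in jball n Q, ∫ t in a..b, G (x, t) = ∫ t in a..b, ∫ x in jball n Q, G (x, t) := by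
  simp only [intervalIntegral.integral_of_le hab]
  refine integral_integral_swap (f := fun x t => G (x, t)) ?_
  rw [Measure.prod_restrict]
  have hc : IntegrableOn G (closedBall 0 Q ×ˢ Icc a b) :=
    (hG.mono (prod_mono (subset_univ _) subset_rfl)).integrableOn_compact
      ((isCompact_closedBall _ _).prod isCompact_Icc)
  exact hc.mono_set (prod_mono ((jball_subset Q).trans ball_subset_closedBall) Ioc_subset_Icc_self)

end Radial

section EnergyInequality

variable {n : ℕ}

/-- Radial weights adapted to the localized energy inequality for `∂ₜV = -Δ²V` on the time interval
`[t₁, t₂]`: `W` is the weight of `V²`, `T` the weight of `|∇V|²`, and `β` the density of the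
error term. -/
structure RadialWeight (n : ℕ) (W Wt W1 W2 T T1 T2 : ℝ → ℝ → ℝ) (β : ℝ → ℝ) (Q t1 t2 : ℝ) :
    Prop where
  deriv_W : ∀ t ∈ Icc t1 t2, ∀ s, HasDerivAt (fun s => W s t) (W1 s t) s
  deriv_W1 : ∀ t ∈ Icc t1 t2, ∀ s, HasDerivAt (fun s => W1 s t) (W2 s t) s
  deriv_T : ∀ t ∈ Icc t1 t2, ∀ s, HasDerivAt (fun s => T s t) (T1 s t) s
  deriv_T1 : ∀ t ∈ Icc t1 t2, ∀ s, HasDerivAt (fun s => T1 s t) (T2 s t) s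
  cont_W2 : ∀ t ∈ Icc t1 t2, Continuous fun s => W2 s t
  cont_T2 : ∀ t ∈ Icc t1 t2, Continuous fun s => T2 s t
  deriv_Wt : ∀ t ∈ Icc t1 t2, ∀ s, HasDerivAt (fun t => W s t) (Wt s t) t
  cont_W : ContinuousOn (fun p : ℝ × ℝ => W p.1 p.2) (univ ×ˢ Icc t1 t2)
  cont_Wt : ContinuousOn (fun p : ℝ × ℝ => Wt p.1 p.2) (univ ×ˢ Icc t1 t2)
  cont_T : ContinuousOn (fun p : ℝ × ℝ => T p.1 p.2) (univ ×ˢ Icc t1 t2)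
  cont_β : ContinuousOn β (Icc t1 t2)
  zero : ∀ t ∈ Icc t1 t2, ∀ s, Q ≤ s → W s t = 0 ∧ Wt s t = 0 ∧ T s t = 0
  bound : ∀ t ∈ Icc t1 t2, ∀ s, 1 ≤ s → 0 ≤ W s t ∧ 0 ≤ T s t ∧ W1 s t ^ 2 ≤ W s t * T s t ∧
    ∃ A, 0 ≤ A ∧ T s t ^ 2 ≤ W s t * A ∧ (|W2 s t| + (n + 1) * |W1 s t|) ^ 2 ≤ W s t * A ∧
      |T2 s t| + (n + 1) * |T1 s t| ≤ A ∧ Wt s t + 50 * A ≤ if s < Q then β t else 0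

variable {W Wt W1 W2 T T1 T2 : ℝ → ℝ → ℝ} {β : ℝ → ℝ} {Q t1 t2 : ℝ}
  {V : EuclideanSpace ℝ (Fin n) × ℝ → ℝ}

theorem continuousOn_radial {w : ℝ → ℝ → ℝ} {s : Set ℝ}
    (h : ContinuousOn (fun p : ℝ × ℝ => w p.1 p.2) (univ ×ˢ s)) :
    ContinuousOn (fun p : EuclideanSpace ℝ (Fin n) × ℝ => w (japanese p.1) p.2) (univ ×ˢ s) :=
  h.comp (f := fun p : EuclideanSpace ℝ (Fin n) × ℝ => (japanese p.1, p.2))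
    ((continuous_japanese.comp continuous_fst).prodMk continuous_snd).continuousOn
    fun _ hp => ⟨mem_univ _, hp.2⟩

theorem gradSq_slice (hV : ContDiffOn ℝ ∞ V (upperHalf n)) {t : ℝ} (ht : 0 < t)
    (x : EuclideanSpace ℝ (Fin n)) :
    gradSq (fun y => V (y, t)) x = ∑ i, dirD (coordDir i, (0 : ℝ)) V (x, t) ^ 2 := by
  refine Finset.sum_congr rfl fun i _ => ?_
  rw [dirD_slice]
  exact (hV.contDiffAt (isOpen_upperHalf.mem_nhds ht)).differentiableAt (by simp)

theorem continuousOn_gradSq (hV : ContDiffOn ℝ ∞ V (upperHalf n)) :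
    ContinuousOn (fun p : EuclideanSpace ℝ (Fin n) × ℝ => gradSq (fun y => V (y, p.2)) p.1)
      (upperHalf n) := by
  have : ContinuousOn (fun p => ∑ i, dirD (coordDir i, (0 : ℝ)) V p ^ 2) (upperHalf n) :=
    continuousOn_finsetSum _ fun i _ => (hV.dirD isOpen_upperHalf _).continuousOn.pow 2
  exact this.congr fun p hp => gradSq_slice hV hp p.1

theorem RadialWeight.slice_le (hw : RadialWeight n W Wt W1 W2 T T1 T2 β Q t1 t2) (ht1 : 0 < t1)
    (hV : IsBiharmonicSol V) {t : ℝ} (ht : t ∈ Icc t1 t2) :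
    (∫ x in jball n Q, (Wt (japanese x) t * V (x, t) ^ 2 -
        2 * W (japanese x) t * V (x, t) * stLap (stLap V) (x, t))) +
      ∫ x in jball n Q, T (japanese x) t * gradSq (fun y => V (y, t)) x ≤
    β t * ∫ x in jball n Q, V (x, t) ^ 2 := by
  have ht0 : 0 < t := ht1.trans_le ht.1
  have hv := contDiff_slice hV.smooth ht0
  have hvc := hv.continuous
  have cW : Continuous fun x : EuclideanSpace ℝ (Fin n) => W (japanese x) t :=
    continuous_slice_of_continuousOn (continuousOn_radial hw.cont_W) ht
  have cWt : Continuous fun x : EuclideanSpace ℝ (Fin n) => Wt (japanese x) t :=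
    continuous_slice_of_continuousOn (continuousOn_radial hw.cont_Wt) ht
  have cT : Continuous fun x : EuclideanSpace ℝ (Fin n) => T (japanese x) t :=
    continuous_slice_of_continuousOn (continuousOn_radial hw.cont_T) ht
  have cL : Continuous fun x => stLap (stLap V) (x, t) :=
    (contDiff_slice hV.smooth.stLap.stLap ht0).continuous
  have cg : Continuous (gradSq fun y => V (y, t)) :=
    (continuousOn_gradSq hV.smooth).comp_continuous (f := fun x => (x, t)) (by fun_prop)
      fun x => ht0
  have e : lap (lap fun y => V (y, t)) = fun x => stLap (stLap V) (x, t) := by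
    have h4 : lap (fun y => V (y, t)) = fun y => stLap V (y, t) :=
      funext fun y => lap_slice hV.smooth ht0 y
    rw [h4]; funext x; exact lap_slice hV.smooth.stLap ht0 x
  set ρ : EuclideanSpace ℝ (Fin n) → ℝ := fun x =>
    (jball n Q).indicator (fun x => β t - Wt (japanese x) t) x with hρ
  have out : ∀ x, x ∉ jball n Q → Q ≤ japanese x := fun x hx => not_lt.1 hx
  have iβ : IntegrableOn (fun x => (β t - Wt (japanese x) t) * V (x, t) ^ 2) (jball n Q) :=
    integrableOn_jball_of_continuous ((continuous_const.sub cWt).mul (hvc.pow 2)) Q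
  have e2 : (fun x => ρ x * V (x, t) ^ 2) =
      (jball n Q).indicator fun x => (β t - Wt (japanese x) t) * V (x, t) ^ 2 := by
    funext x; simp only [hρ, indicator]; split_ifs <;> simp
  have key := integral_energy_le (v := fun y => V (y, t)) (w := fun x => W (japanese x) t)
    (θ := fun x => T (japanese x) t) (ρ := ρ)
    (by exact_mod_cast contDiff_infty.1 hv 4)
    ((contDiff_two_of_hasDerivAt (hw.deriv_W t ht) (hw.deriv_W1 t ht) (hw.cont_W2 t ht)).comp
      contDiff_japanese)
    ((contDiff_two_of_hasDerivAt (hw.deriv_T t ht) (hw.deriv_T1 t ht) (hw.cont_T2 t ht)).comp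
      contDiff_japanese)
    (hasCompactSupport_radial fun s hs => (hw.zero t ht s hs).1)
    (hasCompactSupport_radial fun s hs => (hw.zero t ht s hs).2.2)
    (by rw [e2, integrable_indicator_iff (measurableSet_jball Q)]; exact iβ)
    (fun x => by
      obtain ⟨h1, h2, h3, A, hA, h4, h5, h6, h7⟩ := hw.bound t ht _ (one_le_japanese x)
      refine ⟨h1, h2, (gradSq_radial_le (hw.deriv_W t ht) x).trans h3, A, hA, h4, ?_,
        (abs_lap_radial_le (hw.deriv_T t ht) (hw.deriv_T1 t ht) x).trans h6, ?_⟩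
      · refine le_trans ?_ h5
        rw [← sq_abs]
        exact pow_le_pow_left₀ (abs_nonneg _)
          (abs_lap_radial_le (hw.deriv_W t ht) (hw.deriv_W1 t ht) x) 2
      · simp only [hρ, indicator]
        by_cases hx : x ∈ jball n Q
        · have : japanese x < Q := hx
          rw [if_pos this] at h7
          rw [if_pos hx]; linarith
        · have h8 := out x hx
          rw [if_neg (not_lt.2 h8), (hw.zero t ht _ h8).2.1] at h7
          rw [if_neg hx]; linarith)
  rw [e2, integral_indicator (measurableSet_jball Q), e] at key
  rw [← setIntegral_eq_integral_of_forall_compl_eq_zero (s := jball n Q)] at key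
  · have i1 : IntegrableOn (fun x => Wt (japanese x) t * V (x, t) ^ 2) (jball n Q) :=
      integrableOn_jball_of_continuous (cWt.mul (hvc.pow 2)) Q
    have c1 := (continuous_const (y := (2 : ℝ))).mul cW |>.mul hvc |>.mul cL
    have c2 : Continuous fun x => T (japanese x) t * gradSq (fun y => V (y, t)) x := cT.mul cg
    have i2 : IntegrableOn (fun x => -2 * (W (japanese x) t * V (x, t) * stLap (stLap V) (x, t)) +
        T (japanese x) t * gradSq (fun y => V (y, t)) x) (jball n Q) :=
      integrableOn_jball_of_continuous
        ((continuous_const.mul ((cW.mul hvc).mul cL)).add c2) Q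
    have i3 : IntegrableOn (fun x => Wt (japanese x) t * V (x, t) ^ 2 -
        2 * W (japanese x) t * V (x, t) * stLap (stLap V) (x, t)) (jball n Q) :=
      integrableOn_jball_of_continuous ((cWt.mul (hvc.pow 2)).sub c1) Q
    rw [← integral_add i3 (integrableOn_jball_of_continuous c2 Q), ← integral_const_mul]
    have key2 := add_le_add_right key (∫ x in jball n Q, Wt (japanese x) t * V (x, t) ^ 2)
    rw [← integral_add i1 i2, ← integral_add i1 iβ] at key2
    refine le_of_eq_of_le (integral_congr_ae (ae_of_all _ fun x => ?_))
      (key2.trans_eq (integral_congr_ae (ae_of_all _ fun x => ?_))) <;> dsimp only <;> ring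
  · intro x hx
    obtain ⟨h1, -, h2⟩ := hw.zero t ht _ (out x hx)
    simp [h1, h2]

theorem RadialWeight.energy_le (hw : RadialWeight n W Wt W1 W2 T T1 T2 β Q t1 t2) (ht1 : 0 < t1)
    (ht : t1 ≤ t2) (hV : IsBiharmonicSol V) :
    (∫ x in jball n Q, W (japanese x) t2 * V (x, t2) ^ 2) +
      ∫ t in t1..t2, ∫ x in jball n Q, T (japanese x) t * gradSq (fun y => V (y, t)) x ≤
    (∫ x in jball n Q, W (japanese x) t1 * V (x, t1) ^ 2) +
      ∫ t in t1..t2, β t * ∫ x in jball n Q, V (x, t) ^ 2 := by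
  have hsub : (univ : Set (EuclideanSpace ℝ (Fin n))) ×ˢ Icc t1 t2 ⊆ upperHalf n :=
    fun p hp => ht1.trans_le hp.2.1
  have cV := hV.smooth.continuousOn.mono hsub
  have cL := hV.smooth.stLap.stLap.continuousOn.mono hsub
  have cg := (continuousOn_gradSq hV.smooth).mono hsub
  have cW := continuousOn_radial (n := n) hw.cont_W
  have cWt := continuousOn_radial (n := n) hw.cont_Wt
  have cT := continuousOn_radial (n := n) hw.cont_T
  set G : EuclideanSpace ℝ (Fin n) × ℝ → ℝ := fun p => Wt (japanese p.1) p.2 * V p ^ 2 -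
        2 * W (japanese p.1) p.2 * V p * stLap (stLap V) p with hGdef
  have cG : ContinuousOn G (univ ×ˢ Icc t1 t2) :=
    (cWt.mul (cV.pow 2)).sub (((continuousOn_const.mul cW).mul cV).mul cL)
  have ftc : ∀ x, ∫ t in t1..t2, G (x, t) =
      W (japanese x) t2 * V (x, t2) ^ 2 - W (japanese x) t1 * V (x, t1) ^ 2 := fun x => by
    refine intervalIntegral.integral_eq_sub_of_hasDerivAt
      (f := fun t => W (japanese x) t * V (x, t) ^ 2) (fun t h => ?_) ?_
    · rw [uIcc_of_le ht] at h
      have h0 : 0 < t := ht1.trans_le h.1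
      have h1 := (hw.deriv_Wt t h (japanese x)).mul ((hV.hasDerivAt x h0).pow 2)
      refine h1.congr_deriv ?_
      have h4 : lap (fun y => V (y, t)) = fun y => stLap V (y, t) :=
        funext fun y => lap_slice hV.smooth h0 y
      rw [h4, lap_slice hV.smooth.stLap h0]
      simp only [hGdef]
      norm_num
      ring
    · refine ContinuousOn.intervalIntegrable ?_
      rw [uIcc_of_le ht]
      exact cG.comp (by fun_prop) fun t h => ⟨mem_univ _, h⟩
  have hI : ∀ {H : EuclideanSpace ℝ (Fin n) × ℝ → ℝ}, ContinuousOn H (univ ×ˢ Icc t1 t2) →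
      IntervalIntegrable (fun t => ∫ x in jball n Q, H (x, t)) volume t1 t2 := fun hH => by
    refine ContinuousOn.intervalIntegrable ?_
    rw [uIcc_of_le ht]
    exact continuousOn_integral_jball Q hH
  have iG := hI cG
  have iT := hI (H := fun p => T (japanese p.1) p.2 * gradSq (fun y => V (y, p.2)) p.1) (cT.mul cg)
  have iβ : IntervalIntegrable (fun t => β t * ∫ x in jball n Q, V (x, t) ^ 2) volume t1 t2 := by
    refine ContinuousOn.intervalIntegrable ?_
    rw [uIcc_of_le ht]
    exact hw.cont_β.mul (continuousOn_integral_jball (G := fun p => V p ^ 2) Q (cV.pow 2))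
  have swap := integral_jball_swap ht Q cG
  simp only [ftc] at swap
  have cWV : ContinuousOn (fun p => W (japanese p.1) p.2 * V p ^ 2) (univ ×ˢ Icc t1 t2) :=
    cW.mul (cV.pow 2)
  rw [integral_sub (integrableOn_jball_of_continuous
      (continuous_slice_of_continuousOn cWV ⟨ht, le_rfl⟩) Q)
    (integrableOn_jball_of_continuous
      (continuous_slice_of_continuousOn cWV ⟨le_rfl, ht⟩) Q)] at swap
  have mono := intervalIntegral.integral_mono_on ht (iG.add iT) iβ
    fun t h => hw.slice_le ht1 hV h
  rw [intervalIntegral.integral_add iG iT] at mono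
  linarith

theorem RadialWeight.energy_le_of_continuousOn
    (hw : ∀ τ ∈ Ioc t1 t2, RadialWeight n W Wt W1 W2 T T1 T2 β Q τ t2)
    (cW : ContinuousOn (fun p : ℝ × ℝ => W p.1 p.2) (univ ×ˢ Icc t1 t2))
    (cβ : ContinuousOn β (Icc t1 t2)) (ht1 : 0 ≤ t1)
    (ht : t1 < t2) (hV : IsBiharmonicSol V) (cV : ContinuousOn V (univ ×ˢ Icc t1 t2)) :
    (∫ x in jball n Q, W (japanese x) t2 * V (x, t2) ^ 2) ≤
    (∫ x in jball n Q, W (japanese x) t1 * V (x, t1) ^ 2) +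
      ∫ t in t1..t2, β t * ∫ x in jball n Q, V (x, t) ^ 2 := by
  have c1 := continuousOn_integral_jball Q
    (G := fun p : EuclideanSpace ℝ (Fin n) × ℝ => W (japanese p.1) p.2 * V p ^ 2)
    ((continuousOn_radial (n := n) cW).mul (cV.pow 2))
  have c2 : ContinuousOn (fun t => β t * ∫ x in jball n Q, V (x, t) ^ 2) (Icc t1 t2) :=
    cβ.mul (continuousOn_integral_jball (G := fun p => V p ^ 2) Q (cV.pow 2))
  have i2 : IntervalIntegrable (fun t => β t * ∫ x in jball n Q, V (x, t) ^ 2) volume t1 t2 := by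
    refine ContinuousOn.intervalIntegrable ?_
    rwa [uIcc_of_le ht.le]
  have c3 : ContinuousOn (fun τ => ∫ t in τ..t2, β t * ∫ x in jball n Q, V (x, t) ^ 2)
      (Icc t1 t2) := by
    have := intervalIntegral.continuousOn_primitive_interval_left
      (f := fun t => β t * ∫ x in jball n Q, V (x, t) ^ 2) (a := t1) (b := t2) (μ := volume) (by
      rw [uIcc_of_le ht.le]; exact c2.integrableOn_Icc)
    rwa [uIcc_of_le ht.le] at this
  have hlim : Tendsto (fun τ => (∫ x in jball n Q, W (japanese x) τ * V (x, τ) ^ 2) +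
      ∫ t in τ..t2, β t * ∫ x in jball n Q, V (x, t) ^ 2) (nhdsWithin t1 (Ioc t1 t2))
      (nhds ((∫ x in jball n Q, W (japanese x) t1 * V (x, t1) ^ 2) +
      ∫ t in t1..t2, β t * ∫ x in jball n Q, V (x, t) ^ 2)) :=
    ((c1.add c3) t1 ⟨le_rfl, ht.le⟩).mono Ioc_subset_Icc_self
  have : (nhdsWithin t1 (Ioc t1 t2)).NeBot := by
    rw [nhdsWithin_Ioc_eq_nhdsGT ht]; infer_instance
  refine ge_of_tendsto hlim (eventually_nhdsWithin_of_forall fun τ hτ => ?_)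
  have hτ0 : 0 < τ := ht1.trans_lt hτ.1
  refine le_trans ?_ ((hw τ hτ).energy_le hτ0 hτ.2 hV)
  refine le_add_of_nonneg_right (intervalIntegral.integral_nonneg hτ.2 fun t h => ?_)
  refine integral_nonneg fun x => mul_nonneg ((hw τ hτ).bound t h _ (one_le_japanese x)).2.1 ?_
  exact Finset.sum_nonneg fun i _ => sq_nonneg _

end EnergyInequality

section PowerWeight

theorem hasDerivAt_max_zero_pow (k : ℕ) (s : ℝ) :
    HasDerivAt (fun s : ℝ => max s 0 ^ (k + 2)) ((k + 2) * max s 0 ^ (k + 1)) s := by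
  have ne : ∀ y : ℝ, y ≠ 0 →
      HasDerivAt (fun s : ℝ => max s 0 ^ (k + 2)) ((k + 2) * max y 0 ^ (k + 1)) y := fun y hy => by
    rcases lt_or_gt_of_ne hy with h | h
    · rw [max_eq_right h.le, zero_pow (by omega), mul_zero]
      refine (hasDerivAt_const y (0 : ℝ)).congr_of_eventuallyEq ?_
      filter_upwards [gt_mem_nhds h] with z hz
      rw [max_eq_right (le_of_lt hz), zero_pow (by omega)]
    · rw [max_eq_left h.le]
      refine ((hasDerivAt_pow (k + 2) y).congr_deriv (by push_cast; simp)).congr_of_eventuallyEq ?_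
      filter_upwards [lt_mem_nhds h] with z hz
      rw [max_eq_left (le_of_lt hz)]
  rcases eq_or_ne s 0 with rfl | hs
  · exact hasDerivAt_of_hasDerivAt_of_ne (g := fun y => (k + 2) * max y 0 ^ (k + 1)) ne
      (by fun_prop) (by fun_prop)
  · exact ne s hs

theorem hasDerivAt_max_sub_pow (k : ℕ) (c s : ℝ) :
    HasDerivAt (fun s : ℝ => max (c - s) 0 ^ (k + 2)) (-((k + 2) * max (c - s) 0 ^ (k + 1))) s := by
  have := (hasDerivAt_max_zero_pow k (c - s)).comp s ((hasDerivAt_id s).const_sub c)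
  exact this.congr_deriv (by simp)

variable {n : ℕ}

theorem power_weight_bound {p n : ℝ} {k : ℕ} (hp : 0 ≤ p) (hn : 0 ≤ n) {h y : ℝ} (hh : 0 ≤ h)
    (hy : 0 ≤ y) :
    ((p + 4) ^ 2 * (h * y ^ (k + 2))) ^ 2 ≤
        h * y ^ (k + 4) * (4 * (n + 1) ^ 2 * (p + 4) ^ 4 * (h * (y ^ k + y ^ (k + 2)))) ∧
      ((p + 4) * (p + 3) * (h * y ^ (k + 2)) + (n + 1) * ((p + 4) * (h * y ^ (k + 3)))) ^ 2 ≤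
        h * y ^ (k + 4) * (4 * (n + 1) ^ 2 * (p + 4) ^ 4 * (h * (y ^ k + y ^ (k + 2)))) ∧
      (p + 4) ^ 2 * (p + 2) * (p + 1) * (h * y ^ k) +
          (n + 1) * ((p + 4) ^ 2 * (p + 2) * (h * y ^ (k + 1))) ≤
        4 * (n + 1) ^ 2 * (p + 4) ^ 4 * (h * (y ^ k + y ^ (k + 2))) := by
  obtain ⟨q, rfl⟩ : ∃ q, p = q - 4 := ⟨p + 4, by ring⟩
  obtain ⟨N, rfl⟩ : ∃ N, n = N - 1 := ⟨n + 1, by ring⟩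
  have hq : 4 ≤ q := by linarith
  have hN : 1 ≤ N := by linarith
  have hyk : 0 ≤ y ^ k := by positivity
  have e1 : y ^ (k + 1) = y ^ k * y := by ring
  have e2 : y ^ (k + 2) = y ^ k * y ^ 2 := by ring
  have e3 : y ^ (k + 3) = y ^ k * y ^ 3 := by ring
  have e4 : y ^ (k + 4) = y ^ k * y ^ 4 := by ring
  simp only [e1, e2, e3, e4, sub_add_cancel]
  generalize y ^ k = z at *
  have hq1 : 1 ≤ q ^ 2 := by nlinarith
  have hN1 : 1 ≤ N ^ 2 := by nlinarith
  have b : 0 ≤ h ^ 2 * z ^ 2 * y ^ 4 := by positivity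
  have b' : 0 ≤ h ^ 2 * z ^ 2 * y ^ 6 := by positivity
  have hNq : q ^ 4 ≤ N ^ 2 * q ^ 4 := le_mul_of_one_le_left (by positivity) hN1
  have hqq : q ^ 2 * N ^ 2 ≤ N ^ 2 * q ^ 4 := by nlinarith [sq_nonneg (N * q)]
  have hz4 : 0 ≤ N ^ 2 * q ^ 4 := by positivity
  refine ⟨?_, ?_, ?_⟩
  · have : (q ^ 2 * (h * (z * y ^ 2))) ^ 2 = q ^ 4 * (h ^ 2 * z ^ 2 * y ^ 4) := by ring
    rw [this]
    have : h * (z * y ^ 4) * (4 * N ^ 2 * q ^ 4 * (h * (z + z * y ^ 2))) =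
      4 * (N ^ 2 * q ^ 4) * (h ^ 2 * z ^ 2 * y ^ 4) + 4 * (N ^ 2 * q ^ 4) * (h ^ 2 * z ^ 2 * y ^ 6) := by
      ring
    rw [this]
    nlinarith [mul_le_mul_of_nonneg_right hNq b, mul_nonneg hz4 b, mul_nonneg hz4 b']
  · have c1 : (q * (q - 4 + 3) * (h * (z * y ^ 2)) + N * (q * (h * (z * y ^ 3)))) ^ 2 ≤
        2 * (q * q * (h * (z * y ^ 2))) ^ 2 + 2 * (N * (q * (h * (z * y ^ 3)))) ^ 2 := by
      have d1 : q * (q - 4 + 3) * (h * (z * y ^ 2)) ≤ q * q * (h * (z * y ^ 2)) := by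
        gcongr; linarith
      have d0 : 0 ≤ q * (q - 4 + 3) * (h * (z * y ^ 2)) :=
        mul_nonneg (mul_nonneg (by linarith) (by linarith)) (by positivity)
      have := pow_le_pow_left₀ d0 d1 2
      nlinarith [sq_nonneg (q * (q - 4 + 3) * (h * (z * y ^ 2)) - N * (q * (h * (z * y ^ 3))))]
    refine c1.trans ?_
    have : 2 * (q * q * (h * (z * y ^ 2))) ^ 2 + 2 * (N * (q * (h * (z * y ^ 3)))) ^ 2 =
      2 * (q ^ 4 * (h ^ 2 * z ^ 2 * y ^ 4)) + 2 * (q ^ 2 * N ^ 2 * (h ^ 2 * z ^ 2 * y ^ 6)) := by ring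
    rw [this]
    have : h * (z * y ^ 4) * (4 * N ^ 2 * q ^ 4 * (h * (z + z * y ^ 2))) =
      4 * (N ^ 2 * q ^ 4) * (h ^ 2 * z ^ 2 * y ^ 4) + 4 * (N ^ 2 * q ^ 4) * (h ^ 2 * z ^ 2 * y ^ 6) := by
      ring
    rw [this]
    nlinarith [mul_le_mul_of_nonneg_right hNq b, mul_le_mul_of_nonneg_right hqq b',
      mul_nonneg hz4 b, mul_nonneg hz4 b']
  · have hhz : 0 ≤ h * z := by positivity
    have d1 : q ^ 2 * (q - 4 + 2) * (q - 4 + 1) ≤ N ^ 2 * q ^ 4 := by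
      have : (q - 4 + 2) * (q - 4 + 1) ≤ q ^ 2 := by nlinarith
      nlinarith [mul_le_mul_of_nonneg_left this (sq_nonneg q)]
    have d2 : N * (q ^ 2 * (q - 4 + 2)) ≤ N ^ 2 * q ^ 4 := by
      have a1 : q ^ 2 * (q - 4 + 2) ≤ q ^ 4 := by
        have : q - 4 + 2 ≤ q ^ 2 := by nlinarith
        calc q ^ 2 * (q - 4 + 2) ≤ q ^ 2 * q ^ 2 := by gcongr
          _ = q ^ 4 := by ring
      have a2 : N ≤ N ^ 2 := by nlinarith
      calc _ ≤ N * q ^ 4 := by gcongr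
        _ ≤ _ := by gcongr
    have d3 : 2 * y ≤ 1 + y ^ 2 := by nlinarith [sq_nonneg (y - 1)]
    calc _ = q ^ 2 * (q - 4 + 2) * (q - 4 + 1) * (h * z) +
          N * (q ^ 2 * (q - 4 + 2)) * (h * z * y) := by ring
      _ ≤ N ^ 2 * q ^ 4 * (h * z) + N ^ 2 * q ^ 4 * (h * z * y) := by gcongr
      _ = N ^ 2 * q ^ 4 * (h * z) * (1 + y) := by ring
      _ ≤ N ^ 2 * q ^ 4 * (h * z) * (4 * (1 + y ^ 2)) := by gcongr; nlinarith
      _ = _ := by ring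

/-- The absolute constant in the error term of the weight `(g(t) - s)₊ ^ (k + 4)`. -/
noncomputable def powerConst (n k : ℕ) : ℝ := 4 * ((n : ℝ) + 1) ^ 2 * ((k : ℝ) + 4) ^ 4

theorem powerConst_pos (n k : ℕ) : 0 < powerConst n k := by unfold powerConst; positivity

theorem radialWeight_pow {k : ℕ} (hk : 1 ≤ k) {g g' h h' β : ℝ → ℝ} {Q t1 t2 : ℝ}
    (hg : ∀ t ∈ Icc t1 t2, HasDerivAt g (g' t) t) (cg : ContinuousOn g' (Icc t1 t2))
    (hh : ∀ t ∈ Icc t1 t2, HasDerivAt h (h' t) t) (ch : ContinuousOn h' (Icc t1 t2))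
    (cβ : ContinuousOn β (Icc t1 t2)) (h0 : ∀ t ∈ Icc t1 t2, 0 ≤ h t)
    (gQ : ∀ t ∈ Icc t1 t2, g t ≤ Q) (hQ : 0 ≤ Q)
    (key : ∀ t ∈ Icc t1 t2, ∀ y, 0 ≤ y → y ≤ Q →
      h' t * y ^ (k + 4) + h t * ((k + 4) * y ^ (k + 3) * g' t) +
        50 * (powerConst n k * (h t * (y ^ k + y ^ (k + 2)))) ≤ β t) :
    RadialWeight n (fun s t => h t * max (g t - s) 0 ^ (k + 4))
      (fun s t => h' t * max (g t - s) 0 ^ (k + 4) +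
        h t * ((k + 4) * max (g t - s) 0 ^ (k + 3) * g' t))
      (fun s t => -((k + 4) * (h t * max (g t - s) 0 ^ (k + 3))))
      (fun s t => (k + 4) * (k + 3) * (h t * max (g t - s) 0 ^ (k + 2)))
      (fun s t => (k + 4) ^ 2 * (h t * max (g t - s) 0 ^ (k + 2)))
      (fun s t => -((k + 4) ^ 2 * (k + 2) * (h t * max (g t - s) 0 ^ (k + 1))))
      (fun s t => (k + 4) ^ 2 * (k + 2) * (k + 1) * (h t * max (g t - s) 0 ^ k)) β Q t1 t2 := by
  have hgc : ContinuousOn g (Icc t1 t2) := fun t ht => (hg t ht).continuousAt.continuousWithinAt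
  have hhc : ContinuousOn h (Icc t1 t2) := fun t ht => (hh t ht).continuousAt.continuousWithinAt
  have comp2 : ∀ {f : ℝ → ℝ}, ContinuousOn f (Icc t1 t2) →
      ContinuousOn (fun p : ℝ × ℝ => f p.2) (univ ×ˢ Icc t1 t2) := fun hf =>
    hf.comp continuousOn_snd fun _ hp => hp.2
  have cY : ∀ j : ℕ, ContinuousOn (fun p : ℝ × ℝ => max (g p.2 - p.1) 0 ^ j)
      (univ ×ˢ Icc t1 t2) := fun j =>
    (((comp2 hgc).sub continuousOn_fst).sup continuousOn_const).pow j
  have dY : ∀ j : ℕ, ∀ t ∈ Icc t1 t2, ∀ s, HasDerivAt (fun s => h t * max (g t - s) 0 ^ (j + 2))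
      (-((j + 2) * (h t * max (g t - s) 0 ^ (j + 1)))) s := fun j t _ s =>
    ((hasDerivAt_max_sub_pow j (g t) s).const_mul (h t)).congr_deriv (by ring)
  have kk : ∃ l : ℕ, k = l + 1 := ⟨k - 1, by omega⟩
  constructor
  · intro t ht s
    exact (dY (k + 2) t ht s).congr_deriv (by push_cast; ring)
  · intro t ht s
    exact (((dY (k + 1) t ht s).const_mul ((k : ℝ) + 4)).neg).congr_deriv (by push_cast; ring)
  · intro t ht s
    exact ((dY k t ht s).const_mul (((k : ℝ) + 4) ^ 2)).congr_deriv (by ring)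
  · obtain ⟨l, rfl⟩ := kk
    intro t ht s
    exact (((dY l t ht s).const_mul (((l + 1 : ℕ) + 4 : ℝ) ^ 2 * ((l + 1 : ℕ) + 2))).neg).congr_deriv
      (by push_cast; ring)
  · intro t ht; fun_prop
  · intro t ht; fun_prop
  · intro t ht s
    have h1 := (hasDerivAt_max_zero_pow (k + 2) (g t - s)).comp t ((hg t ht).sub_const s)
    exact ((hh t ht).mul h1).congr_deriv (by push_cast; simp only [Function.comp]; ring)
  · exact (comp2 hhc).mul (cY _)
  · exact ((comp2 ch).mul (cY _)).add
      ((comp2 hhc).mul ((continuousOn_const.mul (cY _)).mul (comp2 cg)))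
  · exact continuousOn_const.mul ((comp2 hhc).mul (cY _))
  · exact cβ
  · intro t ht s hs
    have : max (g t - s) 0 = 0 := max_eq_right (by linarith [gQ t ht])
    simp [this]
  · intro t ht s hs
    have hY : 0 ≤ max (g t - s) 0 := le_max_right _ _
    have hYQ : max (g t - s) 0 ≤ Q := max_le (by linarith [gQ t ht]) hQ
    have hz : ¬ s < Q → max (g t - s) 0 = 0 := fun h => max_eq_right (by linarith [gQ t ht])
    generalize max (g t - s) 0 = y at *
    have hht := h0 t ht
    obtain ⟨b1, b2, b3⟩ := power_weight_bound (p := k) (n := n) (k := k) (by positivity)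
      (by positivity) hht hY
    refine ⟨by positivity, by positivity, le_of_eq (by ring),
      powerConst n k * (h t * (y ^ k + y ^ (k + 2))), ?_, b1, ?_, ?_, ?_⟩
    · have := powerConst_pos n k
      positivity
    · rw [abs_of_nonneg (by positivity), abs_neg, abs_of_nonneg (by positivity)]
      exact b2
    · rw [abs_of_nonneg (by positivity), abs_neg, abs_of_nonneg (by positivity)]
      exact b3
    · split_ifs with hsQ
      · exact key t ht y hY hYQ
      · rw [hz hsQ]
        obtain ⟨l, rfl⟩ := kk
        simp

end PowerWeight

section WeightRemoval

variable {n : ℕ} {V : EuclideanSpace ℝ (Fin n) × ℝ → ℝ}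

theorem integral_jball_mono {f g : EuclideanSpace ℝ (Fin n) → ℝ} (hf : Continuous f)
    (hg : Continuous g) {Q Q' : ℝ} (hQ : Q ≤ Q') (h : ∀ x ∈ jball n Q, f x ≤ g x)
    (h0 : ∀ x ∈ jball n Q', 0 ≤ g x) : ∫ x in jball n Q, f x ≤ ∫ x in jball n Q', g x := by
  have hsub : jball n Q ⊆ jball n Q' := fun x hx => lt_of_lt_of_le hx hQ
  refine (setIntegral_mono_on (integrableOn_jball_of_continuous hf Q)
    (integrableOn_jball_of_continuous hg Q) (measurableSet_jball Q) h).trans ?_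
  exact setIntegral_mono_set (integrableOn_jball_of_continuous hg Q')
    ((ae_restrict_iff' (measurableSet_jball Q')).2 (ae_of_all _ h0)) (ae_of_all _ hsub)

/-- An `L²` bound at all times from a bound with a degenerate weight at time `0`. -/
theorem exists_integral_sq_le (n : ℕ) {a : ℝ} (ha : 0 < a) :
    ∃ κ : ℝ, 1 ≤ κ ∧ ∃ C : ℝ, 0 ≤ C ∧ ∃ m : ℕ, ∀ V : EuclideanSpace ℝ (Fin n) × ℝ → ℝ,
      IsBiharmonicSol V → ContinuousOn V (univ ×ˢ Icc 0 1) → ∀ M, (∀ x, |V (x, 0)| ≤ M) →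
      ∀ R, 1 ≤ R → ∀ t ∈ Ioc (0 : ℝ) 1, ∫ x in jball n (R - 1), V (x, t) ^ 2 ≤
        (R + κ) ^ m * M ^ 2 * volume.real (jball n (R + κ)) +
          C * ∫ t in (0 : ℝ)..1, t ^ a * ∫ x in jball n (R + κ), V (x, t) ^ 2 := by
  obtain ⟨j, hj⟩ := exists_nat_ge (2 * a)
  have hj1 : 1 ≤ j := by
    by_contra h
    have : j = 0 := by omega
    subst this
    norm_num at hj; linarith
  set k := 3 * j with hk
  set c := powerConst n k with hc
  have hcp : 0 < c := powerConst_pos n k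
  refine ⟨1 + 300 * c, by linarith, 100 * c, by positivity, k + 4, fun V hV cV M hM R hR t2 ht2 => ?_⟩
  set κ := 1 + 300 * c with hκ
  have hκ1 : 1 ≤ κ := by linarith
  have hM0 : 0 ≤ M := (abs_nonneg _).trans (hM 0)
  have hsub : Icc (0 : ℝ) t2 ⊆ Icc 0 1 := Icc_subset_Icc_right ht2.2
  have cβ : ContinuousOn (fun t : ℝ => 100 * c * t ^ a) (Icc 0 1) :=
    continuousOn_const.mul (continuousOn_id.rpow_const fun _ _ => Or.inr ha.le)
  have hsq : ∀ t ∈ Icc (0 : ℝ) t2, √t ≤ 1 := fun t ht => Real.sqrt_le_one.2 (hsub ht).2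
  have rw1 : ∀ τ ∈ Ioc 0 t2, RadialWeight n _ _ _ _ _ _ _ (fun t => 100 * c * t ^ a) (R + κ) τ t2 :=
      fun τ hτ => by
    have hpos : ∀ t ∈ Icc τ t2, 0 < t := fun t ht => hτ.1.trans_le ht.1
    refine radialWeight_pow (k := k) (by omega) (g := fun t => R + κ * (1 - √t))
      (g' := fun t => -(κ / (2 * √t))) (h := fun _ => 1) (h' := fun _ => 0)
      (fun t ht => ?_) ?_ (fun t _ => hasDerivAt_const t 1) continuousOn_const
      (cβ.mono fun t ht => ⟨(hpos t ht).le, ht.2.trans ht2.2⟩) (fun _ _ => zero_le_one)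
      (fun t ht => ?_) (by linarith) fun t ht y hy _ => ?_
    · have h0 := hpos t ht
      refine ((((hasDerivAt_id t).sqrt h0.ne').const_sub 1).const_mul κ |>.const_add R).congr_deriv ?_
      simp only [id]; ring
    · refine (continuousOn_const.div (by fun_prop) fun t ht => ?_).neg
      have := Real.sqrt_pos.2 (hpos t ht)
      positivity
    · have := Real.sqrt_nonneg t
      nlinarith
    · have h0 := hpos t ht
      have h1 : t ≤ 1 := ht.2.trans ht2.2
      have hs0 := Real.sqrt_pos.2 h0
      have hs1 : √t ≤ 1 := Real.sqrt_le_one.2 h1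
      have hyk : 0 ≤ y ^ k := by positivity
      have e2 : y ^ (k + 2) ≤ y ^ k + y ^ (k + 3) := by
        have : y ^ 2 ≤ 1 + y ^ 3 := by
          rcases le_total y 1 with h | h
          · nlinarith [pow_nonneg hy 3]
          · nlinarith [pow_nonneg hy 2]
        calc y ^ (k + 2) = y ^ k * y ^ 2 := by ring
          _ ≤ y ^ k * (1 + y ^ 3) := by gcongr
          _ = _ := by ring
      have e3 : y ^ k ≤ t ^ a + y ^ (k + 3) / √t := by
        rcases le_total (√t) (y ^ 3) with h | h
        · have : y ^ k ≤ y ^ (k + 3) / √t := by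
            rw [le_div_iff₀ hs0, pow_add]; gcongr
          have := Real.rpow_nonneg h0.le a
          linarith
        · have : y ^ k ≤ t ^ a := by
            calc y ^ k = (y ^ 3) ^ j := by rw [hk, pow_mul]
              _ ≤ (√t) ^ j := by gcongr
              _ = t ^ ((1 / 2 : ℝ) * j) := by
                rw [Real.rpow_mul_natCast h0.le, Real.sqrt_eq_rpow]
              _ ≤ t ^ a := Real.rpow_le_rpow_of_exponent_ge h0 h1 (by linarith)
          have : 0 ≤ y ^ (k + 3) / √t := by positivity
          linarith
      have e4 : y ^ (k + 3) ≤ y ^ (k + 3) / √t := le_div_self (by positivity) hs0 hs1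
      have e5 : ((k : ℝ) + 4) * y ^ (k + 3) * -(κ / (2 * √t)) =
          -(((k : ℝ) + 4) * κ / 2 * (y ^ (k + 3) / √t)) := by field_simp
      have hk0 : (0 : ℝ) ≤ k := by positivity
      have e6 : 150 * c ≤ ((k : ℝ) + 4) * κ / 2 := by nlinarith
      have e7 : 0 ≤ y ^ (k + 3) / √t := by positivity
      rw [e5]
      nlinarith [mul_le_mul_of_nonneg_right e6 e7, mul_le_mul_of_nonneg_left e2 hcp.le,
        mul_le_mul_of_nonneg_left e3 hcp.le, mul_le_mul_of_nonneg_left e4 hcp.le]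
  have cY : ContinuousOn (fun p : ℝ × ℝ => (1 : ℝ) * max (R + κ * (1 - √p.2) - p.1) 0 ^ (k + 4))
      (univ ×ˢ Icc 0 t2) := by fun_prop
  have main := RadialWeight.energy_le_of_continuousOn rw1 cY (cβ.mono hsub) le_rfl ht2.1 hV
    (cV.mono (prod_mono subset_rfl hsub))
  have cV0 : Continuous fun x => V (x, 0) := continuous_slice_of_continuousOn cV ⟨le_rfl, zero_le_one⟩
  have cV2 : Continuous fun x => V (x, t2) := continuous_slice_of_continuousOn cV ⟨ht2.1.le, ht2.2⟩
  have cj := continuous_japanese (n := n)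
  have step1 : ∫ x in jball n (R - 1), V (x, t2) ^ 2 ≤ ∫ x in jball n (R + κ),
      1 * max (R + κ * (1 - √t2) - japanese x) 0 ^ (k + 4) * V (x, t2) ^ 2 := by
    have q2 : Continuous fun x => V (x, t2) ^ 2 := cV2.pow 2
    have q3 : Continuous fun x =>
      1 * max (R + κ * (1 - √t2) - japanese x) 0 ^ (k + 4) * V (x, t2) ^ 2 := by fun_prop
    refine integral_jball_mono q2 q3
      (by linarith) (fun x hx => ?_)
      fun x _ => by positivity
    have hx' : japanese x < R - 1 := hx
    have hs := hsq t2 ⟨ht2.1.le, le_rfl⟩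
    have : 1 ≤ max (R + κ * (1 - √t2) - japanese x) 0 := le_max_of_le_left (by nlinarith)
    rw [one_mul]
    exact le_mul_of_one_le_left (sq_nonneg _) (one_le_pow₀ this)
  have step2 : ∫ x in jball n (R + κ),
      1 * max (R + κ * (1 - √0) - japanese x) 0 ^ (k + 4) * V (x, 0) ^ 2 ≤
      (R + κ) ^ (k + 4) * M ^ 2 * volume.real (jball n (R + κ)) := by
    have : ∫ x in jball n (R + κ), (R + κ) ^ (k + 4) * M ^ 2 =
        (R + κ) ^ (k + 4) * M ^ 2 * volume.real (jball n (R + κ)) := by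
      rw [setIntegral_const, smul_eq_mul]; ring
    rw [← this]
    have q2 : Continuous fun x => V (x, 0) ^ 2 := cV0.pow 2
    have q3 : Continuous fun x =>
      1 * max (R + κ * (1 - √0) - japanese x) 0 ^ (k + 4) * V (x, 0) ^ 2 := by fun_prop
    refine integral_jball_mono q3 continuous_const le_rfl
      (fun x hx => ?_)
      fun x _ => by positivity
    have h1 : max (R + κ * (1 - √0) - japanese x) 0 ≤ R + κ := by
      refine max_le ?_ (by linarith)
      have := japanese_pos x
      simp; linarith
    have h2 : V (x, 0) ^ 2 ≤ M ^ 2 := sq_le_sq' (abs_le.1 (hM x)).1 (abs_le.1 (hM x)).2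
    rw [one_mul]
    gcongr
  have cI : ContinuousOn (fun t : ℝ => t ^ a * ∫ x in jball n (R + κ), V (x, t) ^ 2) (Icc 0 1) :=
    (continuousOn_id.rpow_const fun _ _ => Or.inr ha.le).mul
      (continuousOn_integral_jball (G := fun p => V p ^ 2) _ (cV.pow 2))
  have step3 : ∫ t in (0 : ℝ)..t2, 100 * c * t ^ a * ∫ x in jball n (R + κ), V (x, t) ^ 2 ≤
      100 * c * ∫ t in (0 : ℝ)..1, t ^ a * ∫ x in jball n (R + κ), V (x, t) ^ 2 := by
    simp only [mul_assoc (100 * c), intervalIntegral.integral_const_mul]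
    refine mul_le_mul_of_nonneg_left ?_ (by positivity)
    refine intervalIntegral.integral_mono_interval le_rfl ht2.1.le ht2.2 ?_ ?_
    · refine (ae_restrict_iff' measurableSet_Ioc).2 (ae_of_all _ fun t ht => ?_)
      exact mul_nonneg (Real.rpow_nonneg ht.1.le _) (integral_nonneg fun x => sq_nonneg _)
    · refine ContinuousOn.intervalIntegrable ?_
      rwa [uIcc_of_le zero_le_one]
  linarith

end WeightRemoval

section WaveAlgebra

noncomputable def waveC1 (K : ℝ) : ℝ := 32 * K ^ 2 + 64
noncomputable def waveC3 (N K : ℝ) : ℝ := 12 * K ^ 2 + 36 * K + 36 + N * (4 * K + 4)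
noncomputable def waveC2 (N K : ℝ) : ℝ :=
  2 * waveC1 K ^ 2 + 2 * waveC3 N K ^ 2 +
    waveC1 K * (2 * K ^ 2 + 54 * K + 89 + N * (2 * K + 13))

theorem wave_factor_bounds {l P p X Y r : ℝ} (hl : 1 ≤ l)
    (hP : 0 ≤ P) (hP1 : P ≤ 1) (hp : p = 1 + l * P) (hX : X = 1 + l ^ 2 * P)
    (hY : Y = 1 + l ^ 4 * P) (hr : r = l ^ 2 * (P * (1 - P))) :
    1 ≤ p ∧ p ≤ X ∧ X ≤ Y ∧ p ^ 2 ≤ 2 * X ∧ X ^ 2 ≤ 2 * Y ∧ p * X ≤ 3 * Y ∧ 0 ≤ r ∧ r ≤ X ∧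
      l * r ≤ Y ∧ l ^ 2 * r ≤ Y ∧ p * (l * r) ≤ 2 * Y := by
  have hl0 : 0 ≤ l := by linarith
  have hl2 : l ≤ l ^ 2 := by nlinarith
  have hl3 : l ^ 2 ≤ l ^ 3 := by nlinarith [sq_nonneg l]
  have hl4 : l ^ 3 ≤ l ^ 4 := by nlinarith [pow_nonneg hl0 3]
  have hPP : P * (1 - P) ≤ P := by nlinarith
  have hPP0 : 0 ≤ P * (1 - P) := mul_nonneg hP (by linarith)
  have hPsq : P ^ 2 ≤ P := by nlinarith
  have hp1 : 1 ≤ p := by rw [hp]; nlinarith [mul_nonneg hl0 hP]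
  have hpX : p ≤ X := by rw [hp, hX]; nlinarith [mul_le_mul_of_nonneg_right hl2 hP]
  have hX1 : 1 ≤ X := hp1.trans hpX
  have l2P : l * P ≤ l ^ 2 * P := by gcongr
  have l3P : l ^ 2 * P ≤ l ^ 3 * P := by gcongr
  have l4P : l ^ 3 * P ≤ l ^ 4 * P := by gcongr
  have hXY : X ≤ Y := by rw [hX, hY]; linarith
  have hY1 : 1 ≤ Y := hX1.trans hXY
  have hp2 : p ^ 2 ≤ 2 * X := by
    have : l ^ 2 * P ^ 2 ≤ l ^ 2 * P := by gcongr
    rw [hp, hX]; nlinarith [sq_nonneg (1 - l * P)]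
  have hX2 : X ^ 2 ≤ 2 * Y := by
    have : l ^ 4 * P ^ 2 ≤ l ^ 4 * P := by gcongr
    rw [hX, hY]; nlinarith [sq_nonneg (1 - l ^ 2 * P)]
  have hpXY : p * X ≤ 3 * Y := by
    have : l ^ 3 * P ^ 2 ≤ l ^ 3 * P := by gcongr
    have h3 : (1 + l * P) * (1 + l ^ 2 * P) = 1 + l * P + l ^ 2 * P + l ^ 3 * P ^ 2 := by ring
    rw [hp, hX, hY, h3]; linarith
  have hr0 : 0 ≤ r := by rw [hr]; positivity
  have hrX : r ≤ X := by
    rw [hr, hX]; nlinarith [mul_le_mul_of_nonneg_left hPP (sq_nonneg l)]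
  have hlr0 : 0 ≤ l * r := by positivity
  have hlr : l * r ≤ Y := by
    have : l ^ 3 * (P * (1 - P)) ≤ l ^ 3 * P := by gcongr
    rw [hr, hY]; nlinarith
  have hllr : l ^ 2 * r ≤ Y := by
    have : l ^ 4 * (P * (1 - P)) ≤ l ^ 4 * P := by gcongr
    rw [hr, hY]; nlinarith
  have hplr : p * (l * r) ≤ 2 * Y := by
    have h1 : l ^ 3 * (P * (1 - P)) ≤ l ^ 3 * P := by gcongr
    have h2 : l ^ 4 * (P * (P * (1 - P))) ≤ l ^ 4 * P := by
      gcongr; nlinarith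
    have h3 : (1 + l * P) * (l * (l ^ 2 * (P * (1 - P)))) =
      l ^ 3 * (P * (1 - P)) + l ^ 4 * (P * (P * (1 - P))) := by ring
    rw [hr, hY, hp, h3]; linarith
  exact ⟨hp1, hpX, hXY, hp2, hX2, hpXY, hr0, hrX, hlr, hllr, hplr⟩

theorem abs_wave_weight_deriv_le {K Z f a p X : ℝ} (hK : 0 ≤ K) (hZ : 0 ≤ Z) (hf : 0 ≤ f) (hf1 : f ≤ 1) (ha : |a| ≤ K)
    (hp1 : 1 ≤ p) (hpX : p ≤ X) :
    |4 * f ^ 3 * a * Z + f ^ 4 * (-4 * Z * p)| ≤ f ^ 2 * Z * ((4 * K + 4) * X) := by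
  have hX1 : 1 ≤ X := hp1.trans hpX
  have f3 : f ^ 3 ≤ f ^ 2 := pow_le_pow_of_le_one hf hf1 (by norm_num)
  have f4 : f ^ 4 ≤ f ^ 2 := pow_le_pow_of_le_one hf hf1 (by norm_num)
  calc _ ≤ |4 * f ^ 3 * a * Z| + |f ^ 4 * (-4 * Z * p)| := abs_add_le _ _
    _ = f ^ 3 * Z * (4 * |a|) + f ^ 4 * Z * (4 * p) := by
      simp only [abs_mul, abs_neg, abs_of_nonneg hZ, abs_of_nonneg (pow_nonneg hf _),
        abs_of_nonneg (zero_le_one.trans hp1)]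
      norm_num; ring
    _ ≤ f ^ 2 * Z * (4 * (K * X)) + f ^ 2 * Z * (4 * X) := by
      gcongr
      exact ha.trans (le_mul_of_one_le_right hK hX1)
    _ = _ := by ring

theorem abs_wave_weight_deriv2_le {K Z f a b p X r : ℝ} (hK : 0 ≤ K) (hZ : 0 ≤ Z) (hf : 0 ≤ f) (hf1 : f ≤ 1)
    (ha : |a| ≤ K)
    (hb : |b| ≤ K) (hp1 : 1 ≤ p) (hpX : p ≤ X) (hp2 : p ^ 2 ≤ 2 * X)
    (hr0 : 0 ≤ r) (hrX : r ≤ X) :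
    |(12 * f ^ 2 * a ^ 2 + 4 * f ^ 3 * b) * Z + 8 * f ^ 3 * a * (-4 * Z * p) +
      f ^ 4 * (16 * Z * p ^ 2 - 4 * Z * r)|
      ≤ f ^ 2 * Z * ((12 * K ^ 2 + 36 * K + 36) * X) := by
  have hX1 : 1 ≤ X := hp1.trans hpX
  obtain ⟨ha1, ha2⟩ := abs_le.1 ha
  have haa : a ^ 2 ≤ K ^ 2 := sq_le_sq' ha1 ha2
  have f3 : f ^ 3 ≤ f ^ 2 := pow_le_pow_of_le_one hf hf1 (by norm_num)
  have f4 : f ^ 4 ≤ f ^ 2 := pow_le_pow_of_le_one hf hf1 (by norm_num)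
  calc _ ≤ (|12 * f ^ 2 * a ^ 2| + |4 * f ^ 3 * b|) * |Z| + |8 * f ^ 3 * a * (-4 * Z * p)| +
        |f ^ 4| * (|16 * Z * p ^ 2| + |4 * Z * r|) := by
        refine (abs_add_le _ _).trans (add_le_add ((abs_add_le _ _).trans
          (add_le_add ?_ le_rfl)) ?_)
        · rw [abs_mul]; gcongr; exact abs_add_le _ _
        · rw [abs_mul]; gcongr; exact abs_sub _ _
    _ = f ^ 2 * Z * (12 * |a| ^ 2) + f ^ 3 * Z * (4 * |b| + 32 * (|a| * p)) +
        f ^ 4 * Z * (16 * p ^ 2 + 4 * r) := by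
      simp only [abs_mul, abs_neg, abs_pow, abs_of_nonneg hZ, abs_of_nonneg hf,
        abs_of_nonneg (zero_le_one.trans hp1), abs_of_nonneg hr0]
      norm_num; ring
    _ ≤ f ^ 2 * Z * (12 * (K ^ 2 * X)) + f ^ 2 * Z * (4 * (K * X) + 32 * (K * X)) +
        f ^ 2 * Z * (16 * (2 * X) + 4 * X) := by
      gcongr
      · rw [sq_abs]; exact haa.trans (le_mul_of_one_le_right (sq_nonneg _) hX1)
      · exact hb.trans (le_mul_of_one_le_right hK hX1)
    _ = _ := by ring

theorem abs_wave_tension_deriv_le {K l Z f a p X Y r : ℝ} (hK : 0 ≤ K) (hZ : 0 ≤ Z) (hf : 0 ≤ f) (hf1 : f ≤ 1) (ha : |a| ≤ K)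
    (hl0 : 0 ≤ l) (hp1 : 1 ≤ p) (hpX : p ≤ X) (hXY : X ≤ Y) (hpXY : p * X ≤ 3 * Y)
    (hr0 : 0 ≤ r) (hlr : l * r ≤ Y) :
    |2 * f * a * (Z * X) + f ^ 2 * (-4 * Z * p * X + Z * (l * r))| ≤ Z * ((2 * K + 13) * Y) := by
  have hX1 : 1 ≤ X := hp1.trans hpX
  have hY1 : 1 ≤ Y := hX1.trans hXY
  have hX0 : 0 ≤ X := zero_le_one.trans hX1
  have f2 : f ^ 2 ≤ 1 := pow_le_one₀ hf hf1
  calc _ ≤ |2 * f * a * (Z * X)| + |f ^ 2| * (|-4 * Z * p * X| + |Z * (l * r)|) := by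
        refine (abs_add_le _ _).trans (add_le_add le_rfl ?_)
        rw [abs_mul]; gcongr; exact abs_add_le _ _
    _ = f * Z * (2 * (|a| * X)) + f ^ 2 * Z * (4 * (p * X) + l * r) := by
      simp only [abs_mul, abs_neg, abs_pow, abs_of_nonneg hZ, abs_of_nonneg hf,
        abs_of_nonneg (zero_le_one.trans hp1), abs_of_nonneg hr0,
        abs_of_nonneg (zero_le_one.trans hX1), abs_of_nonneg hl0]
      norm_num; ring
    _ ≤ 1 * Z * (2 * (K * Y)) + 1 * Z * (4 * (3 * Y) + Y) := by
      gcongr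
    _ = _ := by ring

theorem abs_wave_tension_deriv2_le {K l P Z f a b p X Y r : ℝ} (hK : 0 ≤ K) (hZ : 0 ≤ Z) (hf : 0 ≤ f) (hf1 : f ≤ 1) (ha : |a| ≤ K)
    (hb : |b| ≤ K) (hl0 : 0 ≤ l) (hP : 0 ≤ P) (hP1 : P ≤ 1) (hp1 : 1 ≤ p) (hpX : p ≤ X)
    (hXY : X ≤ Y) (hp2 : p ^ 2 ≤ 2 * X) (hX2 : X ^ 2 ≤ 2 * Y) (hpXY : p * X ≤ 3 * Y)
    (hr0 : 0 ≤ r) (hrX : r ≤ X) (hlr : l * r ≤ Y) (hllr : l ^ 2 * r ≤ Y)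
    (hplr : p * (l * r) ≤ 2 * Y) :
    |(2 * a ^ 2 + 2 * f * b) * (Z * X) +
      4 * f * a * (-4 * Z * p * X + Z * (l * r)) +
      f ^ 2 * ((16 * Z * p ^ 2 - 4 * Z * r) * X + 2 * (-4 * Z * p) * (l * r) +
      Z * (l ^ 2 * r * (1 - 2 * P)))|
      ≤ Z * ((2 * K ^ 2 + 54 * K + 89) * Y) := by
  have hX1 : 1 ≤ X := hp1.trans hpX
  have hY1 : 1 ≤ Y := hX1.trans hXY
  have hX0 : 0 ≤ X := zero_le_one.trans hX1
  obtain ⟨ha1, ha2⟩ := abs_le.1 ha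
  have haa : a ^ 2 ≤ K ^ 2 := sq_le_sq' ha1 ha2
  have f2 : f ^ 2 ≤ 1 := pow_le_one₀ hf hf1
  have h12 : |1 - 2 * P| ≤ 1 := abs_le.2 ⟨by linarith, by linarith⟩
  calc _ ≤ (|2 * a ^ 2| + |2 * f * b|) * |Z * X| +
        |4 * f * a| * (|-4 * Z * p * X| + |Z * (l * r)|) +
        |f ^ 2| * ((|16 * Z * p ^ 2| + |4 * Z * r|) * |X| + |2 * (-4 * Z * p) * (l * r)| +
          |Z * (l ^ 2 * r * (1 - 2 * P))|) := by
        refine (abs_add_le _ _).trans (add_le_add ((abs_add_le _ _).trans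
          (add_le_add ?_ ?_)) ?_)
        · rw [abs_mul]; gcongr; exact abs_add_le _ _
        · rw [abs_mul]; gcongr; exact abs_add_le _ _
        · rw [abs_mul]; gcongr
          refine (abs_add_le _ _).trans (add_le_add ((abs_add_le _ _).trans
            (add_le_add ?_ le_rfl)) le_rfl)
          rw [abs_mul]; gcongr; exact abs_sub _ _
    _ = Z * (2 * (|a| ^ 2 * X)) + f * Z * (2 * (|b| * X) + |a| * (16 * (p * X) + 4 * (l * r))) +
        f ^ 2 * Z * (16 * (p ^ 2 * X) + 4 * (r * X) + 8 * (p * (l * r)) +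
          l ^ 2 * r * |1 - 2 * P|) := by
      simp only [abs_mul, abs_neg, abs_pow, abs_of_nonneg hZ, abs_of_nonneg hf,
        abs_of_nonneg (zero_le_one.trans hp1), abs_of_nonneg hr0,
        abs_of_nonneg (zero_le_one.trans hX1), abs_of_nonneg hl0]
      norm_num; ring
    _ ≤ Z * (2 * (K ^ 2 * Y)) + 1 * Z * (2 * (K * Y) + K * (16 * (3 * Y) + 4 * Y)) +
        1 * Z * (16 * (2 * (2 * Y)) + 4 * (2 * Y) + 8 * (2 * Y) + Y * 1) := by
      have q1 : p ^ 2 * X ≤ 2 * (2 * Y) := by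
        calc p ^ 2 * X ≤ 2 * X * X := by gcongr
          _ ≤ 2 * (2 * Y) := by nlinarith
      have q2 : r * X ≤ 2 * Y := by
        calc r * X ≤ X * X := by gcongr
          _ ≤ 2 * Y := by nlinarith
      gcongr
    _ = _ := by ring

theorem wave_weight_bound {N K l P Z f a b p X Y r : ℝ} (hN : 0 ≤ N) (hK : 0 ≤ K) (hl : 1 ≤ l)
    (hP : 0 ≤ P) (hP1 : P ≤ 1) (hZ : 0 ≤ Z) (hf : 0 ≤ f) (hf1 : f ≤ 1) (ha : |a| ≤ K)
    (hb : |b| ≤ K) (hp : p = 1 + l * P) (hX : X = 1 + l ^ 2 * P) (hY : Y = 1 + l ^ 4 * P)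
    (hr : r = l ^ 2 * (P * (1 - P))) :
    (4 * f ^ 3 * a * Z + f ^ 4 * (-4 * Z * p)) ^ 2 ≤
        f ^ 4 * Z * (waveC1 K * (f ^ 2 * (Z * X))) ∧
      (waveC1 K * (f ^ 2 * (Z * X))) ^ 2 ≤ f ^ 4 * Z * (waveC2 N K * (Z * Y)) ∧
      (|(12 * f ^ 2 * a ^ 2 + 4 * f ^ 3 * b) * Z + 8 * f ^ 3 * a * (-4 * Z * p) +
          f ^ 4 * (16 * Z * p ^ 2 - 4 * Z * r)| +
        N * |4 * f ^ 3 * a * Z + f ^ 4 * (-4 * Z * p)|) ^ 2 ≤ f ^ 4 * Z * (waveC2 N K * (Z * Y)) ∧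
      |waveC1 K * ((2 * a ^ 2 + 2 * f * b) * (Z * X) + 4 * f * a * (-4 * Z * p * X + Z * (l * r)) +
          f ^ 2 * ((16 * Z * p ^ 2 - 4 * Z * r) * X + 2 * (-4 * Z * p) * (l * r) +
            Z * (l ^ 2 * r * (1 - 2 * P))))| +
        N * |waveC1 K * (2 * f * a * (Z * X) + f ^ 2 * (-4 * Z * p * X + Z * (l * r)))| ≤
        waveC2 N K * (Z * Y) := by
  obtain ⟨hp1, hpX, hXY, hp2, hX2, hpXY, hr0, hrX, hlr, hllr, hplr⟩ :=
    wave_factor_bounds hl hP hP1 hp hX hY hr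
  have hX1 : 1 ≤ X := hp1.trans hpX
  have hY1 : 1 ≤ Y := hX1.trans hXY
  have hX0 : 0 ≤ X := zero_le_one.trans hX1
  obtain ⟨ha1, ha2⟩ := abs_le.1 ha
  have haa : a ^ 2 ≤ K ^ 2 := sq_le_sq' ha1 ha2
  have hC1 : 0 ≤ waveC1 K := by unfold waveC1; positivity
  have hC3 : 0 ≤ waveC3 N K := by unfold waveC3; positivity
  have hZZ : 0 ≤ f ^ 4 * Z ^ 2 := by positivity
  have hrest : 0 ≤ waveC1 K * (2 * K ^ 2 + 54 * K + 89 + N * (2 * K + 13)) := by positivity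
  have f2 : f ^ 2 ≤ 1 := pow_le_one₀ hf hf1
  have f3 : f ^ 3 ≤ f ^ 2 := pow_le_pow_of_le_one hf hf1 (by norm_num)
  have f4 : f ^ 4 ≤ f ^ 2 := pow_le_pow_of_le_one hf hf1 (by norm_num)
  have hl0 : 0 ≤ l := by linarith
  have absW1 := abs_wave_weight_deriv_le hK hZ hf hf1 ha hp1 hpX
  have absW2 := abs_wave_weight_deriv2_le hK hZ hf hf1 ha hb hp1 hpX hp2 hr0 hrX
  have absT1 := abs_wave_tension_deriv_le hK hZ hf hf1 ha hl0 hp1 hpX hXY hpXY hr0 hlr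
  have absT2 := abs_wave_tension_deriv2_le hK hZ hf hf1 ha hb hl0 hP hP1 hp1 hpX hXY hp2 hX2 hpXY
    hr0 hrX hlr hllr hplr
  refine ⟨?_, ?_, ?_, ?_⟩
  · have e : (4 * f ^ 3 * a * Z + f ^ 4 * (-4 * Z * p)) ^ 2 =
        f ^ 6 * Z ^ 2 * (4 * a - 4 * (f * p)) ^ 2 := by ring
    have hfp : (f * p) ^ 2 ≤ 2 * X := by
      calc (f * p) ^ 2 = f ^ 2 * p ^ 2 := by ring
        _ ≤ 1 * (2 * X) := by gcongr
        _ = _ := by ring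
    have e2 : (4 * a - 4 * (f * p)) ^ 2 ≤ waveC1 K * X := by
      unfold waveC1
      nlinarith [sq_nonneg (4 * a + 4 * (f * p)), le_mul_of_one_le_right (sq_nonneg K) hX1]
    rw [e]
    calc _ ≤ f ^ 6 * Z ^ 2 * (waveC1 K * X) := by gcongr
      _ = _ := by ring
  · calc (waveC1 K * (f ^ 2 * (Z * X))) ^ 2 = f ^ 4 * Z ^ 2 * (waveC1 K ^ 2 * X ^ 2) := by ring
      _ ≤ f ^ 4 * Z ^ 2 * (waveC1 K ^ 2 * (2 * Y)) := by gcongr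
      _ = f ^ 4 * Z ^ 2 * (2 * waveC1 K ^ 2 * Y) := by ring
      _ ≤ f ^ 4 * Z ^ 2 * (waveC2 N K * Y) := by
        gcongr
        unfold waveC2
        linarith [sq_nonneg (waveC3 N K)]
      _ = _ := by ring
  · have h0 : |(12 * f ^ 2 * a ^ 2 + 4 * f ^ 3 * b) * Z + 8 * f ^ 3 * a * (-4 * Z * p) +
          f ^ 4 * (16 * Z * p ^ 2 - 4 * Z * r)| +
        N * |4 * f ^ 3 * a * Z + f ^ 4 * (-4 * Z * p)| ≤ f ^ 2 * Z * (waveC3 N K * X) := by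
      calc _ ≤ f ^ 2 * Z * ((12 * K ^ 2 + 36 * K + 36) * X) +
            N * (f ^ 2 * Z * ((4 * K + 4) * X)) :=
          add_le_add absW2 (mul_le_mul_of_nonneg_left absW1 hN)
        _ = _ := by unfold waveC3; ring
    calc _ ≤ (f ^ 2 * Z * (waveC3 N K * X)) ^ 2 := by gcongr
      _ = f ^ 4 * Z ^ 2 * (waveC3 N K ^ 2 * X ^ 2) := by ring
      _ ≤ f ^ 4 * Z ^ 2 * (waveC3 N K ^ 2 * (2 * Y)) := by gcongr
      _ = f ^ 4 * Z ^ 2 * (2 * waveC3 N K ^ 2 * Y) := by ring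
      _ ≤ f ^ 4 * Z ^ 2 * (waveC2 N K * Y) := by
        gcongr
        unfold waveC2
        linarith [sq_nonneg (waveC1 K)]
      _ = _ := by ring
  · rw [abs_mul, abs_mul (waveC1 K), abs_of_nonneg hC1]
    calc _ ≤ waveC1 K * (Z * ((2 * K ^ 2 + 54 * K + 89) * Y)) +
          N * (waveC1 K * (Z * ((2 * K + 13) * Y))) :=
        add_le_add (mul_le_mul_of_nonneg_left absT2 hC1)
          (mul_le_mul_of_nonneg_left (mul_le_mul_of_nonneg_left absT1 hC1) hN)
      _ = waveC1 K * (2 * K ^ 2 + 54 * K + 89 + N * (2 * K + 13)) * (Z * Y) := by ring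
      _ ≤ _ := by
        refine mul_le_mul_of_nonneg_right ?_ (mul_nonneg hZ (zero_le_one.trans hY1))
        unfold waveC2
        linarith [sq_nonneg (waveC1 K), sq_nonneg (waveC3 N K)]

end WaveAlgebra

theorem exists_smooth_cutoff : ∃ K : ℝ, 0 ≤ K ∧ ∃ f f1 f2 : ℝ → ℝ,
    (∀ s, HasDerivAt f (f1 s) s) ∧ (∀ s, HasDerivAt f1 (f2 s) s) ∧ Continuous f2 ∧
    (∀ s, 0 ≤ f s ∧ f s ≤ 1 ∧ |f1 s| ≤ K ∧ |f2 s| ≤ K) ∧ (∀ s ≤ 3, f s = 1) ∧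
    ∀ s, 4 ≤ s → f s = 0 ∧ f1 s = 0 ∧ f2 s = 0 := by
  set f : ℝ → ℝ := fun s => Real.smoothTransition (7 - 2 * s) with hf
  have cf : ContDiff ℝ ∞ f := Real.smoothTransition.contDiff.comp (by fun_prop)
  have cf1 : ContDiff ℝ ∞ (deriv f) := (contDiff_infty_iff_deriv.1 cf).2
  have cf2 : ContDiff ℝ ∞ (deriv (deriv f)) := (contDiff_infty_iff_deriv.1 cf1).2
  have hf0 : ∀ s, 7 / 2 ≤ s → f s = 0 := fun s hs =>
    Real.smoothTransition.zero_of_nonpos (by linarith)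
  have hf1 : ∀ s ≤ 3, f s = 1 := fun s hs => Real.smoothTransition.one_of_one_le (by linarith)
  have bd : ∀ g : ℝ → ℝ, ContDiff ℝ ∞ g → (∀ s, 7 / 2 < s → deriv g s = 0) →
      (∀ s, s < 3 → deriv g s = 0) → ∃ K, 0 ≤ K ∧ ∀ s, |deriv g s| ≤ K := fun g cg h4 h3 => by
    obtain ⟨K, hK⟩ := (isCompact_Icc (a := (3 : ℝ)) (b := 7 / 2)).exists_bound_of_continuousOn
      (cg.continuous_deriv (by simp)).continuousOn
    refine ⟨max K 0, le_max_right _ _, fun s => ?_⟩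
    by_cases hs : s ∈ Icc (3 : ℝ) (7 / 2)
    · exact (hK s hs).trans (le_max_left _ _)
    · have : deriv g s = 0 := by
        rcases lt_or_ge s 3 with h | h
        · exact h3 s h
        · exact h4 s (not_le.1 fun h' => hs ⟨h, h'⟩)
      simp [this]
  have g4 : ∀ s, 7 / 2 < s → deriv f s = 0 := fun s hs => by
    have : f =ᶠ[nhds s] fun _ => 0 := by
      filter_upwards [lt_mem_nhds hs] with z hz using hf0 z hz.le
    rw [this.deriv_eq, deriv_const]
  have g3 : ∀ s, s < 3 → deriv f s = 0 := fun s hs => by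
    have : f =ᶠ[nhds s] fun _ => 1 := by
      filter_upwards [gt_mem_nhds hs] with z hz using hf1 z hz.le
    rw [this.deriv_eq, deriv_const]
  have k4 : ∀ s, 7 / 2 < s → deriv (deriv f) s = 0 := fun s hs => by
    have : deriv f =ᶠ[nhds s] fun _ => 0 := by
      filter_upwards [lt_mem_nhds hs] with z hz using g4 z hz
    rw [this.deriv_eq, deriv_const]
  have k3 : ∀ s, s < 3 → deriv (deriv f) s = 0 := fun s hs => by
    have : deriv f =ᶠ[nhds s] fun _ => 0 := by
      filter_upwards [gt_mem_nhds hs] with z hz using g3 z hz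
    rw [this.deriv_eq, deriv_const]
  obtain ⟨K1, hK1, b1⟩ := bd f cf g4 g3
  obtain ⟨K2, hK2, b2⟩ := bd _ cf1 k4 k3
  exact ⟨max K1 K2, le_max_of_le_left hK1, f, deriv f, deriv (deriv f),
    fun s => ((cf.differentiable (by simp)) s).hasDerivAt,
    fun s => ((cf1.differentiable (by simp)) s).hasDerivAt, cf2.continuous,
    fun s => ⟨Real.smoothTransition.nonneg _, Real.smoothTransition.le_one _,
      (b1 s).trans (le_max_left _ _), (b2 s).trans (le_max_right _ _)⟩, hf1,
    fun s hs => ⟨hf0 s (by linarith), g4 s (by linarith), k4 s (by linarith)⟩⟩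

section WaveWeight

variable {l : ℝ} {f f1 f2 P Z : ℝ → ℝ}

theorem hasDerivAt_wave_weight (hf : ∀ s, HasDerivAt f (f1 s) s)
    (hZ : ∀ s, HasDerivAt Z (-4 * Z s * (1 + l * P s)) s) (s : ℝ) :
    HasDerivAt (fun s => f s ^ 4 * Z s)
      (4 * f s ^ 3 * f1 s * Z s + f s ^ 4 * (-4 * Z s * (1 + l * P s))) s :=
  (((hf s).pow 4).mul (hZ s)).congr_deriv (by simp)

theorem hasDerivAt_wave_weight_deriv (hf : ∀ s, HasDerivAt f (f1 s) s)
    (hf1 : ∀ s, HasDerivAt f1 (f2 s) s) (hP : ∀ s, HasDerivAt P (l * (P s * (1 - P s))) s)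
    (hZ : ∀ s, HasDerivAt Z (-4 * Z s * (1 + l * P s)) s) (s : ℝ) :
    HasDerivAt (fun s => 4 * f s ^ 3 * f1 s * Z s + f s ^ 4 * (-4 * Z s * (1 + l * P s)))
      ((12 * f s ^ 2 * f1 s ^ 2 + 4 * f s ^ 3 * f2 s) * Z s +
        8 * f s ^ 3 * f1 s * (-4 * Z s * (1 + l * P s)) +
        f s ^ 4 * (16 * Z s * (1 + l * P s) ^ 2 - 4 * Z s * (l ^ 2 * (P s * (1 - P s))))) s := by
  have h1 := ((((hf s).pow 3).const_mul 4).mul (hf1 s)).mul (hZ s)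
  have h2 := ((hf s).pow 4).mul (((hZ s).const_mul (-4)).mul (((hP s).const_mul l).const_add 1))
  exact (h1.add h2).congr_deriv (by simp; ring)

theorem hasDerivAt_wave_tension (c : ℝ) (hf : ∀ s, HasDerivAt f (f1 s) s)
    (hP : ∀ s, HasDerivAt P (l * (P s * (1 - P s))) s)
    (hZ : ∀ s, HasDerivAt Z (-4 * Z s * (1 + l * P s)) s) (s : ℝ) :
    HasDerivAt (fun s => c * (f s ^ 2 * (Z s * (1 + l ^ 2 * P s))))
      (c * (2 * f s * f1 s * (Z s * (1 + l ^ 2 * P s)) +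
        f s ^ 2 * (-4 * Z s * (1 + l * P s) * (1 + l ^ 2 * P s) +
          Z s * (l * (l ^ 2 * (P s * (1 - P s))))))) s :=
  ((((hf s).pow 2).mul ((hZ s).mul (((hP s).const_mul (l ^ 2)).const_add 1))).const_mul
    c).congr_deriv (by simp only [Pi.mul_apply, Pi.pow_apply]; push_cast; ring)

theorem hasDerivAt_wave_tension_deriv (c : ℝ) (hf : ∀ s, HasDerivAt f (f1 s) s)
    (hf1 : ∀ s, HasDerivAt f1 (f2 s) s) (hP : ∀ s, HasDerivAt P (l * (P s * (1 - P s))) s)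
    (hZ : ∀ s, HasDerivAt Z (-4 * Z s * (1 + l * P s)) s) (s : ℝ) :
    HasDerivAt (fun s => c * (2 * f s * f1 s * (Z s * (1 + l ^ 2 * P s)) +
        f s ^ 2 * (-4 * Z s * (1 + l * P s) * (1 + l ^ 2 * P s) +
          Z s * (l * (l ^ 2 * (P s * (1 - P s)))))))
      (c * ((2 * f1 s ^ 2 + 2 * f s * f2 s) * (Z s * (1 + l ^ 2 * P s)) +
        4 * f s * f1 s * (-4 * Z s * (1 + l * P s) * (1 + l ^ 2 * P s) +
          Z s * (l * (l ^ 2 * (P s * (1 - P s))))) +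
        f s ^ 2 * ((16 * Z s * (1 + l * P s) ^ 2 - 4 * Z s * (l ^ 2 * (P s * (1 - P s)))) *
            (1 + l ^ 2 * P s) +
          2 * (-4 * Z s * (1 + l * P s)) * (l * (l ^ 2 * (P s * (1 - P s)))) +
          Z s * (l ^ 2 * (l ^ 2 * (P s * (1 - P s))) * (1 - 2 * P s))))) s := by
  have hX := ((hP s).const_mul (l ^ 2)).const_add 1
  have hp := ((hP s).const_mul l).const_add 1
  have h1 := (((hf s).const_mul 2).mul (hf1 s)).mul ((hZ s).mul hX)
  have h2 := ((((hZ s).const_mul (-4)).mul hp).mul hX).add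
    ((hZ s).mul ((((hP s).mul ((hP s).const_sub 1)).const_mul (l ^ 2)).const_mul l))
  exact ((h1.add (((hf s).pow 2).mul h2)).const_mul c).congr_deriv (by
    simp only [Pi.mul_apply, Pi.pow_apply, Pi.add_apply]; push_cast; ring)

end WaveWeight

theorem sigmoid_le_exp (x : ℝ) : Real.sigmoid x ≤ Real.exp x := by
  rw [Real.sigmoid_def, ← inv_inv (Real.exp x), ← Real.exp_neg]
  exact inv_anti₀ (Real.exp_pos _) (by linarith)

theorem radialWeight_wave (n : ℕ) : ∃ B : ℝ, 0 < B ∧ ∃ f : ℝ → ℝ, Continuous f ∧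
    (∀ s, 0 ≤ f s ∧ f s ≤ 1) ∧ (∀ s ≤ 3, f s = 1) ∧ ∀ D, 1 ≤ D → ∀ l, 1 ≤ l → ∀ t1 τ t2, t1 ≤ τ →
    ∃ Wt W1 W2 T T1 T2, RadialWeight n
      (fun s t => f (s / D) ^ 4 * (Real.exp (-4 * s - 4 * B * (t - t1)) *
        (1 - Real.sigmoid (l * (s - 2 * D) + B * l ^ 4 * (t - t1))) ^ 4))
      Wt W1 W2 T T1 T2 (fun _ => 8 * B * l ^ 4 * Real.exp (-4 * (l * D))) (4 * D) τ t2 := by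
  obtain ⟨K, hK, f, f1, f2, df, df1, cf2, hb, hf3, hf4⟩ := exists_smooth_cutoff
  set C2 := waveC2 (n + 1) K with hC2
  have hC2p : 0 < C2 := by
    have h1 : 0 < waveC1 K := by unfold waveC1; positivity
    rw [hC2]; unfold waveC2; positivity
  have cf : Continuous f := continuous_iff_continuousAt.2 fun s => (df s).continuousAt
  have cf1 : Continuous f1 := continuous_iff_continuousAt.2 fun s => (df1 s).continuousAt
  refine ⟨25 / 2 * C2, by positivity, f, cf, fun s => ⟨(hb s).1, (hb s).2.1⟩, hf3,
    fun D hD l hl t1 τ t2 hτ => ?_⟩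
  set B := 25 / 2 * C2 with hB
  have hBp : 0 < B := by positivity
  have hD0 : 0 < D := by linarith
  let g : ℝ → ℝ := fun s => f (s / D)
  let g1 : ℝ → ℝ := fun s => f1 (s / D) / D
  let g2 : ℝ → ℝ := fun s => f2 (s / D) / D ^ 2
  have dg : ∀ s, HasDerivAt g (g1 s) s := fun s =>
    ((df (s / D)).comp s ((hasDerivAt_id s).div_const D)).congr_deriv (by simp [g1]; ring)
  have dg1 : ∀ s, HasDerivAt g1 (g2 s) s := fun s =>
    (((df1 (s / D)).comp s ((hasDerivAt_id s).div_const D)).div_const D).congr_deriv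
      (by simp [g2]; ring)
  have cg : Continuous g := by fun_prop
  have cg1 : Continuous g1 := by fun_prop
  have cg2 : Continuous g2 := by fun_prop
  let P : ℝ → ℝ → ℝ := fun s t => Real.sigmoid (l * (s - 2 * D) + B * l ^ 4 * (t - t1))
  let Z : ℝ → ℝ → ℝ := fun s t => Real.exp (-4 * s - 4 * B * (t - t1)) * (1 - P s t) ^ 4
  have cs := continuous_sigmoid
  have cP : Continuous fun p : ℝ × ℝ => P p.1 p.2 := by fun_prop
  have cZ : Continuous fun p : ℝ × ℝ => Z p.1 p.2 :=
    (by fun_prop : Continuous fun p : ℝ × ℝ => Real.exp (-4 * p.1 - 4 * B * (p.2 - t1))).mul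
      ((continuous_const.sub cP).pow 4)
  have cPs : ∀ t, Continuous fun s => P s t := fun t =>
    cP.comp (continuous_id.prodMk continuous_const)
  have cZs : ∀ t, Continuous fun s => Z s t := fun t =>
    cZ.comp (continuous_id.prodMk continuous_const)
  have dP : ∀ t s, HasDerivAt (fun s => P s t) (l * (P s t * (1 - P s t))) s := fun t s =>
    ((Real.hasDerivAt_sigmoid _).comp s
      ((((hasDerivAt_id s).sub_const (2 * D)).const_mul l).add_const _)).congr_deriv
      (by simp [P]; ring)
  have dPt : ∀ t s, HasDerivAt (fun t => P s t) (B * l ^ 4 * (P s t * (1 - P s t))) t := fun t s =>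
    ((Real.hasDerivAt_sigmoid _).comp t
      ((((hasDerivAt_id t).sub_const t1).const_mul (B * l ^ 4)).const_add _)).congr_deriv
      (by simp [P]; ring)
  have dZ : ∀ t s, HasDerivAt (fun s => Z s t) (-4 * Z s t * (1 + l * P s t)) s := fun t s =>
    (((((hasDerivAt_id s).const_mul (-4)).sub_const _).exp).mul
      (((dP t s).const_sub 1).pow 4)).congr_deriv (by simp [Z]; ring)
  have dZt : ∀ t s, HasDerivAt (fun t => Z s t)
      (Z s t * (-(4 * B) - 4 * B * l ^ 4 * P s t)) t := fun t s =>
    ((((((hasDerivAt_id t).sub_const t1).const_mul (4 * B)).const_sub (-4 * s)).exp).mul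
      (((dPt t s).const_sub 1).pow 4)).congr_deriv (by simp [Z]; ring)
  have P0 : ∀ s t, 0 ≤ P s t := fun s t => (Real.sigmoid_pos _).le
  have P1 : ∀ s t, P s t ≤ 1 := fun s t => Real.sigmoid_le_one _
  have Z0 : ∀ s t, 0 ≤ Z s t := fun s t => by
    have := P1 s t
    positivity
  have g4 : ∀ s, 4 * D ≤ s → g s = 0 ∧ g1 s = 0 ∧ g2 s = 0 := fun s hs => by
    have := hf4 (s / D) (by rwa [le_div_iff₀ hD0])
    simp [g, g1, g2, this]
  refine ⟨fun s t => g s ^ 4 * (Z s t * (-(4 * B) - 4 * B * l ^ 4 * P s t)), _, _, _, _, _,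
    fun t _ s => hasDerivAt_wave_weight dg (dZ t) s,
    fun t _ s => hasDerivAt_wave_weight_deriv dg dg1 (dP t) (dZ t) s,
    fun t _ s => hasDerivAt_wave_tension (waveC1 K) dg (dP t) (dZ t) s,
    fun t _ s => hasDerivAt_wave_tension_deriv (waveC1 K) dg dg1 (dP t) (dZ t) s,
    fun t _ => ?_, fun t _ => ?_, fun t _ s => (dZt t s).const_mul _, ?_, ?_, ?_,
    continuousOn_const, fun t _ s hs => ?_, fun t ht s _ => ?_⟩
  · have := cZs t
    have := cPs t
    fun_prop
  · have := cZs t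
    have := cPs t
    fun_prop
  · exact (((cg.comp continuous_fst).pow 4).mul cZ).continuousOn
  · refine Continuous.continuousOn ?_
    fun_prop
  · refine Continuous.continuousOn ?_
    fun_prop
  · show g s ^ 4 * Z s t = 0 ∧ g s ^ 4 * (Z s t * (-(4 * B) - 4 * B * l ^ 4 * P s t)) = 0 ∧
      waveC1 K * (g s ^ 2 * (Z s t * (1 + l ^ 2 * P s t))) = 0
    rw [(g4 s hs).1]
    refine ⟨?_, ?_, ?_⟩ <;> ring
  · have tt : 0 ≤ t - t1 := by linarith [ht.1]
    have ag : 0 ≤ g s ∧ g s ≤ 1 := ⟨(hb _).1, (hb _).2.1⟩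
    have ag1 : |g1 s| ≤ K := by
      simp only [g1, abs_div, abs_of_pos hD0]
      exact (div_le_self (abs_nonneg _) hD).trans (hb _).2.2.1
    have ag2 : |g2 s| ≤ K := by
      simp only [g2, abs_div, abs_of_pos (pow_pos hD0 2)]
      exact (div_le_self (abs_nonneg _) (one_le_pow₀ hD)).trans (hb _).2.2.2
    obtain ⟨b1, b2, b3, b4⟩ := wave_weight_bound (N := n + 1) (by positivity) hK hl (P0 s t) (P1 s t)
      (Z0 s t) ag.1 ag.2 ag1 ag2 rfl rfl rfl rfl
    have hz := Z0 s t
    have hp := P0 s t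
    have hC1 : 0 ≤ waveC1 K := by unfold waveC1; positivity
    refine ⟨mul_nonneg (pow_nonneg ag.1 4) hz, by positivity, b1, ?_⟩
    by_cases hs : s < 4 * D
    · refine ⟨C2 * (Z s t * (1 + l ^ 4 * P s t)), by positivity, b2, b3, b4, ?_⟩
      rw [if_pos hs]
      have e : g s ^ 4 * (Z s t * (-(4 * B) - 4 * B * l ^ 4 * P s t)) +
          50 * (C2 * (Z s t * (1 + l ^ 4 * P s t))) =
          (1 - g s ^ 4) * (4 * B * (Z s t * (1 + l ^ 4 * P s t))) := by rw [hB]; ring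
      show g s ^ 4 * (Z s t * (-(4 * B) - 4 * B * l ^ 4 * P s t)) +
          50 * (C2 * (Z s t * (1 + l ^ 4 * P s t))) ≤ _
      rw [e]
      rcases le_or_gt s (3 * D) with h3 | h3
      · have : g s = 1 := hf3 _ (by rwa [div_le_iff₀ hD0])
        rw [this]; simp; positivity
      · have hl4 : 1 ≤ l ^ 4 := one_le_pow₀ hl
        have zle : Z s t ≤ Real.exp (-4 * (l * D)) := by
          have q1 : Real.exp (-4 * s - 4 * B * (t - t1)) ≤ 1 := by
            rw [Real.exp_le_one_iff]; linarith [mul_nonneg hBp.le tt]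
          have q2 : 1 - P s t ≤ Real.exp (-(l * D)) := by
            have : 1 - P s t = Real.sigmoid (-(l * (s - 2 * D) + B * l ^ 4 * (t - t1))) := by
              rw [Real.sigmoid_neg]
            rw [this]
            refine (sigmoid_le_exp _).trans (Real.exp_le_exp.2 ?_)
            have : 0 ≤ B * l ^ 4 * (t - t1) := by positivity
            have : l * D ≤ l * (s - 2 * D) := mul_le_mul_of_nonneg_left (by linarith) (by linarith)
            linarith
          calc Z s t ≤ 1 * Real.exp (-(l * D)) ^ 4 :=
                mul_le_mul q1 (pow_le_pow_left₀ (by linarith [P1 s t]) q2 4)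
                  (pow_nonneg (by linarith [P1 s t]) 4) zero_le_one
            _ = _ := by rw [one_mul, ← Real.exp_nat_mul]; congr 1; push_cast; ring
        have yle : 1 + l ^ 4 * P s t ≤ 2 * l ^ 4 := by
          linarith [mul_le_of_le_one_right (zero_le_one.trans hl4) (P1 s t)]
        calc _ ≤ 1 * (4 * B * (Real.exp (-4 * (l * D)) * (2 * l ^ 4))) := by
              have : 0 ≤ g s ^ 4 := pow_nonneg ag.1 4
              gcongr
              linarith
          _ = _ := by ring
    · obtain ⟨z0, z1, z2⟩ := g4 s (not_lt.1 hs)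
      refine ⟨0, le_rfl, ?_, ?_, ?_, ?_⟩ <;> simp [z0, z1, z2, hs]

theorem exists_wave_step (n : ℕ) : ∃ B : ℝ, 0 < B ∧ ∀ V : EuclideanSpace ℝ (Fin n) × ℝ → ℝ,
    IsBiharmonicSol V → ContinuousOn V (univ ×ˢ Icc 0 1) → ∀ D ℓ t1 t2, 1 ≤ D → D ≤ ℓ → 0 ≤ t1 →
      t1 ≤ t2 → t2 ≤ 1 → (∀ t ∈ Icc t1 t2, ∫ x in jball n (4 * D), V (x, t) ^ 2 ≤ Real.exp ℓ) →
      B * ℓ ^ 3 * (t2 - t1) ≤ D ^ 4 →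
      ∫ x in jball n D, Real.exp (-4 * japanese x) * V (x, t2) ^ 2 ≤
        Real.exp (B * (t2 - t1)) *
          ((∫ x in jball n (4 * D), Real.exp (-4 * japanese x) * V (x, t1) ^ 2) +
            B * Real.exp (-ℓ)) := by
  obtain ⟨b, hb, f, cf, f01, f1, key⟩ := radialWeight_wave n
  refine ⟨50000 * b + 4, by positivity, fun V hV cV D ℓ t1 t2 hD hℓ ht1 ht12 ht2 hE hδ => ?_⟩
  have hD0 : 0 < D := by linarith
  have hℓ0 : 0 < ℓ := by linarith
  have cj := continuous_japanese (n := n)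
  have cVt : ∀ t ∈ Icc t1 t2, Continuous fun x => V (x, t) := fun t ht =>
    continuous_slice_of_continuousOn cV ⟨ht1.trans ht.1, ht.2.trans ht2⟩
  have m1 : t1 ∈ Icc t1 t2 := ⟨le_rfl, ht12⟩
  have m2 : t2 ∈ Icc t1 t2 := ⟨ht12, le_rfl⟩
  have q1 : Continuous fun x => V (x, t1) ^ 2 := (cVt t1 m1).pow 2
  have q2 : Continuous fun x => V (x, t2) ^ 2 := (cVt t2 m2).pow 2
  have cs := continuous_sigmoid
  rcases ht12.eq_or_lt with rfl | hlt
  · have : ∫ x in jball n D, Real.exp (-4 * japanese x) * V (x, t1) ^ 2 ≤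
        ∫ x in jball n (4 * D), Real.exp (-4 * japanese x) * V (x, t1) ^ 2 :=
      integral_jball_mono (by fun_prop) (by fun_prop) (by linarith) (fun x _ => le_rfl)
        fun x _ => by positivity
    have h0 : 0 ≤ (50000 * b + 4) * Real.exp (-ℓ) := by positivity
    simp only [sub_self, mul_zero, Real.exp_zero, one_mul]
    linarith
  set l := 4 * ℓ / D with hl
  have hlD : l * D = 4 * ℓ := by rw [hl]; field_simp
  have hl1 : 1 ≤ l := by rw [hl, le_div_iff₀ hD0]; linarith
  set δ := t2 - t1 with hδ'
  have hδ0 : 0 < δ := by linarith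
  have hδ1 : δ ≤ 1 := by linarith
  set W : ℝ → ℝ → ℝ := fun s t => f (s / D) ^ 4 * (Real.exp (-4 * s - 4 * b * (t - t1)) *
        (1 - Real.sigmoid (l * (s - 2 * D) + b * l ^ 4 * (t - t1))) ^ 4) with hW
  have sg : ∀ y, 0 ≤ 1 - Real.sigmoid y ∧ 1 - Real.sigmoid y ≤ 1 := fun y =>
    ⟨by linarith [Real.sigmoid_le_one y], by linarith [Real.sigmoid_pos y]⟩
  have W0 : ∀ s t, 0 ≤ W s t := fun s t =>
    mul_nonneg (pow_nonneg (f01 _).1 4) (mul_nonneg (Real.exp_pos _).le (pow_nonneg (sg _).1 4))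
  have cW : Continuous fun p : ℝ × ℝ => W p.1 p.2 := by rw [hW]; fun_prop
  have cWs : ∀ t, Continuous fun x : EuclideanSpace ℝ (Fin n) => W (japanese x) t := fun t =>
    cW.comp (f := fun x : EuclideanSpace ℝ (Fin n) => (japanese x, t))
      (cj.prodMk continuous_const)
  have main : (∫ x in jball n (4 * D), W (japanese x) t2 * V (x, t2) ^ 2) ≤
      (∫ x in jball n (4 * D), W (japanese x) t1 * V (x, t1) ^ 2) +
      ∫ t in t1..t2, 8 * b * l ^ 4 * Real.exp (-4 * (l * D)) *
        ∫ x in jball n (4 * D), V (x, t) ^ 2 := by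
    obtain ⟨Wt, W1, W2, T, T1, T2, hw⟩ := key D hD l hl1 t1 t1 t2 le_rfl
    have : ∀ τ ∈ Ioc t1 t2, RadialWeight n W Wt W1 W2 T T1 T2
        (fun _ => 8 * b * l ^ 4 * Real.exp (-4 * (l * D))) (4 * D) τ t2 := fun τ hτ => by
      have hs : Icc τ t2 ⊆ Icc t1 t2 := Icc_subset_Icc_left hτ.1.le
      have hs' : (univ : Set ℝ) ×ˢ Icc τ t2 ⊆ univ ×ˢ Icc t1 t2 := prod_mono subset_rfl hs
      exact ⟨fun t ht => hw.deriv_W t (hs ht), fun t ht => hw.deriv_W1 t (hs ht),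
        fun t ht => hw.deriv_T t (hs ht), fun t ht => hw.deriv_T1 t (hs ht),
        fun t ht => hw.cont_W2 t (hs ht), fun t ht => hw.cont_T2 t (hs ht),
        fun t ht => hw.deriv_Wt t (hs ht), hw.cont_W.mono hs', hw.cont_Wt.mono hs',
        hw.cont_T.mono hs', hw.cont_β.mono hs, fun t ht => hw.zero t (hs ht),
        fun t ht => hw.bound t (hs ht)⟩
    exact RadialWeight.energy_le_of_continuousOn this cW.continuousOn continuousOn_const ht1 hlt hV
      (cV.mono (prod_mono subset_rfl (Icc_subset_Icc ht1 ht2)))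
  have start : ∫ x in jball n (4 * D), W (japanese x) t1 * V (x, t1) ^ 2 ≤
      ∫ x in jball n (4 * D), Real.exp (-4 * japanese x) * V (x, t1) ^ 2 := by
    refine integral_jball_mono ((cWs t1).mul q1) (by fun_prop) le_rfl (fun x _ => ?_)
      fun x _ => by positivity
    refine mul_le_mul_of_nonneg_right ?_ (sq_nonneg _)
    simp only [hW, sub_self, mul_zero, sub_zero]
    calc _ ≤ 1 * (Real.exp (-4 * japanese x) * 1) := by
          gcongr
          · exact pow_le_one₀ (f01 _).1 (f01 _).2
          · exact pow_le_one₀ (sg _).1 (sg _).2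
      _ = _ := by ring
  have err : ∫ t in t1..t2, 8 * b * l ^ 4 * Real.exp (-4 * (l * D)) *
        ∫ x in jball n (4 * D), V (x, t) ^ 2 ≤ 50000 * b * Real.exp (-ℓ) := by
    have h1 : ∫ t in t1..t2, 8 * b * l ^ 4 * Real.exp (-4 * (l * D)) *
        ∫ x in jball n (4 * D), V (x, t) ^ 2 ≤
        ∫ t in t1..t2, 8 * b * l ^ 4 * Real.exp (-4 * (l * D)) * Real.exp ℓ := by
      refine intervalIntegral.integral_mono_on ht12 ?_ (by simp) fun t ht => ?_
      · refine ContinuousOn.intervalIntegrable ?_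
        rw [uIcc_of_le ht12]
        exact continuousOn_const.mul (continuousOn_integral_jball (G := fun p => V p ^ 2) _
          ((cV.mono (prod_mono subset_rfl (Icc_subset_Icc ht1 ht2))).pow 2))
      · gcongr
        exact hE t ht
    refine h1.trans ?_
    rw [intervalIntegral.integral_const, smul_eq_mul, ← hδ', hlD]
    have hl4 : l ^ 4 ≤ 256 * ℓ ^ 4 := by
      have : l ≤ 4 * ℓ := by rw [hl]; exact div_le_self (by positivity) hD
      calc l ^ 4 ≤ (4 * ℓ) ^ 4 := by gcongr
        _ = _ := by ring
    have hℓ4 : ℓ ^ 4 ≤ 24 * Real.exp ℓ := by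
      have := Real.pow_div_factorial_le_exp ℓ hℓ0.le 4
      rw [div_le_iff₀ (by positivity)] at this
      norm_num [Nat.factorial] at this
      linarith
    calc δ * (8 * b * l ^ 4 * Real.exp (-4 * (4 * ℓ)) * Real.exp ℓ) ≤
          1 * (8 * b * (256 * (24 * Real.exp ℓ)) * Real.exp (-4 * (4 * ℓ)) * Real.exp ℓ) := by
          gcongr
          exact hl4.trans (by gcongr)
      _ = 49152 * b * (Real.exp ℓ * Real.exp (-4 * (4 * ℓ)) * Real.exp ℓ) := by ring
      _ = 49152 * b * Real.exp (-(14 * ℓ)) := by rw [← Real.exp_add, ← Real.exp_add]; ring_nf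
      _ ≤ 50000 * b * Real.exp (-ℓ) := by
        gcongr <;> linarith
  have fin : ∫ x in jball n D, Real.exp (-4 * japanese x) * V (x, t2) ^ 2 ≤
      ∫ x in jball n (4 * D), (Real.exp (4 * b * δ) * (W (japanese x) t2 * V (x, t2) ^ 2) +
        4 * Real.exp (-(2 * ℓ)) * V (x, t2) ^ 2) := by
    have q3 : Continuous fun x => Real.exp (4 * b * δ) * (W (japanese x) t2 * V (x, t2) ^ 2) +
        4 * Real.exp (-(2 * ℓ)) * V (x, t2) ^ 2 :=
      (continuous_const.mul ((cWs t2).mul q2)).add (continuous_const.mul q2)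
    refine integral_jball_mono (by fun_prop) q3 (by linarith) (fun x hx => ?_) fun x _ => ?_
    · have hx' : japanese x < D := hx
      have hf : f (japanese x / D) = 1 := f1 _ (by rw [div_le_iff₀ hD0]; linarith)
      set S := Real.sigmoid (l * (japanese x - 2 * D) + b * l ^ 4 * (t2 - t1)) with hS
      have hSle : S ≤ Real.exp (-(2 * ℓ)) := by
        refine (sigmoid_le_exp _).trans (Real.exp_le_exp.2 ?_)
        have h1 : l * (japanese x - 2 * D) ≤ l * (-D) := by gcongr; linarith
        have h2 : b * l ^ 3 * δ ≤ D / 2 := by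
          have : b * l ^ 3 * δ * D ^ 3 = b * (l * D) ^ 3 * δ := by ring
          rw [← mul_le_mul_iff_left₀ (pow_pos hD0 3), this, hlD]
          have h3 : 0 ≤ ℓ ^ 3 * δ := by positivity
          nlinarith [mul_nonneg hb.le h3]
        have h4 : b * l ^ 4 * (t2 - t1) ≤ l * (D / 2) := by
          calc b * l ^ 4 * (t2 - t1) = l * (b * l ^ 3 * δ) := by ring
            _ ≤ _ := by gcongr
        linarith
      have hexp : Real.exp (4 * b * δ) * (W (japanese x) t2) =
          Real.exp (-4 * japanese x) * (1 - S) ^ 4 := by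
        simp only [hW, hf, one_pow, one_mul]
        rw [← mul_assoc, ← Real.exp_add]
        congr 2; ring
      have hS0 : 0 ≤ S := (Real.sigmoid_pos _).le
      have hS1 : S ≤ 1 := Real.sigmoid_le_one _
      have hbern : 1 ≤ (1 - S) ^ 4 + 4 * S := by
        have := one_add_mul_le_pow (a := -S) (by linarith) 4
        rw [← sub_eq_add_neg] at this
        push_cast at this; linarith
      have he1 : Real.exp (-4 * japanese x) ≤ 1 := by
        rw [Real.exp_le_one_iff]; linarith [japanese_pos x]
      have he0 := (Real.exp_pos (-4 * japanese x)).le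
      rw [← mul_assoc, hexp, ← add_mul]
      refine mul_le_mul_of_nonneg_right ?_ (sq_nonneg _)
      nlinarith [mul_le_mul_of_nonneg_left hbern he0, mul_le_mul_of_nonneg_right he1 hS0]
    · have := W0 (japanese x) t2
      positivity
  have i1 : IntegrableOn (fun x => Real.exp (4 * b * δ) * (W (japanese x) t2 * V (x, t2) ^ 2))
      (jball n (4 * D)) :=
    integrableOn_jball_of_continuous (continuous_const.mul ((cWs t2).mul q2)) _
  have i2 : IntegrableOn (fun x => 4 * Real.exp (-(2 * ℓ)) * V (x, t2) ^ 2) (jball n (4 * D)) :=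
    integrableOn_jball_of_continuous (continuous_const.mul q2) _
  rw [integral_add i1 i2, integral_const_mul, integral_const_mul] at fin
  have hE2 : 4 * Real.exp (-(2 * ℓ)) * ∫ x in jball n (4 * D), V (x, t2) ^ 2 ≤
      4 * Real.exp (-ℓ) := by
    calc _ ≤ 4 * Real.exp (-(2 * ℓ)) * Real.exp ℓ := by gcongr; exact hE t2 m2
      _ = 4 * (Real.exp (-(2 * ℓ)) * Real.exp ℓ) := by ring
      _ = _ := by rw [← Real.exp_add]; ring_nf
  have hF : 0 ≤ ∫ x in jball n (4 * D), Real.exp (-4 * japanese x) * V (x, t1) ^ 2 :=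
    integral_nonneg fun x => by positivity
  set F := ∫ x in jball n (4 * D), Real.exp (-4 * japanese x) * V (x, t1) ^ 2
  calc _ ≤ Real.exp (4 * b * δ) * (F + 50000 * b * Real.exp (-ℓ)) + 4 * Real.exp (-ℓ) := by
        refine fin.trans (add_le_add (mul_le_mul_of_nonneg_left ?_ (Real.exp_pos _).le) hE2)
        linarith
    _ ≤ Real.exp ((50000 * b + 4) * δ) * (F + 50000 * b * Real.exp (-ℓ)) +
        Real.exp ((50000 * b + 4) * δ) * (4 * Real.exp (-ℓ)) := by
      have : 1 ≤ Real.exp ((50000 * b + 4) * δ) := Real.one_le_exp (by positivity)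
      refine add_le_add ?_ (le_mul_of_one_le_left (by positivity) this)
      gcongr
      linarith
    _ = _ := by ring

theorem not_summable_add_pow {h : ℕ → ℝ} (hh : ∀ k, 0 < h k) {α : ℝ} (hα : 0 < α)
    (hs : ¬ Summable fun k => (256 : ℝ) ^ k / h k ^ 3) :
    ¬ Summable fun k => (256 : ℝ) ^ k / (α * 4 ^ k + h k) ^ 3 := by
  refine fun H => hs ?_
  have ev : ∀ᶠ k in atTop, (256 : ℝ) ^ k / (α * 4 ^ k + h k) ^ 3 < 1 / (8 * α ^ 3) :=
    H.tendsto_atTop_zero.eventually (gt_mem_nhds (by positivity))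
  refine Summable.of_norm_bounded_eventually_nat (g := fun k =>
    8 * ((256 : ℝ) ^ k / (α * 4 ^ k + h k) ^ 3)) (H.mul_left 8) ?_
  filter_upwards [ev] with k hk
  have hk0 := hh k
  have h4 : (1 : ℝ) ≤ 4 ^ k := one_le_pow₀ (by norm_num)
  have e : (256 : ℝ) ^ k = (4 ^ k) ^ 4 := by rw [← pow_mul, mul_comm, pow_mul]; norm_num
  have hle : α * 4 ^ k ≤ h k := by
    by_contra hc
    push Not at hc
    rw [div_lt_div_iff₀ (by positivity) (by positivity), one_mul, e] at hk
    have h1 : (α * 4 ^ k + h k) ^ 3 ≤ (2 * (α * 4 ^ k)) ^ 3 := by gcongr; linarith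
    have h2 : (2 * (α * 4 ^ k)) ^ 3 ≤ ((4 : ℝ) ^ k) ^ 4 * (8 * α ^ 3) := by
      calc (2 * (α * 4 ^ k)) ^ 3 = ((4 : ℝ) ^ k) ^ 3 * 1 * (8 * α ^ 3) := by ring
        _ ≤ ((4 : ℝ) ^ k) ^ 3 * 4 ^ k * (8 * α ^ 3) := by gcongr
        _ = _ := by ring
    linarith
  rw [Real.norm_of_nonneg (by positivity)]
  calc (256 : ℝ) ^ k / h k ^ 3 = 8 * (256 ^ k / (2 * h k) ^ 3) := by field_simp; norm_num
    _ ≤ 8 * (256 ^ k / (α * 4 ^ k + h k) ^ 3) := by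
      gcongr
      linarith

theorem volume_real_jball_le (n : ℕ) : ∃ c : ℝ, 0 ≤ c ∧ ∀ Q, 0 ≤ Q →
    volume.real (jball n Q) ≤ c * Q ^ n := by
  refine ⟨volume.real (ball (0 : EuclideanSpace ℝ (Fin n)) 1), measureReal_nonneg, fun Q hQ => ?_⟩
  have h1 : volume.real (jball n Q) ≤ volume.real (closedBall (0 : EuclideanSpace ℝ (Fin n)) Q) :=
    measureReal_mono ((jball_subset Q).trans ball_subset_closedBall)
      (measure_closedBall_lt_top.ne)
  refine h1.trans_eq ?_
  rw [measureReal_def, Measure.addHaar_closedBall _ _ hQ, finrank_euclideanSpace_fin,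
    ENNReal.toReal_mul, ENNReal.toReal_ofReal (by positivity), measureReal_def, mul_comm]

/-- The dyadic growth condition for solutions on the unit time interval. -/
def DyadicGrowth {n : ℕ} (V : EuclideanSpace ℝ (Fin n) × ℝ → ℝ) : Prop :=
  ∃ a : ℝ, 0 < a ∧ ∃ g : ℕ → ℝ, (∀ k, 0 < g k) ∧ (¬ Summable fun k => (256 : ℝ) ^ k / g k ^ 3) ∧
    ∀ k, ∫ t in (0 : ℝ)..1, t ^ a * ∫ x in jball n (4 ^ k), V (x, t) ^ 2 ≤ Real.exp (g k)

section WeightedBound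

variable {n : ℕ} {V : EuclideanSpace ℝ (Fin n) × ℝ → ℝ}

theorem DyadicGrowth.exists_exponent (hg : DyadicGrowth V) (hV : IsBiharmonicSol V)
    (cV : ContinuousOn V (univ ×ˢ Icc 0 1)) {M : ℝ} (hM : ∀ x, |V (x, 0)| ≤ M) :
    ∃ ℓ : ℕ → ℝ, (∀ k, 4 ^ k ≤ ℓ k) ∧ (¬ Summable fun k => (256 : ℝ) ^ k / ℓ k ^ 3) ∧
      ∀ k, ∀ t ∈ Icc (0 : ℝ) 1, ∫ x in jball n (4 * 4 ^ k), V (x, t) ^ 2 ≤ Real.exp (ℓ k) := by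
  obtain ⟨a, ha, g, g0, gs, hg⟩ := hg
  obtain ⟨κ, hκ, C, hC, m, key⟩ := exists_integral_sq_le n ha
  obtain ⟨v, hv, hvol⟩ := volume_real_jball_le n
  obtain ⟨i, hi⟩ := pow_unbounded_of_one_lt (2 + κ) (by norm_num : (1 : ℝ) < 4)
  have hM0 : 0 ≤ M := (abs_nonneg _).trans (hM 0)
  set p := i + 1 with hp
  set A : ℝ := (4 ^ p) ^ (m + n) * M ^ 2 * v * (m + n).factorial + C + M ^ 2 * v * (4 ^ n * n.factorial) with hA
  have hA0 : 0 ≤ A := by positivity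
  have e4 : ∀ N k : ℕ, ((4 : ℝ) ^ k) ^ N ≤ N.factorial * Real.exp (4 ^ k) := fun N k => by
    have := Real.pow_div_factorial_le_exp ((4 : ℝ) ^ k) (by positivity) N
    rwa [div_le_iff₀ (by positivity), mul_comm] at this
  refine ⟨fun k => (1 + A) * 4 ^ k + g (k + p), fun k => ?_, ?_, fun k t ht => ?_⟩
  · have := g0 (k + p)
    have : 0 ≤ A * 4 ^ k := by positivity
    linarith
  · refine not_summable_add_pow (fun k => g0 _) (by linarith) fun H => gs ?_
    rw [← summable_nat_add_iff p]
    refine (H.mul_left (256 ^ p)).congr fun k => ?_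
    rw [pow_add]; ring
  · have h4 : (1 : ℝ) ≤ 4 ^ k := one_le_pow₀ (by norm_num)
    have hgk := (g0 (k + p)).le
    have fin : A * Real.exp (4 ^ k + g (k + p)) ≤ Real.exp ((1 + A) * 4 ^ k + g (k + p)) := by
      calc A * Real.exp (4 ^ k + g (k + p)) ≤ Real.exp (A * 4 ^ k) * Real.exp (4 ^ k + g (k + p)) := by
            gcongr
            have := Real.add_one_le_exp (A * 4 ^ k)
            nlinarith
        _ = _ := by rw [← Real.exp_add]; congr 1; ring
    refine le_trans ?_ fin
    have ek : Real.exp (4 ^ k) ≤ Real.exp (4 ^ k + g (k + p)) := Real.exp_le_exp.2 (by linarith)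
    have eg : Real.exp (g (k + p)) ≤ Real.exp (4 ^ k + g (k + p)) :=
      Real.exp_le_exp.2 (by linarith)
    set E := Real.exp (4 ^ k + g (k + p))
    have hE : 0 < E := Real.exp_pos _
    rcases ht.1.eq_or_lt with rfl | ht0
    · have c0 : Continuous fun x => V (x, 0) := continuous_slice_of_continuousOn cV ht
      have : ∫ x in jball n (4 * 4 ^ k), V (x, 0) ^ 2 ≤ ∫ x in jball n (4 * 4 ^ k), M ^ 2 :=
        integral_jball_mono (c0.pow 2) continuous_const le_rfl
          (fun x _ => sq_le_sq' (abs_le.1 (hM x)).1 (abs_le.1 (hM x)).2) fun x _ => sq_nonneg _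
      rw [setIntegral_const, smul_eq_mul] at this
      calc _ ≤ v * (4 * 4 ^ k) ^ n * M ^ 2 := by
            refine this.trans ?_
            gcongr
            exact hvol _ (by positivity)
        _ = v * (4 ^ n * (4 ^ k) ^ n) * M ^ 2 := by rw [mul_pow]
        _ ≤ v * (4 ^ n * (n.factorial * E)) * M ^ 2 := by
          gcongr
          exact (e4 n k).trans (by gcongr)
        _ = M ^ 2 * v * (4 ^ n * n.factorial) * E := by ring
        _ ≤ A * E := by
          gcongr
          rw [hA]
          have : 0 ≤ (4 ^ p : ℝ) ^ (m + n) * M ^ 2 * v * (m + n).factorial := by positivity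
          linarith
    · have h1 := key V hV cV M hM (4 * 4 ^ k + 1) (by linarith) t ⟨ht0, ht.2⟩
      rw [add_sub_cancel_right] at h1
      have hR : 4 * 4 ^ k + 1 + κ ≤ (4 : ℝ) ^ (k + p) := by
        have : (4 : ℝ) ^ (k + p) = 4 * 4 ^ k * 4 ^ i := by rw [hp]; ring
        rw [this]
        nlinarith
      have hR0 : 0 ≤ 4 * 4 ^ k + 1 + κ := by positivity
      have ct : ∀ Q : ℝ, ContinuousOn (fun t : ℝ => t ^ a * ∫ x in jball n Q, V (x, t) ^ 2)
          (Icc 0 1) := fun Q => (continuousOn_id.rpow_const fun _ _ => Or.inr ha.le).mul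
            (continuousOn_integral_jball (G := fun p => V p ^ 2) _ (cV.pow 2))
      have h2 : ∫ t in (0 : ℝ)..1, t ^ a * ∫ x in jball n (4 * 4 ^ k + 1 + κ), V (x, t) ^ 2 ≤
          Real.exp (g (k + p)) := by
        refine le_trans (intervalIntegral.integral_mono_on zero_le_one ?_ ?_ fun s hs => ?_)
          (hg (k + p))
        · exact ContinuousOn.intervalIntegrable (by rw [uIcc_of_le zero_le_one]; exact ct _)
        · exact ContinuousOn.intervalIntegrable (by rw [uIcc_of_le zero_le_one]; exact ct _)
        · have c0 : Continuous fun x => V (x, s) := continuous_slice_of_continuousOn cV hs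
          refine mul_le_mul_of_nonneg_left ?_ (Real.rpow_nonneg hs.1 _)
          exact integral_jball_mono (c0.pow 2) (c0.pow 2) hR (fun x _ => le_rfl)
            fun x _ => sq_nonneg _
      have h3 : (4 * 4 ^ k + 1 + κ) ^ m * M ^ 2 * volume.real (jball n (4 * 4 ^ k + 1 + κ)) ≤
          (4 ^ p) ^ (m + n) * M ^ 2 * v * (m + n).factorial * E := by
        calc _ ≤ (4 * 4 ^ k + 1 + κ) ^ m * M ^ 2 * (v * (4 * 4 ^ k + 1 + κ) ^ n) := by
              gcongr
              exact hvol _ hR0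
          _ = (4 * 4 ^ k + 1 + κ) ^ (m + n) * M ^ 2 * v := by ring
          _ ≤ (4 ^ (k + p)) ^ (m + n) * M ^ 2 * v := by gcongr
          _ = (4 ^ p) ^ (m + n) * M ^ 2 * v * (4 ^ k) ^ (m + n) := by
            rw [pow_add 4 k p, mul_pow]; ring
          _ ≤ (4 ^ p) ^ (m + n) * M ^ 2 * v * ((m + n).factorial * E) := by
            gcongr
            exact (e4 _ k).trans (by gcongr)
          _ = _ := by ring
      have h4 : C * ∫ t in (0 : ℝ)..1, t ^ a * ∫ x in jball n (4 * 4 ^ k + 1 + κ), V (x, t) ^ 2 ≤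
          C * E := mul_le_mul_of_nonneg_left (h2.trans eg) hC
      have h5 : 0 ≤ M ^ 2 * v * (4 ^ n * n.factorial) * E := by positivity
      rw [hA]
      linarith

end WeightedBound

theorem integrable_exp_neg_japanese (n : ℕ) :
    Integrable fun x : EuclideanSpace ℝ (Fin n) => Real.exp (-4 * japanese x) := by
  have h : Integrable fun x : EuclideanSpace ℝ (Fin n) =>
      ((n + 1).factorial : ℝ) * (1 + ‖x‖) ^ (-((n + 1 : ℕ) : ℝ)) :=
    (integrable_one_add_norm (by rw [finrank_euclideanSpace_fin]; exact_mod_cast Nat.lt_succ_self n)).const_mul _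
  have cj := continuous_japanese (n := n)
  refine h.mono' (by fun_prop) (ae_of_all _ fun x => ?_)
  rw [Real.norm_of_nonneg (Real.exp_pos _).le, Real.rpow_neg (by positivity), Real.rpow_natCast,
    ← div_eq_mul_inv, le_div_iff₀ (by positivity)]
  have h1 := Real.pow_div_factorial_le_exp (1 + ‖x‖) (by positivity) (n + 1)
  rw [div_le_iff₀ (by positivity)] at h1
  have h2 : 1 + ‖x‖ ≤ 4 * japanese x := by linarith [one_le_japanese x, norm_le_japanese x]
  calc _ ≤ Real.exp (-4 * japanese x) * (Real.exp (4 * japanese x) * (n + 1).factorial) := by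
        gcongr
        exact h1.trans (by gcongr)
    _ = _ := by rw [← mul_assoc, ← Real.exp_add]; simp

/-- Decreasing times obtained by subtracting the successive steps `δ`, truncated at `0`. -/
noncomputable def truncatedDescent (t : ℝ) (δ : ℕ → ℝ) : ℕ → ℝ
  | 0 => t
  | i + 1 => max (truncatedDescent t δ i - δ i) 0

theorem truncatedDescent_nonneg {t : ℝ} (ht : 0 ≤ t) (δ : ℕ → ℝ) (i : ℕ) :
    0 ≤ truncatedDescent t δ i := by
  cases i with
  | zero => exact ht
  | succ i => exact le_max_right _ _

theorem truncatedDescent_succ_le {t : ℝ} (ht : 0 ≤ t) {δ : ℕ → ℝ} (hδ : ∀ i, 0 ≤ δ i) (i : ℕ) :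
    truncatedDescent t δ (i + 1) ≤ truncatedDescent t δ i :=
  max_le (by linarith [hδ i]) (truncatedDescent_nonneg ht δ i)

theorem truncatedDescent_le {t : ℝ} (ht : 0 ≤ t) {δ : ℕ → ℝ} (hδ : ∀ i, 0 ≤ δ i) (i : ℕ) :
    truncatedDescent t δ i ≤ t := by
  induction i with
  | zero => exact le_rfl
  | succ i ih => exact (truncatedDescent_succ_le ht hδ i).trans ih

theorem exists_truncatedDescent_eq_zero {t : ℝ} (ht : 0 ≤ t) {δ : ℕ → ℝ} (hδ : ∀ i, 0 ≤ δ i)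
    (hs : ¬ Summable δ) : ∃ N, truncatedDescent t δ N = 0 := by
  by_contra! H
  have h : ∀ N, truncatedDescent t δ N = t - ∑ i ∈ Finset.range N, δ i := fun N => by
    induction N with
    | zero => simp [truncatedDescent]
    | succ N ih =>
      have h1 := H (N + 1)
      have h2 : truncatedDescent t δ (N + 1) = max (truncatedDescent t δ N - δ N) 0 := rfl
      rw [h2] at h1 ⊢
      rw [max_eq_left (le_of_not_ge fun h => h1 (max_eq_right h)), ih, Finset.sum_range_succ]
      ring
  refine hs (summable_of_sum_range_le (c := t) hδ fun N => ?_)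
  have := truncatedDescent_nonneg ht δ N
  rw [h N] at this
  linarith

theorem le_exp_mul_of_forall_le_exp_mul {f τ : ℕ → ℝ} {B b : ℝ} (hB : 0 ≤ B) (hb : 0 ≤ b)
    (hτ : ∀ i, τ (i + 1) ≤ τ i)
    (hf : ∀ i, f i ≤ Real.exp (B * (τ i - τ (i + 1))) * (f (i + 1) + b * (1 / 4) ^ i)) (N : ℕ) :
    f 0 ≤ Real.exp (B * (τ 0 - τ N)) * (f N + b * ∑ i ∈ Finset.range N, (1 / 4 : ℝ) ^ i) := by
  induction N with
  | zero => simp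
  | succ N ih =>
    refine ih.trans ?_
    have hd : 0 ≤ τ N - τ (N + 1) := sub_nonneg.2 (hτ N)
    rw [Finset.sum_range_succ]
    have hS0 : 0 ≤ ∑ i ∈ Finset.range N, (1 / 4 : ℝ) ^ i := Finset.sum_nonneg fun i _ => by positivity
    generalize ∑ i ∈ Finset.range N, (1 / 4 : ℝ) ^ i = S at hS0 ⊢
    have he : 1 ≤ Real.exp (B * (τ N - τ (N + 1))) := Real.one_le_exp (mul_nonneg hB hd)
    have e : Real.exp (B * (τ 0 - τ (N + 1))) =
        Real.exp (B * (τ 0 - τ N)) * Real.exp (B * (τ N - τ (N + 1))) := by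
      rw [← Real.exp_add]; congr 1; ring
    rw [e, mul_assoc]
    refine mul_le_mul_of_nonneg_left ?_ (Real.exp_pos _).le
    have h1 := hf N
    have h2 := le_mul_of_one_le_left (mul_nonneg hb hS0) he
    linarith

theorem sum_range_quarter_pow_le (N : ℕ) : ∑ i ∈ Finset.range N, (1 / 4 : ℝ) ^ i ≤ 2 :=
  (Finset.sum_le_sum fun i _ => pow_le_pow_left₀ (by norm_num) (by norm_num) i).trans
    (sum_geometric_two_le N)

section InitialData

variable {n : ℕ}

theorem exp_neg_le_quarter_pow {ℓ : ℝ} {k : ℕ} (h : 4 ^ k ≤ ℓ) : Real.exp (-ℓ) ≤ (1 / 4) ^ k := by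
  calc Real.exp (-ℓ) ≤ Real.exp (-(4 ^ k)) := by gcongr
    _ ≤ (4 ^ k)⁻¹ := by
      rw [Real.exp_neg]
      gcongr
      linarith [Real.add_one_le_exp ((4 : ℝ) ^ k)]
    _ = _ := by simp

theorem exists_weighted_integral_le (n : ℕ) : ∃ B : ℝ, 0 ≤ B ∧
    ∀ V : EuclideanSpace ℝ (Fin n) × ℝ → ℝ, IsBiharmonicSol V →
      ContinuousOn V (univ ×ˢ Icc 0 1) → ∀ J : ℝ,
      (∀ k : ℕ, ∫ x in jball n (4 ^ k), Real.exp (-4 * japanese x) * V (x, 0) ^ 2 ≤ J) →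
      ∀ ℓ : ℕ → ℝ, (∀ k, 4 ^ k ≤ ℓ k) → (¬ Summable fun k => (256 : ℝ) ^ k / ℓ k ^ 3) →
      (∀ k, ∀ t ∈ Icc (0 : ℝ) 1, ∫ x in jball n (4 * 4 ^ k), V (x, t) ^ 2 ≤ Real.exp (ℓ k)) →
      ∀ t ∈ Icc (0 : ℝ) 1, ∀ k0 : ℕ,
      ∫ x in jball n (4 ^ k0), Real.exp (-4 * japanese x) * V (x, t) ^ 2 ≤
        Real.exp B * (J + 2 * B * (1 / 4) ^ k0) := by
  obtain ⟨B, hB, step⟩ := exists_wave_step n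
  refine ⟨B, hB.le, fun V hV cV J hJ ℓ hℓ sℓ hE t ht k0 => ?_⟩
  have hℓ0 : ∀ k, 0 < ℓ k := fun k => lt_of_lt_of_le (by positivity) (hℓ k)
  set δ : ℕ → ℝ := fun i => 256 ^ (k0 + i) / (B * ℓ (k0 + i) ^ 3) with hδ
  have hδ0 : ∀ i, 0 ≤ δ i := fun i => by have := hℓ0 (k0 + i); positivity
  have hδs : ¬ Summable δ := fun H => sℓ <| by
    rw [← summable_nat_add_iff k0]
    refine (H.mul_left B).congr fun k => ?_
    have := hℓ0 (k0 + k)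
    simp only [hδ, add_comm k k0]
    field_simp
  set τ := truncatedDescent t δ with hτ
  have τ0 : ∀ i, 0 ≤ τ i := truncatedDescent_nonneg ht.1 δ
  have τs : ∀ i, τ (i + 1) ≤ τ i := truncatedDescent_succ_le ht.1 hδ0
  have τ1 : ∀ i, τ i ≤ 1 := fun i => (truncatedDescent_le ht.1 hδ0 i).trans ht.2
  set f : ℕ → ℝ := fun i => ∫ x in jball n (4 ^ (k0 + i)),
    Real.exp (-4 * japanese x) * V (x, τ i) ^ 2 with hf
  have one : ∀ i, f i ≤ Real.exp (B * (τ i - τ (i + 1))) *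
      (f (i + 1) + B * (1 / 4) ^ k0 * (1 / 4) ^ i) := fun i => by
    have h2 : τ i - τ (i + 1) ≤ δ i := by
      have : τ i - δ i ≤ τ (i + 1) := le_max_left _ _
      linarith
    have h3 : B * ℓ (k0 + i) ^ 3 * (τ i - τ (i + 1)) ≤ (4 ^ (k0 + i)) ^ 4 := by
      have := hℓ0 (k0 + i)
      calc B * ℓ (k0 + i) ^ 3 * (τ i - τ (i + 1)) ≤ B * ℓ (k0 + i) ^ 3 * δ i :=
            mul_le_mul_of_nonneg_left h2 (by positivity)
        _ = 256 ^ (k0 + i) := mul_div_cancel₀ _ (by positivity)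
        _ = (4 ^ (k0 + i)) ^ 4 := by
          rw [← pow_mul, mul_comm, pow_mul, show (4 : ℝ) ^ 4 = 256 by norm_num]
    have h1 := step V hV cV (4 ^ (k0 + i)) (ℓ (k0 + i)) (τ (i + 1)) (τ i)
      (one_le_pow₀ (by norm_num)) (hℓ _) (τ0 _) (τs i) (τ1 i)
      (fun s hs => hE _ s ⟨(τ0 _).trans hs.1, hs.2.trans (τ1 i)⟩) h3
    rw [← pow_succ', add_assoc] at h1
    refine h1.trans (mul_le_mul_of_nonneg_left (add_le_add_right ?_ _) (Real.exp_pos _).le)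
    rw [mul_assoc, ← pow_add]
    exact mul_le_mul_of_nonneg_left (exp_neg_le_quarter_pow (hℓ _)) hB.le
  obtain ⟨N, hN⟩ := exists_truncatedDescent_eq_zero ht.1 hδ0 hδs
  have h := le_exp_mul_of_forall_le_exp_mul hB.le (by positivity) τs one N
  rw [show τ N = 0 from hN, sub_zero] at h
  have hfN : f N ≤ J := by
    simp only [hf, show τ N = 0 from hN]
    exact hJ _
  have f0 : 0 ≤ f N := integral_nonneg fun x => mul_nonneg (Real.exp_pos _).le (sq_nonneg _)
  have hs := sum_range_quarter_pow_le N
  have hs0 : 0 ≤ ∑ i ∈ Finset.range N, (1 / 4 : ℝ) ^ i := Finset.sum_nonneg fun i _ => by positivity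
  have hb : 0 ≤ B * (1 / 4) ^ k0 := by positivity
  calc _ = f 0 := rfl
    _ ≤ _ := h
    _ ≤ Real.exp B * (f N + B * (1 / 4) ^ k0 * ∑ i ∈ Finset.range N, (1 / 4 : ℝ) ^ i) := by
      refine mul_le_mul_of_nonneg_right (Real.exp_le_exp.2 ?_)
        (add_nonneg f0 (mul_nonneg hb hs0))
      exact mul_le_of_le_one_right hB.le (τ1 0)
    _ ≤ _ := by
      refine mul_le_mul_of_nonneg_left ?_ (Real.exp_pos _).le
      have := mul_le_mul_of_nonneg_left hs hb
      linarith

theorem exists_integral_sq_le_initial (n : ℕ) : ∃ C : ℝ, 0 ≤ C ∧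
    ∀ V : EuclideanSpace ℝ (Fin n) × ℝ → ℝ, IsBiharmonicSol V →
      ContinuousOn V (univ ×ˢ Icc 0 1) → DyadicGrowth V → ∀ M, (∀ x, |V (x, 0)| ≤ M) →
      ∀ Q, ∀ t ∈ Icc (0 : ℝ) 1, ∫ x in jball n Q, V (x, t) ^ 2 ≤ C * Real.exp (4 * Q) * M ^ 2 := by
  obtain ⟨B, hB, key⟩ := exists_weighted_integral_le n
  set I := ∫ x : EuclideanSpace ℝ (Fin n), Real.exp (-4 * japanese x) with hI
  have hI0 : 0 ≤ I := integral_nonneg fun x => (Real.exp_pos _).le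
  refine ⟨Real.exp B * I, by positivity, fun V hV cV hg M hM Q t ht => ?_⟩
  obtain ⟨ℓ, hℓ, sℓ, hE⟩ := hg.exists_exponent hV cV hM
  have cj := continuous_japanese (n := n)
  have init : ∀ k : ℕ, ∫ x in jball n (4 ^ k), Real.exp (-4 * japanese x) * V (x, 0) ^ 2 ≤
      I * M ^ 2 := fun k => by
    have c0 : Continuous fun x => V (x, 0) :=
      continuous_slice_of_continuousOn cV ⟨le_rfl, zero_le_one⟩
    have q0 : Continuous fun x => V (x, 0) ^ 2 := c0.pow 2
    have ce : Continuous fun x : EuclideanSpace ℝ (Fin n) => Real.exp (-4 * japanese x) := by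
      fun_prop
    calc _ ≤ ∫ x in jball n (4 ^ k), Real.exp (-4 * japanese x) * M ^ 2 :=
          integral_jball_mono (ce.mul q0) (ce.mul continuous_const) le_rfl (fun x _ =>
            mul_le_mul_of_nonneg_left (sq_le_sq' (abs_le.1 (hM x)).1 (abs_le.1 (hM x)).2)
              (Real.exp_pos _).le) fun x _ => mul_nonneg (Real.exp_pos _).le (sq_nonneg _)
      _ ≤ ∫ x : EuclideanSpace ℝ (Fin n), Real.exp (-4 * japanese x) * M ^ 2 :=
        setIntegral_le_integral ((integrable_exp_neg_japanese n).mul_const _)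
          (ae_of_all _ fun x => by positivity)
      _ = I * M ^ 2 := integral_mul_const _ _
  have bound := key V hV cV _ init ℓ hℓ sℓ hE t ht
  have ct : Continuous fun x => V (x, t) := continuous_slice_of_continuousOn cV ht
  have qt : Continuous fun x => V (x, t) ^ 2 := ct.pow 2
  have lim : Tendsto (fun k0 : ℕ => Real.exp B * (I * M ^ 2 + 2 * B * (1 / 4) ^ k0)) atTop
      (nhds (Real.exp B * (I * M ^ 2 + 2 * B * 0))) :=
    ((tendsto_pow_atTop_nhds_zero_of_lt_one (by norm_num) (by norm_num)).const_mul _ |>.const_add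
      _).const_mul _
  have ev : ∀ᶠ k0 : ℕ in atTop, Real.exp (-4 * Q) * ∫ x in jball n Q, V (x, t) ^ 2 ≤
      Real.exp B * (I * M ^ 2 + 2 * B * (1 / 4) ^ k0) := by
    have h4 : Tendsto (fun k : ℕ => (4 : ℝ) ^ k) atTop atTop :=
      tendsto_pow_atTop_atTop_of_one_lt (by norm_num)
    filter_upwards [h4.eventually_ge_atTop Q] with k0 hk0
    refine le_trans ?_ (bound k0)
    rw [← integral_const_mul]
    refine integral_jball_mono (by fun_prop) (by fun_prop) hk0 (fun x hx => ?_)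
      fun x _ => by positivity
    have hx' : japanese x < Q := hx
    exact mul_le_mul_of_nonneg_right (Real.exp_le_exp.2 (by linarith)) (sq_nonneg _)
  have h := ge_of_tendsto lim ev
  have e : Real.exp (4 * Q) * (Real.exp (-4 * Q) * ∫ x in jball n Q, V (x, t) ^ 2) =
      ∫ x in jball n Q, V (x, t) ^ 2 := by rw [← mul_assoc, ← Real.exp_add]; simp
  rw [← e]
  calc _ ≤ Real.exp (4 * Q) * (Real.exp B * (I * M ^ 2 + 2 * B * 0)) := by gcongr
    _ = _ := by ring

end InitialData

section LocalRegularity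

variable {n : ℕ}

/-- Interior energy estimate on the space-time cylinders `jball n Q × [t₂, 1]`. -/
theorem exists_local_energy_le (n : ℕ) {Q t1 t2 : ℝ} (hQ : 0 ≤ Q) (h1 : 0 < t1) (h12 : t1 < t2)
    (h2 : t2 ≤ 1) : ∃ C : ℝ, 0 ≤ C ∧ ∀ V : EuclideanSpace ℝ (Fin n) × ℝ → ℝ, IsBiharmonicSol V →
      (∫ x in jball n Q, V (x, 1) ^ 2) ≤
        C * ∫ t in t1..1, ∫ x in jball n (Q + 1), V (x, t) ^ 2 ∧
      (∫ t in t2..1, ∫ x in jball n Q, gradSq (fun y => V (y, t)) x) ≤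
        C * ∫ t in t1..1, ∫ x in jball n (Q + 1), V (x, t) ^ 2 := by
  set c := powerConst n 2 with hc
  have hcp : 0 < c := powerConst_pos n 2
  have ht11 : t1 < 1 := h12.trans_le h2
  set K := (Q + 1) ^ 6 + 50 * (c * ((Q + 1) ^ 2 + (Q + 1) ^ 4)) with hK
  have hK0 : 0 ≤ K := by positivity
  have hw := radialWeight_pow (n := n) (k := 2) (by norm_num) (g := fun _ => Q + 1) (g' := fun _ => 0)
    (h := fun t => t - t1) (h' := fun _ => 1) (β := fun _ => K) (Q := Q + 1) (t1 := t1) (t2 := 1)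
    (fun t _ => hasDerivAt_const t _) continuousOn_const
    (fun t _ => (hasDerivAt_id t).sub_const t1) continuousOn_const continuousOn_const
    (fun t ht => sub_nonneg.2 ht.1) (fun _ _ => le_rfl) (by linarith) fun t ht y hy hyQ => by
      have e1 : y ^ 6 ≤ (Q + 1) ^ 6 := pow_le_pow_left₀ hy hyQ 6
      have e2 : y ^ 2 ≤ (Q + 1) ^ 2 := pow_le_pow_left₀ hy hyQ 2
      have e3 : y ^ 4 ≤ (Q + 1) ^ 4 := pow_le_pow_left₀ hy hyQ 4
      have e4 : (t - t1) * (y ^ 2 + y ^ 4) ≤ 1 * ((Q + 1) ^ 2 + (Q + 1) ^ 4) :=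
        mul_le_mul (by linarith [ht.2]) (add_le_add e2 e3) (by positivity) zero_le_one
      have e5 := mul_le_mul_of_nonneg_left e4 hcp.le
      norm_num at e5 ⊢
      linarith
  refine ⟨K / (1 - t1) + K / (36 * (t2 - t1)), ?_, fun V hV => ?_⟩
  · have : 0 < 1 - t1 := by linarith
    have : 0 < t2 - t1 := by linarith
    positivity
  have main := hw.energy_le h1 ht11.le hV
  have hsub : (univ : Set (EuclideanSpace ℝ (Fin n))) ×ˢ Icc t1 1 ⊆ upperHalf n :=
    fun p hp => h1.trans_le hp.2.1
  have cV := hV.smooth.continuousOn.mono hsub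
  have cg := (continuousOn_gradSq hV.smooth).mono hsub
  have cj := continuous_japanese (n := n)
  have cI := continuousOn_integral_jball (G := fun p => V p ^ 2) (Q + 1) (cV.pow 2)
  have cgI := continuousOn_integral_jball Q cg
  set T : ℝ → ℝ → ℝ := fun s t => ((2 : ℕ) + 4 : ℝ) ^ 2 * ((t - t1) * max (Q + 1 - s) 0 ^ (2 + 2))
    with hT
  have cT : Continuous fun p : EuclideanSpace ℝ (Fin n) × ℝ => T (japanese p.1) p.2 := by
    simp only [hT]; fun_prop
  have cTI := continuousOn_integral_jball (Q + 1) (cT.continuousOn.mul cg)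
  set J := ∫ t in t1..1, ∫ x in jball n (Q + 1), V (x, t) ^ 2 with hJ
  have hJ0 : 0 ≤ J := intervalIntegral.integral_nonneg ht11.le fun t _ =>
    integral_nonneg fun x => sq_nonneg _
  have max1 : ∀ x ∈ jball n Q, 1 ≤ max (Q + 1 - japanese x) 0 := fun x hx => by
    have hx' : japanese x < Q := hx
    exact le_max_of_le_left (by linarith)
  have hg0 : ∀ t x, 0 ≤ gradSq (fun y => V (y, t)) x := fun t x =>
    Finset.sum_nonneg fun i _ => sq_nonneg _
  have hT0 : ∀ t ∈ Icc t1 1, ∀ x : EuclideanSpace ℝ (Fin n),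
      0 ≤ T (japanese x) t * gradSq (fun y => V (y, t)) x := fun t ht x => by
    have := sub_nonneg.2 ht.1
    have := hg0 t x
    positivity
  have partA : (1 - t1) * ∫ x in jball n Q, V (x, 1) ^ 2 ≤
      ∫ x in jball n (Q + 1), (1 - t1) * max (Q + 1 - japanese x) 0 ^ (2 + 4) * V (x, 1) ^ 2 := by
    have q : Continuous fun x => V (x, 1) ^ 2 :=
      (continuous_slice_of_continuousOn cV ⟨ht11.le, le_rfl⟩).pow 2
    have q2 : Continuous fun x : EuclideanSpace ℝ (Fin n) =>
      (1 - t1) * max (Q + 1 - japanese x) 0 ^ (2 + 4) := by fun_prop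
    have h10 : 0 ≤ 1 - t1 := by linarith
    rw [← integral_const_mul]
    refine integral_jball_mono (continuous_const.mul q) (q2.mul q) (by linarith) (fun x hx => ?_)
      fun x _ => mul_nonneg (mul_nonneg h10 (pow_nonneg (le_max_right _ _) _)) (sq_nonneg _)
    refine mul_le_mul_of_nonneg_right ?_ (sq_nonneg _)
    exact le_mul_of_one_le_right h10 (one_le_pow₀ (max1 x hx))
  have partB : 36 * (t2 - t1) * ∫ t in t2..1, ∫ x in jball n Q, gradSq (fun y => V (y, t)) x ≤
      ∫ t in t1..1, ∫ x in jball n (Q + 1), T (japanese x) t * gradSq (fun y => V (y, t)) x := by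
    have i1 : IntervalIntegrable (fun t => 36 * (t2 - t1) *
        ∫ x in jball n Q, gradSq (fun y => V (y, t)) x) volume t2 1 := by
      refine ((cgI.mono (Icc_subset_Icc_left h12.le)).const_smul (36 * (t2 - t1))).intervalIntegrable_of_Icc h2
    have i2 : IntervalIntegrable (fun t =>
        ∫ x in jball n (Q + 1), T (japanese x) t * gradSq (fun y => V (y, t)) x) volume t1 1 :=
      cTI.intervalIntegrable_of_Icc ht11.le
    calc _ = ∫ t in t2..1, 36 * (t2 - t1) * ∫ x in jball n Q, gradSq (fun y => V (y, t)) x :=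
          (intervalIntegral.integral_const_mul _ _).symm
      _ ≤ ∫ t in t2..1, ∫ x in jball n (Q + 1), T (japanese x) t * gradSq (fun y => V (y, t)) x := by
          refine intervalIntegral.integral_mono_on h2 i1
            (i2.mono_set (by
              rw [uIcc_of_le h2, uIcc_of_le ht11.le]; exact Icc_subset_Icc_left h12.le))
            fun t ht => ?_
          have ht' : t ∈ Icc t1 1 := ⟨h12.le.trans ht.1, ht.2⟩
          have ct := continuous_slice_of_continuousOn cg ht'
          have cTt : Continuous fun x : EuclideanSpace ℝ (Fin n) => T (japanese x) t :=
            cT.comp (continuous_id.prodMk continuous_const)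
          rw [← integral_const_mul]
          refine integral_jball_mono (continuous_const.mul ct) (cTt.mul ct) (by linarith)
            (fun x hx => mul_le_mul_of_nonneg_right ?_ (hg0 t x)) fun x _ => hT0 t ht' x
          have e1 : t2 - t1 ≤ (t - t1) * max (Q + 1 - japanese x) 0 ^ (2 + 2) :=
            (sub_le_sub_right ht.1 t1).trans
              (le_mul_of_one_le_right (sub_nonneg.2 ht'.1) (one_le_pow₀ (max1 x hx)))
          simp only [hT]
          norm_num at e1 ⊢
          linarith
      _ ≤ _ := by
          refine intervalIntegral.integral_mono_interval h12.le h2 le_rfl ?_ i2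
          refine (ae_restrict_iff' measurableSet_Ioc).2 (ae_of_all _ fun t ht => ?_)
          exact integral_nonneg fun x => hT0 t (Ioc_subset_Icc_self ht) x
  have r : (∫ x in jball n (Q + 1),
        (t1 - t1) * max (Q + 1 - japanese x) 0 ^ (2 + 4) * V (x, t1) ^ 2) +
      ∫ t in t1..1, K * ∫ x in jball n (Q + 1), V (x, t) ^ 2 = K * J := by
    simp [intervalIntegral.integral_const_mul, hJ]
  have main' := main.trans_eq r
  have A0 : 0 ≤ ∫ x in jball n Q, V (x, 1) ^ 2 := integral_nonneg fun x => sq_nonneg _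
  have B0 : 0 ≤ ∫ t in t2..1, ∫ x in jball n Q, gradSq (fun y => V (y, t)) x :=
    intervalIntegral.integral_nonneg h2 fun t _ => integral_nonneg fun x => hg0 t x
  have p1 : 0 < 1 - t1 := by linarith
  have p2 : 0 < 36 * (t2 - t1) := by linarith
  have s1 : 0 ≤ K / (1 - t1) * J := by positivity
  have s2 : 0 ≤ K / (36 * (t2 - t1)) * J := by positivity
  have A0' := mul_nonneg p1.le A0
  have B0' := mul_nonneg p2.le B0
  rw [add_mul]
  constructor
  · have : ∫ x in jball n Q, V (x, 1) ^ 2 ≤ K / (1 - t1) * J := by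
      rw [div_mul_eq_mul_div, le_div_iff₀ p1]
      linarith
    linarith
  · have : ∫ t in t2..1, ∫ x in jball n Q, gradSq (fun y => V (y, t)) x ≤
        K / (36 * (t2 - t1)) * J := by
      rw [div_mul_eq_mul_div, le_div_iff₀ p2]
      linarith
    linarith

end LocalRegularity

section Sobolev

variable {n : ℕ}

/-- The sum of squares of the mixed derivatives of `f` in the directions of a list. -/
noncomputable def mixedSq : List (Fin n) → (EuclideanSpace ℝ (Fin n) → ℝ) →
    EuclideanSpace ℝ (Fin n) → ℝ
  | [], f => fun x => f x ^ 2
  | i :: l, f => fun x => 2 * (mixedSq l f x + mixedSq l (dirD (coordDir i) f) x)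

theorem mixedSq_nonneg (l : List (Fin n)) (f : EuclideanSpace ℝ (Fin n) → ℝ)
    (x : EuclideanSpace ℝ (Fin n)) : 0 ≤ mixedSq l f x := by
  induction l generalizing f with
  | nil => exact sq_nonneg _
  | cons i l ih =>
    have := ih f
    have := ih (dirD (coordDir i) f)
    simp only [mixedSq]
    positivity

theorem continuous_mixedSq (l : List (Fin n)) {f : EuclideanSpace ℝ (Fin n) → ℝ}
    (hf : ContDiff ℝ ∞ f) : Continuous (mixedSq l f) := by
  induction l generalizing f with
  | nil => exact hf.continuous.pow 2
  | cons i l ih => exact continuous_const.mul ((ih hf).add (ih (hf.dirD (by simp) _)))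

theorem sq_le_intervalIntegral {g g' : ℝ → ℝ} (hg : ∀ s, HasDerivAt g (g' s) s)
    (cg : Continuous g') : g 0 ^ 2 ≤ ∫ s in (0 : ℝ)..1, 2 * (g s ^ 2 + g' s ^ 2) := by
  have c : Continuous g := continuous_iff_continuousAt.2 fun s => (hg s).continuousAt
  have h : ∀ s ∈ uIcc (0 : ℝ) 1, HasDerivAt (fun s => -((1 - s) * g s ^ 2))
      (g s ^ 2 - 2 * ((1 - s) * (g s * g' s))) s := fun s _ => by
    refine ((((hasDerivAt_id s).const_sub 1).mul ((hg s).pow 2)).neg).congr_deriv ?_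
    simp only [Pi.pow_apply, id]; push_cast; ring
  have e := intervalIntegral.integral_eq_sub_of_hasDerivAt h
    (Continuous.intervalIntegrable (by fun_prop) _ _)
  have e' : ∫ s in (0 : ℝ)..1, (g s ^ 2 - 2 * ((1 - s) * (g s * g' s))) = g 0 ^ 2 := by
    rw [e]; simp
  rw [← e']
  refine intervalIntegral.integral_mono_on zero_le_one
    (Continuous.intervalIntegrable (by fun_prop) _ _)
    (Continuous.intervalIntegrable (by fun_prop) _ _) fun s hs => ?_
  have h1 : 0 ≤ 1 - s := sub_nonneg.2 hs.2
  have h2 : 1 - s ≤ 1 := by linarith [hs.1]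
  have h3 : -(2 * ((1 - s) * (g s * g' s))) ≤ (1 - s) * (g s ^ 2 + g' s ^ 2) := by
    have := mul_nonneg h1 (sq_nonneg (g s + g' s))
    linarith
  have h4 : (1 - s) * (g s ^ 2 + g' s ^ 2) ≤ 1 * (g s ^ 2 + g' s ^ 2) :=
    mul_le_mul_of_nonneg_right h2 (by positivity)
  linarith [sq_nonneg (g' s)]

theorem hasDerivAt_comp_toLp_update {f : EuclideanSpace ℝ (Fin n) → ℝ} (hf : Differentiable ℝ f)
    (y : Fin n → ℝ) (i : Fin n) (s : ℝ) :
    HasDerivAt (fun s => f (WithLp.toLp 2 (Function.update y i s)))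
      (dirD (coordDir i) f (WithLp.toLp 2 (Function.update y i s))) s := by
  have e : ∀ s, WithLp.toLp 2 (Function.update y i s) =
      WithLp.toLp 2 (Function.update y i 0) + s • coordDir i := fun s => by
    ext j
    by_cases h : j = i
    · subst h; simp
    · simp [h]
  rw [e s, show (fun s => f (WithLp.toLp 2 (Function.update y i s))) =
    fun s => f (WithLp.toLp 2 (Function.update y i 0) + s • coordDir i) from
    funext fun s => congrArg f (e s)]
  have h1 : HasDerivAt (fun s : ℝ => WithLp.toLp 2 (Function.update y i 0) + s • coordDir i)
      (coordDir i) s := by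
    simpa using ((hasDerivAt_id s).smul_const (coordDir i)).const_add
      (WithLp.toLp 2 (Function.update y i 0))
  exact (hf _).hasFDerivAt.comp_hasDerivAt s h1

theorem ofReal_sq_le_lmarginal {l : List (Fin n)} (hl : l.Nodup)
    {f : EuclideanSpace ℝ (Fin n) → ℝ} (hf : ContDiff ℝ ∞ f) (y : Fin n → ℝ)
    (hy : ∀ j ∈ l, y j = 0) :
    ENNReal.ofReal (f (WithLp.toLp 2 y) ^ 2) ≤
      (∫⋯∫⁻_l.toFinset, (fun z => ENNReal.ofReal (mixedSq l f (WithLp.toLp 2 z)))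
        ∂fun _ => volume.restrict (Icc (0 : ℝ) 1)) y := by
  have cLp : Continuous fun z : Fin n → ℝ => (WithLp.toLp 2 z : EuclideanSpace ℝ (Fin n)) :=
    PiLp.continuous_toLp 2 _
  induction l generalizing f y with
  | nil => simp [mixedSq]
  | cons i l ih =>
    have hil : i ∉ l := (List.nodup_cons.1 hl).1
    have hf' : ContDiff ℝ ∞ (dirD (coordDir i) f) := hf.dirD (by simp) _
    have m : ∀ {g : EuclideanSpace ℝ (Fin n) → ℝ}, ContDiff ℝ ∞ g →
        Measurable fun z : Fin n → ℝ => ENNReal.ofReal (mixedSq l g (WithLp.toLp 2 z)) := fun hg =>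
      ((continuous_mixedSq l hg).comp cLp).measurable.ennreal_ofReal
    have m2 : Measurable fun z : Fin n → ℝ =>
        ENNReal.ofReal (mixedSq (i :: l) f (WithLp.toLp 2 z)) :=
      ((continuous_mixedSq (i :: l) hf).comp cLp).measurable.ennreal_ofReal
    rw [List.toFinset_cons, lmarginal_insert _ m2 (by simpa using hil)]
    have cu : Continuous fun s : ℝ =>
        (WithLp.toLp 2 (Function.update y i s) : EuclideanSpace ℝ (Fin n)) :=
      cLp.comp (continuous_const.update i continuous_id)
    have c1 := hf.continuous.comp cu
    have c2 := hf'.continuous.comp cu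
    have h1 := sq_le_intervalIntegral (hasDerivAt_comp_toLp_update (hf.differentiable (by simp)) y i) c2
    rw [show Function.update y i 0 = y by
      rw [← hy i (by simp)]; exact Function.update_eq_self i y] at h1
    refine (ENNReal.ofReal_le_ofReal h1).trans ?_
    have c3 : Continuous fun s : ℝ => 2 * (f (WithLp.toLp 2 (Function.update y i s)) ^ 2 +
        dirD (coordDir i) f (WithLp.toLp 2 (Function.update y i s)) ^ 2) :=
      continuous_const.mul ((c1.pow 2).add (c2.pow 2))
    rw [intervalIntegral.integral_of_le zero_le_one, ← integral_Icc_eq_integral_Ioc,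
      ofReal_integral_eq_lintegral_ofReal
        (c3.continuousOn.integrableOn_compact isCompact_Icc)
        (ae_of_all _ fun s => by positivity)]
    refine lintegral_mono fun s => ?_
    have hys : ∀ j ∈ l, Function.update y i s j = 0 := fun j hj => by
      have hji : j ≠ i := fun h => hil (h ▸ hj)
      rw [Function.update_of_ne hji]
      exact hy j (by simp [hj])
    have i1 := ih (List.nodup_cons.1 hl).2 hf (Function.update y i s) hys
    have i2 := ih (List.nodup_cons.1 hl).2 hf' (Function.update y i s) hys
    rw [ENNReal.ofReal_mul (by norm_num), ENNReal.ofReal_add (sq_nonneg _) (sq_nonneg _)]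
    refine (mul_le_mul_right (add_le_add i1 i2) _).trans_eq ?_
    simp only [lmarginal]
    rw [← lintegral_add_left, ← lintegral_const_mul]
    · refine lintegral_congr fun z => ?_
      rw [mixedSq, ENNReal.ofReal_mul (by norm_num),
        ENNReal.ofReal_add (mixedSq_nonneg _ _ _) (mixedSq_nonneg _ _ _)]
    · exact ((m hf).comp measurable_updateFinset).add ((m hf').comp measurable_updateFinset)
    · exact (m hf).comp measurable_updateFinset

theorem sq_le_integral_mixedSq {f : EuclideanSpace ℝ (Fin n) → ℝ} (hf : ContDiff ℝ ∞ f) {Q : ℝ}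
    (hQ0 : 0 < Q) (hQ : (n : ℝ) + 1 < Q ^ 2) :
    f 0 ^ 2 ≤ ∫ x in jball n Q, mixedSq (List.finRange n) f x := by
  have h := ofReal_sq_le_lmarginal (List.nodup_finRange n) hf 0 fun _ _ => rfl
  have cm := continuous_mixedSq (List.finRange n) hf
  rw [show (List.finRange n).toFinset = Finset.univ by ext; simp, lmarginal_univ,
    ← Measure.restrict_pi_pi, ← volume_pi] at h
  have hmp := PiLp.volume_preserving_toLp (Fin n)
  have hcube : ∀ y : Fin n → ℝ, y ∈ univ.pi (fun _ => Icc (0 : ℝ) 1) →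
      (WithLp.toLp 2 y : EuclideanSpace ℝ (Fin n)) ∈ jball n Q := fun y hy => by
    have h1 : japanese (WithLp.toLp 2 y : EuclideanSpace ℝ (Fin n)) ^ 2 < Q ^ 2 := by
      rw [japanese_sq, EuclideanSpace.norm_sq_eq]
      have : ∑ i, ‖y i‖ ^ 2 ≤ ∑ i : Fin n, (1 : ℝ) := Finset.sum_le_sum fun i _ => by
        have := hy i (mem_univ i)
        rw [Real.norm_eq_abs, sq_abs]
        exact pow_le_one₀ this.1 this.2
      simp at this ⊢
      linarith
    exact lt_of_pow_lt_pow_left₀ 2 hQ0.le h1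
  have h2 : ENNReal.ofReal (f 0 ^ 2) ≤
      ∫⁻ x in jball n Q, ENNReal.ofReal (mixedSq (List.finRange n) f x) := by
    rw [← hmp.setLIntegral_comp_preimage (measurableSet_jball Q) cm.measurable.ennreal_ofReal]
    refine le_trans ?_ (lintegral_mono_set (s := univ.pi fun _ => Icc (0 : ℝ) 1) hcube)
    exact h
  rw [← ofReal_integral_eq_lintegral_ofReal (integrableOn_jball_of_continuous cm Q)
    (ae_of_all _ fun x => mixedSq_nonneg _ _ _)] at h2
  exact (ENNReal.ofReal_le_ofReal_iff (integral_nonneg fun x => mixedSq_nonneg _ _ _)).1 h2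

theorem exists_integral_mixedSq_le (l : List (Fin n)) {Q t1 : ℝ} (hQ : 0 ≤ Q) (h1 : 0 < t1)
    (h2 : t1 < 1) : ∃ C : ℝ, 0 ≤ C ∧ ∀ V : EuclideanSpace ℝ (Fin n) × ℝ → ℝ, IsBiharmonicSol V →
      ∫ x in jball n Q, mixedSq l (fun y => V (y, 1)) x ≤
        C * ∫ t in t1..1, ∫ x in jball n (Q + l.length + 1), V (x, t) ^ 2 := by
  induction l generalizing t1 with
  | nil =>
    obtain ⟨C, hC, h⟩ := exists_local_energy_le n hQ h1 h2 le_rfl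
    exact ⟨C, hC, fun V hV => by simpa [mixedSq] using (h V hV).1⟩
  | cons i l ih =>
    have h12 : t1 < (t1 + 1) / 2 := by linarith
    have ht2 : (t1 + 1) / 2 < 1 := by linarith
    have hl : (0 : ℝ) ≤ l.length := Nat.cast_nonneg _
    obtain ⟨C, hC, h⟩ := ih h1 h2
    obtain ⟨C', hC', h'⟩ := ih (h1.trans h12) ht2
    obtain ⟨C'', hC'', h''⟩ := exists_local_energy_le n (Q := Q + l.length + 1) (by linarith) h1 h12
      ht2.le
    refine ⟨2 * (C + C' * C''), by positivity, fun V hV => ?_⟩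
    have hU := hV.dirD (coordDir i, 0)
    set U := dirD (coordDir i, (0 : ℝ)) V with hUdef
    have hdV : ∀ {t : ℝ}, 0 < t → ∀ x : EuclideanSpace ℝ (Fin n), DifferentiableAt ℝ V (x, t) :=
      fun ht x => (hV.smooth.contDiffAt (isOpen_upperHalf.mem_nhds
        (show (x, _) ∈ upperHalf n from ht))).differentiableAt (by simp)
    have eU : ∀ {t : ℝ}, 0 < t → dirD (coordDir i) (fun y => V (y, t)) = fun y => U (y, t) :=
      fun ht => funext fun x => dirD_slice (hdV ht x)
    have sV := contDiff_slice hV.smooth one_pos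
    have sU := contDiff_slice hU.smooth one_pos
    have hsub : (univ : Set (EuclideanSpace ℝ (Fin n))) ×ˢ Icc t1 1 ⊆ upperHalf n :=
      fun p hp => h1.trans_le hp.2.1
    have hsub2 : (univ : Set (EuclideanSpace ℝ (Fin n))) ×ˢ Icc ((t1 + 1) / 2) 1 ⊆ upperHalf n :=
      fun p hp => (h1.trans h12).trans_le hp.2.1
    have cV := hV.smooth.continuousOn.mono hsub
    have cU := hU.smooth.continuousOn.mono hsub2
    have cg := (continuousOn_gradSq hV.smooth).mono hsub2
    have e : ∫ x in jball n Q, mixedSq (i :: l) (fun y => V (y, 1)) x =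
        2 * ((∫ x in jball n Q, mixedSq l (fun y => V (y, 1)) x) +
          ∫ x in jball n Q, mixedSq l (fun y => U (y, 1)) x) := by
      simp only [mixedSq, eU one_pos]
      rw [integral_const_mul, integral_add
        (integrableOn_jball_of_continuous (continuous_mixedSq l sV) Q)
        (integrableOn_jball_of_continuous (continuous_mixedSq l sU) Q)]
    have grad : ∫ t in (t1 + 1) / 2..1, ∫ x in jball n (Q + l.length + 1), U (x, t) ^ 2 ≤
        ∫ t in (t1 + 1) / 2..1, ∫ x in jball n (Q + l.length + 1),
          gradSq (fun y => V (y, t)) x := by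
      refine intervalIntegral.integral_mono_on ht2.le
        ((continuousOn_integral_jball (G := fun p => U p ^ 2) _
          (cU.pow 2)).intervalIntegrable_of_Icc ht2.le)
        ((continuousOn_integral_jball _ cg).intervalIntegrable_of_Icc ht2.le) fun t ht => ?_
      have ht0 : 0 < t := (h1.trans h12).trans_le ht.1
      refine integral_jball_mono ((continuous_slice_of_continuousOn cU ht).pow 2)
        (continuous_slice_of_continuousOn cg ht) le_rfl (fun x _ => ?_)
        fun x _ => Finset.sum_nonneg fun j _ => sq_nonneg _
      rw [gradSq_slice hV.smooth ht0]
      exact Finset.single_le_sum (f := fun j => dirD (coordDir j, (0 : ℝ)) V (x, t) ^ 2)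
        (fun j _ => sq_nonneg _) (Finset.mem_univ i)
    have mono : ∫ t in t1..1, ∫ x in jball n (Q + l.length + 1), V (x, t) ^ 2 ≤
        ∫ t in t1..1, ∫ x in jball n (Q + l.length + 1 + 1), V (x, t) ^ 2 := by
      refine intervalIntegral.integral_mono_on h2.le
        ((continuousOn_integral_jball (G := fun p => V p ^ 2) _
          (cV.pow 2)).intervalIntegrable_of_Icc h2.le)
        ((continuousOn_integral_jball (G := fun p => V p ^ 2) _
          (cV.pow 2)).intervalIntegrable_of_Icc h2.le) fun t ht => ?_
      have c := (continuous_slice_of_continuousOn cV ht).pow 2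
      exact integral_jball_mono c c (by linarith) (fun x _ => le_rfl) fun x _ => sq_nonneg _
    rw [e, List.length_cons, show Q + ((l.length + 1 : ℕ) : ℝ) + 1 = Q + l.length + 1 + 1 by
      push_cast; ring]
    have k1 := (h V hV).trans (mul_le_mul_of_nonneg_left mono hC)
    have k2 := (h' U hU).trans (mul_le_mul_of_nonneg_left (grad.trans (h'' V hV).2) hC')
    linarith

theorem exists_sq_le_of_initial (n : ℕ) : ∃ C : ℝ, 0 ≤ C ∧
    ∀ V : EuclideanSpace ℝ (Fin n) × ℝ → ℝ, IsBiharmonicSol V →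
      ContinuousOn V (univ ×ˢ Icc 0 1) → DyadicGrowth V → ∀ M, (∀ x, |V (x, 0)| ≤ M) →
      V (0, 1) ^ 2 ≤ C * M ^ 2 := by
  obtain ⟨C1, hC1, h1⟩ := exists_integral_sq_le_initial n
  obtain ⟨C2, hC2, h2⟩ := exists_integral_mixedSq_le (List.finRange n) (Q := n + 2) (t1 := 1 / 2)
    (by positivity) (by norm_num) (by norm_num)
  set R : ℝ := (n : ℝ) + 2 + (List.finRange n).length + 1 with hR
  refine ⟨C2 * (C1 * Real.exp (4 * R)), by positivity, fun V hV cV hg M hM => ?_⟩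
  have k1 := sq_le_integral_mixedSq (contDiff_slice hV.smooth one_pos) (Q := n + 2) (by positivity)
    (by nlinarith [(Nat.cast_nonneg n : (0 : ℝ) ≤ n)])
  have k2 := k1.trans (h2 V hV)
  have k3 : ∫ t in (1 / 2 : ℝ)..1, ∫ x in jball n R, V (x, t) ^ 2 ≤
      C1 * Real.exp (4 * R) * M ^ 2 := by
    have cV' : ContinuousOn V (univ ×ˢ Icc (1 / 2) 1) :=
      cV.mono (prod_mono subset_rfl (Icc_subset_Icc_left (by norm_num)))
    calc _ ≤ ∫ t in (1 / 2 : ℝ)..1, C1 * Real.exp (4 * R) * M ^ 2 :=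
          intervalIntegral.integral_mono_on (by norm_num)
            ((continuousOn_integral_jball (G := fun p => V p ^ 2) _
              (cV'.pow 2)).intervalIntegrable_of_Icc (by norm_num))
            (by simp) fun t ht =>
              h1 V hV cV hg M hM R t ⟨by linarith [ht.1], ht.2⟩
      _ ≤ _ := by
          have : 0 ≤ C1 * Real.exp (4 * R) * M ^ 2 := by positivity
          rw [intervalIntegral.integral_const, smul_eq_mul]
          linarith
  have k4 := mul_le_mul_of_nonneg_left k3 hC2
  calc _ ≤ _ := k2
    _ ≤ _ := k4
    _ = _ := by ring

end Sobolev

section Scaling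

variable {n : ℕ}

theorem IsBiharmonicHeatSol.isBiharmonicSol {u : EuclideanSpace ℝ (Fin n) → ℝ → ℝ}
    (hu : IsBiharmonicHeatSol u {p | 0 ≤ p.2}) : IsBiharmonicSol fun p => u p.1 p.2 := by
  have hs : ContDiffOn ℝ ∞ (fun p : EuclideanSpace ℝ (Fin n) × ℝ => u p.1 p.2) (upperHalf n) :=
    hu.1.mono fun p hp => le_of_lt (show 0 < p.2 from hp)
  refine ⟨hs, fun p hp => ?_⟩
  have hp0 : 0 < p.2 := hp
  have h1 : HasDerivAt (fun s => u p.1 s) (-(lap (lap (fun y => u y p.2)) p.1)) p.2 :=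
    (hu.2 p hp0.le).hasDerivAt (Ici_mem_nhds hp0)
  have hd : DifferentiableAt ℝ (fun p : EuclideanSpace ℝ (Fin n) × ℝ => u p.1 p.2) (p.1, p.2) :=
    (hs.contDiffAt (isOpen_upperHalf.mem_nhds hp)).differentiableAt (by simp)
  have h2 : HasDerivAt (fun s => u p.1 s) _ p.2 := hd.hasFDerivAt.comp_hasDerivAt p.2
    ((hasDerivAt_const p.2 p.1).prodMk (hasDerivAt_id p.2))
  have h4 : lap (fun y => u y p.2) = fun y => stLap (fun p => u p.1 p.2) (y, p.2) :=
    funext fun y => lap_slice hs hp0 y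
  rw [h4, lap_slice hs.stLap hp0] at h1
  exact h2.unique h1

/-- The affine change of variables `(x, t) ↦ (x₀ + r x, r⁴ t)`. -/
def parabolicMap (x0 : EuclideanSpace ℝ (Fin n)) (r : ℝ) (p : EuclideanSpace ℝ (Fin n) × ℝ) :
    EuclideanSpace ℝ (Fin n) × ℝ := (x0 + r • p.1, r ^ 4 * p.2)

theorem parabolicMap_mem {x0 : EuclideanSpace ℝ (Fin n)} {r : ℝ} (hr : 0 < r)
    {p : EuclideanSpace ℝ (Fin n) × ℝ} (hp : p ∈ upperHalf n) :
    parabolicMap x0 r p ∈ upperHalf n :=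
  mul_pos (pow_pos hr 4) hp

theorem contDiff_parabolicMap (x0 : EuclideanSpace ℝ (Fin n)) (r : ℝ) :
    ContDiff ℝ ∞ (parabolicMap x0 r) := by
  unfold parabolicMap; fun_prop

theorem dirD_parabolicMap {x0 : EuclideanSpace ℝ (Fin n)} {r : ℝ}
    {W : EuclideanSpace ℝ (Fin n) × ℝ → ℝ} {p : EuclideanSpace ℝ (Fin n) × ℝ} (c : ℝ)
    (hW : DifferentiableAt ℝ W (parabolicMap x0 r p)) (e : EuclideanSpace ℝ (Fin n)) (s : ℝ) :
    dirD (e, s) (fun q => c * W (parabolicMap x0 r q)) p =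
      c * fderiv ℝ W (parabolicMap x0 r p) (r • e, r ^ 4 * s) := by
  have hA : HasFDerivAt (parabolicMap x0 r)
      ((r • ContinuousLinearMap.fst ℝ (EuclideanSpace ℝ (Fin n)) ℝ).prod
        (r ^ 4 • ContinuousLinearMap.snd ℝ (EuclideanSpace ℝ (Fin n)) ℝ)) p :=
    ((hasFDerivAt_fst.const_smul r).const_add x0).prodMk (hasFDerivAt_snd.const_mul (r ^ 4))
  have h : HasFDerivAt (fun q => c * W (parabolicMap x0 r q)) _ p :=
    (HasFDerivAt.comp p hW.hasFDerivAt hA).const_mul c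
  rw [dirD, h.fderiv]
  simp

theorem dirD_space_parabolicMap {x0 : EuclideanSpace ℝ (Fin n)} {r : ℝ}
    {W : EuclideanSpace ℝ (Fin n) × ℝ → ℝ} {p : EuclideanSpace ℝ (Fin n) × ℝ} (c : ℝ)
    (hW : DifferentiableAt ℝ W (parabolicMap x0 r p)) (e : EuclideanSpace ℝ (Fin n)) :
    dirD (e, 0) (fun q => c * W (parabolicMap x0 r q)) p =
      c * r * dirD (e, 0) W (parabolicMap x0 r p) := by
  rw [dirD_parabolicMap c hW, dirD,
    show (r • e, r ^ 4 * (0 : ℝ)) = r • ((e, 0) : EuclideanSpace ℝ (Fin n) × ℝ) by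
      simp [Prod.smul_mk], map_smul, smul_eq_mul, mul_assoc]

theorem stLap_parabolicMap {x0 : EuclideanSpace ℝ (Fin n)} {r : ℝ} (hr : 0 < r)
    {W : EuclideanSpace ℝ (Fin n) × ℝ → ℝ} (hW : ContDiffOn ℝ ∞ W (upperHalf n)) (c : ℝ) :
    EqOn (stLap fun q => c * W (parabolicMap x0 r q))
      (fun q => c * r ^ 2 * stLap W (parabolicMap x0 r q)) (upperHalf n) := fun p hp => by
  have h0 := isOpen_upperHalf (n := n)
  have hd : ∀ {W : EuclideanSpace ℝ (Fin n) × ℝ → ℝ}, ContDiffOn ℝ ∞ W (upperHalf n) →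
      ∀ q ∈ upperHalf n, DifferentiableAt ℝ W (parabolicMap x0 r q) := fun hW q hq =>
    (hW.contDiffAt (h0.mem_nhds (parabolicMap_mem hr hq))).differentiableAt (by simp)
  simp only [stLap, Finset.mul_sum]
  refine Finset.sum_congr rfl fun i _ => ?_
  have h1 : EqOn (dirD (coordDir i, 0) fun q => c * W (parabolicMap x0 r q))
      (fun q => c * r * dirD (coordDir i, 0) W (parabolicMap x0 r q)) (upperHalf n) := fun q hq =>
    dirD_space_parabolicMap c (hd hW q hq) _
  rw [h1.dirD h0 _ hp, dirD_space_parabolicMap _ (hd (hW.dirD h0 _) p hp)]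
  ring

theorem IsBiharmonicSol.comp_parabolicMap {U : EuclideanSpace ℝ (Fin n) × ℝ → ℝ}
    (hU : IsBiharmonicSol U) (x0 : EuclideanSpace ℝ (Fin n)) {r : ℝ} (hr : 0 < r) :
    IsBiharmonicSol fun p => U (parabolicMap x0 r p) := by
  refine ⟨hU.smooth.comp (contDiff_parabolicMap x0 r).contDiffOn fun p hp =>
    parabolicMap_mem hr hp, fun p hp => ?_⟩
  have hA := parabolicMap_mem (x0 := x0) hr hp
  have hd : DifferentiableAt ℝ U (parabolicMap x0 r p) :=
    (hU.smooth.contDiffAt (isOpen_upperHalf.mem_nhds hA)).differentiableAt (by simp)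
  have h1 := dirD_parabolicMap 1 hd 0 1
  have h2 := stLap_parabolicMap (x0 := x0) hr hU.smooth 1
  have h3 := stLap_parabolicMap (x0 := x0) hr hU.smooth.stLap (1 * r ^ 2)
  have h4 := (h2.stLap hp).trans (h3 hp)
  simp only [one_mul] at h1 h4
  have h5 := hU.eqn hA
  rw [_root_.dirD] at h5
  have e : ((r • (0 : EuclideanSpace ℝ (Fin n)), r ^ 4 * (1 : ℝ))) =
      r ^ 4 • ((0, 1) : EuclideanSpace ℝ (Fin n) × ℝ) := by simp [Prod.smul_mk]
  rw [h1, e, map_smul, h5]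
  simp only [h4, smul_eq_mul]
  ring

theorem not_summable_of_lintegral_eq_top {L : ℝ → ℝ} (hL : MonotoneOn L (Ici 1))
    (L0 : ∀ r ∈ Ici (1 : ℝ), 0 < L r)
    (h : ∫⁻ r in Ici (1 : ℝ), ENNReal.ofReal (r ^ 3 / L r ^ 3) = ⊤) :
    ¬ Summable fun k : ℕ => (256 : ℝ) ^ k / L (4 ^ k) ^ 3 := fun hs => by
  have h4 : ∀ k : ℕ, (1 : ℝ) ≤ 4 ^ k := fun k => one_le_pow₀ (by norm_num)
  have hsub : Ici (1 : ℝ) ⊆ ⋃ k : ℕ, Ico ((4 : ℝ) ^ k) (4 ^ (k + 1)) := fun r hr => by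
    obtain ⟨k, hk⟩ := exists_nat_pow_near (show 1 ≤ r from hr) (by norm_num : (1 : ℝ) < 4)
    exact mem_iUnion.2 ⟨k, hk⟩
  have piece : ∀ k : ℕ, ∫⁻ r in Ico ((4 : ℝ) ^ k) (4 ^ (k + 1)), ENNReal.ofReal (r ^ 3 / L r ^ 3) ≤
      ENNReal.ofReal (256 * (256 ^ k / L (4 ^ k) ^ 3)) := fun k => by
    have hk := L0 _ (h4 k)
    calc _ ≤ ∫⁻ r in Ico ((4 : ℝ) ^ k) (4 ^ (k + 1)),
          ENNReal.ofReal ((4 ^ (k + 1)) ^ 3 / L (4 ^ k) ^ 3) := by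
          refine setLIntegral_mono' measurableSet_Ico fun r hr => ENNReal.ofReal_le_ofReal ?_
          have hr1 : 1 ≤ r := (h4 k).trans hr.1
          have hLr := hL (h4 k) hr1 hr.1
          exact div_le_div₀ (by positivity) (pow_le_pow_left₀ (by linarith) hr.2.le 3) (by positivity)
            (pow_le_pow_left₀ hk.le hLr 3)
      _ = ENNReal.ofReal ((4 ^ (k + 1)) ^ 3 / L (4 ^ k) ^ 3 * (4 ^ (k + 1) - 4 ^ k)) := by
          rw [lintegral_const, Measure.restrict_apply_univ, Real.volume_Ico,
            ENNReal.ofReal_mul (by positivity)]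
      _ ≤ _ := by
          refine ENNReal.ofReal_le_ofReal ?_
          rw [div_mul_eq_mul_div, ← mul_div_assoc]
          refine div_le_div_of_nonneg_right ?_ (by positivity)
          calc ((4 : ℝ) ^ (k + 1)) ^ 3 * (4 ^ (k + 1) - 4 ^ k) ≤ (4 ^ (k + 1)) ^ 3 * 4 ^ (k + 1) := by
                refine mul_le_mul_of_nonneg_left ?_ (by positivity)
                linarith [h4 k]
            _ = (4 ^ 4) ^ (k + 1) := by rw [← pow_succ, ← pow_mul, ← pow_mul, mul_comm]
            _ = 256 * 256 ^ k := by rw [pow_succ]; norm_num; ring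
  refine (hs.mul_left 256).tsum_ofReal_ne_top (top_le_iff.1 ?_)
  rw [← h]
  exact (lintegral_mono_set hsub).trans
    ((lintegral_iUnion_le _ _).trans (ENNReal.tsum_le_tsum piece))

theorem not_summable_shift_add {L : ℝ → ℝ} (hL : MonotoneOn L (Ici 1))
    (L0 : ∀ r ∈ Ici (1 : ℝ), 0 < L r)
    (h : ¬ Summable fun k : ℕ => (256 : ℝ) ^ k / L (4 ^ k) ^ 3) {K : ℝ} (hK : 0 ≤ K) (j : ℕ) :
    ¬ Summable fun k : ℕ => (256 : ℝ) ^ k / (L (4 ^ (k + j)) + K) ^ 3 := fun hs => h <| by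
  have h4 : ∀ k : ℕ, (1 : ℝ) ≤ 4 ^ k := fun k => one_le_pow₀ (by norm_num)
  have L1 : 0 < L 1 := L0 1 self_mem_Ici
  rw [← summable_nat_add_iff j]
  refine Summable.of_nonneg_of_le (fun k => ?_) (fun k => ?_)
    (hs.mul_left (256 ^ j * (1 + K / L 1) ^ 3))
  · have := L0 _ (h4 (k + j))
    positivity
  · have h1 := L0 _ (h4 (k + j))
    have h2 : L 1 ≤ L (4 ^ (k + j)) := hL self_mem_Ici (h4 _) (h4 _)
    have h3 : L (4 ^ (k + j)) + K ≤ (1 + K / L 1) * L (4 ^ (k + j)) := by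
      have : K ≤ K / L 1 * L (4 ^ (k + j)) := by
        rw [div_mul_eq_mul_div, le_div_iff₀ L1]
        exact mul_le_mul_of_nonneg_left h2 hK
      linarith
    have h5 := pow_le_pow_left₀ (by positivity) h3 3
    rw [mul_div_assoc', div_le_div_iff₀ (by positivity) (by positivity)]
    have h6 := mul_le_mul_of_nonneg_left h5 (by positivity : (0 : ℝ) ≤ 256 ^ (k + j))
    refine h6.trans_eq ?_
    rw [pow_add]; ring

theorem continuousOn_integral_ball {G : EuclideanSpace ℝ (Fin n) × ℝ → ℝ} {a b : ℝ} (R : ℝ)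
    (hG : ContinuousOn G (univ ×ˢ Icc a b)) :
    ContinuousOn (fun t => ∫ x in ball 0 R, G (x, t)) (Icc a b) := by
  obtain ⟨C, hC⟩ := ((isCompact_closedBall (0 : EuclideanSpace ℝ (Fin n)) R).prod
    (isCompact_Icc (a := a) (b := b))).exists_bound_of_continuousOn
    (hG.mono (prod_mono (subset_univ _) subset_rfl))
  refine continuousOn_of_dominated (bound := fun _ => C) ?_ ?_ ?_ ?_
  · exact fun t ht => (continuous_slice_of_continuousOn hG ht).aestronglyMeasurable
  · exact fun t ht => (ae_restrict_iff' measurableSet_ball).2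
      (ae_of_all _ fun x hx => hC (x, t) ⟨ball_subset_closedBall hx, ht⟩)
  · exact integrableOn_const measure_ball_lt_top.ne
  · exact ae_of_all _ fun x => hG.comp (by fun_prop) fun t ht => ⟨mem_univ _, ht⟩

theorem integral_jball_comp_le {f : EuclideanSpace ℝ (Fin n) → ℝ} (hf : Continuous f)
    (f0 : ∀ x, 0 ≤ f x) (x0 : EuclideanSpace ℝ (Fin n)) {r Q R : ℝ} (hr : 0 < r)
    (hR : ‖x0‖ + r * Q ≤ R) :
    ∫ x in jball n Q, f (x0 + r • x) ≤ (r ^ n)⁻¹ * ∫ x in ball 0 R, f x := by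
  set g : EuclideanSpace ℝ (Fin n) → ℝ := (ball 0 R).indicator f with hg
  have ig : Integrable g := (integrable_indicator_iff measurableSet_ball).2
    ((hf.continuousOn.integrableOn_compact (isCompact_closedBall 0 R)).mono_set
      ball_subset_closedBall)
  have g0 : ∀ x, 0 ≤ g x := fun x => indicator_nonneg (fun x _ => f0 x) x
  have e : ∫ x, g (x0 + r • x) = (r ^ n)⁻¹ * ∫ x in ball 0 R, f x := by
    rw [Measure.integral_comp_smul volume (fun x => g (x0 + x)) r, integral_add_left_eq_self,
      finrank_euclideanSpace_fin, abs_of_pos (by positivity), smul_eq_mul,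
      integral_indicator measurableSet_ball]
  rw [← e, ← integral_indicator (measurableSet_jball Q)]
  refine integral_mono_of_nonneg
    (ae_of_all _ fun x => indicator_nonneg (fun x _ => f0 _) x)
    ((ig.comp_add_left x0).comp_smul hr.ne') (ae_of_all _ fun x => ?_)
  by_cases hx : x ∈ jball n Q
  swap
  · rw [indicator_of_notMem hx]
    exact g0 _
  rw [indicator_of_mem hx]
  have hx' : japanese x < Q := hx
  have hb : x0 + r • x ∈ ball (0 : EuclideanSpace ℝ (Fin n)) R := by
    rw [mem_ball_zero_iff]
    calc ‖x0 + r • x‖ ≤ ‖x0‖ + r * ‖x‖ := by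
          simpa [norm_smul, abs_of_pos hr] using norm_add_le x0 (r • x)
      _ < ‖x0‖ + r * Q := by
          have := mul_lt_mul_of_pos_left ((norm_le_japanese x).trans_lt hx') hr
          linarith
      _ ≤ R := hR
  exact (indicator_of_mem hb f).ge

theorem dyadicGrowth_comp_parabolicMap {U : EuclideanSpace ℝ (Fin n) × ℝ → ℝ}
    (cU : ContinuousOn U {p | 0 ≤ p.2}) (x0 : EuclideanSpace ℝ (Fin n)) {r a Rstar : ℝ} (hr : 0 < r)
    (ha : 0 < a) {L : ℝ → ℝ} (hL : MonotoneOn L (Ici 1)) (L0 : ∀ r ∈ Ici (1 : ℝ), 0 < L r)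
    (hs : ∫⁻ r in Ici (1 : ℝ), ENNReal.ofReal (r ^ 3 / L r ^ 3) = ⊤)
    (hg : ∀ R, Rstar ≤ R →
      ∫ t in Ioc (0 : ℝ) (r ^ 4), t ^ a * ∫ x in ball 0 R, U (x, t) ^ 2 ≤ Real.exp (L R)) :
    DyadicGrowth fun p => U (parabolicMap x0 r p) := by
  have h4 : ∀ k : ℕ, (1 : ℝ) ≤ 4 ^ k := fun k => one_le_pow₀ (by norm_num)
  have hr4 : 0 < r ^ 4 := by positivity
  obtain ⟨j, hj⟩ := pow_unbounded_of_one_lt (‖x0‖ + r + |Rstar|) (by norm_num : (1 : ℝ) < 4)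
  set K : ℝ := (r ^ n)⁻¹ * ((r ^ 4) ^ a)⁻¹ * (r ^ 4)⁻¹ with hK
  have hK0 : 0 ≤ K := by positivity
  refine ⟨a, ha, fun k => L (4 ^ (k + j)) + K, fun k => add_pos_of_pos_of_nonneg (L0 _ (h4 _)) hK0,
    not_summable_shift_add hL L0 (not_summable_of_lintegral_eq_top hL L0 hs) hK0 j, fun k => ?_⟩
  set R : ℝ := 4 ^ (k + j) with hR
  have hjR : 4 ^ j ≤ R := pow_le_pow_right₀ (by norm_num) (by omega)
  have hstar : Rstar ≤ R := by linarith [le_abs_self Rstar, norm_nonneg x0]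
  have hball : ‖x0‖ + r * 4 ^ k ≤ R := by
    have h1 : (‖x0‖ + r) * 4 ^ k ≤ 4 ^ j * 4 ^ k :=
      mul_le_mul_of_nonneg_right (by linarith [abs_nonneg Rstar]) (by positivity)
    have h2 := mul_le_mul_of_nonneg_left (h4 k) (norm_nonneg x0)
    rw [hR, pow_add]
    linarith
  have cUt : ∀ t, 0 ≤ t → Continuous fun x => U (x, t) := fun t ht =>
    cU.comp_continuous (by fun_prop) fun _ => ht
  have cV : ContinuousOn (fun p => U (parabolicMap x0 r p)) (univ ×ˢ Icc 0 1) :=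
    cU.comp (contDiff_parabolicMap x0 r).continuous.continuousOn
      fun p hp => mul_nonneg hr4.le hp.2.1
  set Φ : ℝ → ℝ := fun s => ∫ x in ball 0 R, U (x, s) ^ 2 with hΦ
  have cΦ : ContinuousOn Φ (Icc 0 (r ^ 4)) :=
    continuousOn_integral_ball (G := fun p => U p ^ 2) R
      ((cU.mono fun p hp => hp.2.1).pow 2)
  have ct : ContinuousOn (fun t : ℝ => t ^ a) (Icc 0 1) :=
    continuousOn_id.rpow_const fun _ _ => Or.inr ha.le
  have cΦ' : ContinuousOn (fun t => Φ (r ^ 4 * t)) (Icc 0 1) :=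
    cΦ.comp (by fun_prop) fun t ht =>
      ⟨mul_nonneg hr4.le ht.1, mul_le_of_le_one_right hr4.le ht.2⟩
  have hgR := hg R hstar
  rw [← intervalIntegral.integral_of_le hr4.le] at hgR
  calc _ ≤ ∫ t in (0 : ℝ)..1, t ^ a * ((r ^ n)⁻¹ * Φ (r ^ 4 * t)) := by
        refine intervalIntegral.integral_mono_on zero_le_one
          ((ct.mul (continuousOn_integral_jball _ (cV.pow 2))).intervalIntegrable_of_Icc zero_le_one)
          ((ct.mul (continuousOn_const.mul cΦ')).intervalIntegrable_of_Icc zero_le_one)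
          fun t ht => mul_le_mul_of_nonneg_left ?_ (Real.rpow_nonneg ht.1 a)
        exact integral_jball_comp_le ((cUt _ (mul_nonneg hr4.le ht.1)).pow 2)
          (fun x => sq_nonneg _) x0 hr hball
    _ = ∫ t in (0 : ℝ)..1, ((r ^ n)⁻¹ * ((r ^ 4) ^ a)⁻¹) * ((r ^ 4 * t) ^ a * Φ (r ^ 4 * t)) := by
        refine intervalIntegral.integral_congr fun t ht => ?_
        rw [uIcc_of_le zero_le_one] at ht
        have : (r ^ 4) ^ a ≠ 0 := (Real.rpow_pos_of_pos hr4 a).ne'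
        simp only [Real.mul_rpow hr4.le ht.1]
        field_simp
    _ = K * ∫ s in (0 : ℝ)..r ^ 4, s ^ a * Φ s := by
        rw [intervalIntegral.integral_const_mul,
          intervalIntegral.integral_comp_mul_left (fun s => s ^ a * Φ s) hr4.ne', mul_zero, mul_one,
          smul_eq_mul, hK]
        ring
    _ ≤ K * Real.exp (L R) := mul_le_mul_of_nonneg_left hgR hK0
    _ ≤ Real.exp K * Real.exp (L R) :=
        mul_le_mul_of_nonneg_right (by linarith [Real.add_one_le_exp K]) (Real.exp_pos _).le
    _ = _ := by rw [← Real.exp_add, add_comm]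

end Scaling

/-- Uniform `L^∞` estimate for entire solutions of the biharmonic heat equation on ℝⁿ
with bounded initial data (Corollary 1.4 of the paper, Euclidean case): there is a
constant `C = C(n)` such that `sup_x |u(x,t)| ≤ C · sup_x |u(x,0)|` for all `t > 0`,
for any solution in the uniqueness class. -/
theorem biharmonic_heat_uniform_Linfty_estimate (n : ℕ) :
    ∃ C : ℝ, 0 < C ∧
      ∀ u : EuclideanSpace ℝ (Fin n) → ℝ → ℝ,
        IsBiharmonicHeatSol u {p | 0 ≤ p.2} →
        (∀ T : ℝ, 0 < T → ∃ a : ℝ, 0 < a ∧ ∃ Rstar : ℝ, 1 ≤ Rstar ∧ ∃ L : ℝ → ℝ,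
          MonotoneOn L (Set.Ici (1:ℝ)) ∧ (∀ r ∈ Set.Ici (1:ℝ), 0 < L r) ∧
          (∫⁻ r in Set.Ici (1:ℝ), ENNReal.ofReal (r ^ 3 / (L r) ^ 3) = ⊤) ∧
          (∀ R, Rstar ≤ R →
            ∫ t in Set.Ioc (0:ℝ) T, t ^ a * ∫ x in Metric.ball 0 R, (u x t) ^ 2
              ≤ Real.exp (L R))) →
        ∀ M : ℝ, (∀ x, |u x 0| ≤ M) →
          ∀ t : ℝ, 0 < t → ∀ x, |u x t| ≤ C * M := by
  obtain ⟨C, hC, key⟩ := exists_sq_le_of_initial n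
  refine ⟨C + 1, by linarith, fun u hu growth M hM t ht x0 => ?_⟩
  have hM0 : 0 ≤ M := (abs_nonneg _).trans (hM 0)
  obtain ⟨r, hr, rfl⟩ : ∃ r : ℝ, 0 < r ∧ r ^ 4 = t :=
    ⟨t ^ (1 / 4 : ℝ), by positivity, by
      rw [← Real.rpow_natCast, ← Real.rpow_mul ht.le]; norm_num⟩
  obtain ⟨a, ha, Rstar, -, L, hL, L0, hs, hg⟩ := growth _ ht
  have cU : ContinuousOn (fun p : EuclideanSpace ℝ (Fin n) × ℝ => u p.1 p.2) {p | 0 ≤ p.2} :=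
    hu.1.continuousOn
  have cV : ContinuousOn (fun p => (fun p : EuclideanSpace ℝ (Fin n) × ℝ => u p.1 p.2)
      (parabolicMap x0 r p)) (univ ×ˢ Icc 0 1) :=
    cU.comp (contDiff_parabolicMap x0 r).continuous.continuousOn
      fun p hp => mul_nonneg ht.le hp.2.1
  have h := key _ (hu.isBiharmonicSol.comp_parabolicMap x0 hr) cV
    (dyadicGrowth_comp_parabolicMap cU x0 hr ha hL L0 hs hg) M fun x => by
      simpa [parabolicMap] using hM (x0 + r • x)
  simp only [parabolicMap, smul_zero, add_zero, mul_one] at h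
  refine abs_le_of_sq_le_sq (h.trans ?_) (by positivity)
  have : C * M ^ 2 ≤ (C + 1) ^ 2 * M ^ 2 := mul_le_mul_of_nonneg_right (by nlinarith) (sq_nonneg M)
  linarith [mul_pow (C + 1) M 2]
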